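/- arXiv:1410.8189 — 2 statements merged into one kernel-verified Lean document; each statement's English description precedes it below -/
import Mathlib

section
/- There is an absolute constant C > 0 such that for every real y ≥ 10, every α ∈ [−1/2, 1/2) with α ≠ 0, and every real z ≥ 1/|α|, one has |∑_{n ≤ z, P⁺(n) ≤ y} e(nα)/n − ∑_{n ≤ 1/|α|, P⁺(n) ≤ y} 1/n| ≤ C, where both sums are over positive integers n in the stated range all of whose prime factors are at most y. -/
open Real Complex MeasureTheory
open scoped BigOperators

attribute [local instance] Classical.propDecidable

/-- `e(x) = exp(2πix)` -/
noncomputable def e2pi (x : ℝ) : ℂ := Complex.exp (2 * Real.pi * Complex.I * x)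

/-- `∑_{n ≤ x} χ(n)` -/
noncomputable def charSum {q : ℕ} (χ : DirichletCharacter ℂ q) (x : ℝ) : ℂ :=
  ∑ n ∈ Finset.Icc 1 ⌊x⌋₊, χ (n : ZMod q)

/-- `M(χ) = max_{1 ≤ N ≤ q} |∑_{n ≤ N} χ(n)|` -/
noncomputable def Mchi {q : ℕ} (χ : DirichletCharacter ℂ q) : ℝ :=
  ⨆ N ∈ Finset.Icc 1 q, ‖charSum χ (N : ℝ)‖

/-- `m(χ) = π M(χ)/(e^γ √q)` -/
noncomputable def mchi {q : ℕ} (χ : DirichletCharacter ℂ q) : ℝ :=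
  Real.pi * Mchi χ / (Real.exp Real.eulerMascheroniConstant * Real.sqrt q)

/-- the modified Bessel function `I₀` -/
noncomputable def I0 (t : ℝ) : ℝ := ∑' n : ℕ, (t ^ 2 / 4) ^ n / ((n.factorial : ℝ)) ^ 2

/-- the constant `A` -/
noncomputable def Aconst : ℝ :=
  Real.log 2 - 1 - (∫ t in (0:ℝ)..2, Real.log (I0 t) / t ^ 2)
    - ∫ t in Set.Ioi (2:ℝ), (Real.log (I0 t) - t) / t ^ 2

/-- `Φ_q(τ)` -/
noncomputable def Phi (q : ℕ) (τ : ℝ) : ℝ :=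
  (Nat.card {χ : DirichletCharacter ℂ q // χ ≠ 1 ∧ τ < mchi χ} : ℝ) / q.totient

/-- `S_𝒜(χ) = max_{α ∈ [0,1]} |∑_{n ∈ 𝒜} χ(n) e(nα)/n|` -/
noncomputable def SA {q : ℕ} (χ : DirichletCharacter ℂ q) (A : Finset ℕ) : ℝ :=
  ⨆ α : Set.Icc (0:ℝ) 1, ‖∑ n ∈ A, χ (n : ZMod q) * e2pi (n * (α : ℝ)) / n‖

/-- `S_{y,z}(χ)` -/
noncomputable def Syz {q : ℕ} (χ : DirichletCharacter ℂ q) (y z : ℝ) : ℝ :=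
  SA χ ((Finset.Icc 1 ⌊z⌋₊).filter fun n => ∃ p : ℕ, p.Prime ∧ p ∣ n ∧ y < (p : ℝ))

/-- `L(1,χ)` -/
noncomputable def Lone {q : ℕ} (χ : DirichletCharacter ℂ q) : ℂ :=
  ∑' n : ℕ, χ (n : ZMod q) / n

/-- the Gauss sum `G(χ) = ∑_{a=1}^{q} χ(a) e(a/q)` -/
noncomputable def gaussS {q : ℕ} (χ : DirichletCharacter ℂ q) : ℂ :=
  ∑ a ∈ Finset.Icc 1 q, χ (a : ZMod q) * e2pi ((a : ℝ) / q)

/-- the pretentious distance `𝔻(χ, ξ; y)` -/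
noncomputable def Ddist {q D : ℕ} (χ : DirichletCharacter ℂ q) (ξ : DirichletCharacter ℂ D)
    (y : ℝ) : ℝ :=
  Real.sqrt (∑ p ∈ (Finset.Icc 1 ⌊y⌋₊).filter Nat.Prime,
    (1 - (χ (p : ZMod q) * (starRingEnd ℂ) (ξ (p : ZMod D))).re) / p)

namespace SmoothExpSum

open Finset ArithmeticFunction

/-- Squarefree integers up to `D` that are coprime to `q`. -/
def sieveSupport (q D : ℕ) : Finset ℕ :=
  (Icc 1 D).filter fun l => Squarefree l ∧ Nat.Coprime l q

/-- The Selberg sum `∑ 1/φ(l)` over the sieve support. -/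
noncomputable def sieveMass (q D : ℕ) : ℝ := ∑ l ∈ sieveSupport q D, 1 / (Nat.totient l : ℝ)

/-- Diagonalised Selberg weights. -/
noncomputable def diagWeight (q D l : ℕ) : ℝ :=
  (moebius l : ℝ) / (Nat.totient l * sieveMass q D)

/-- Selberg weights divided by the modulus. -/
noncomputable def sieveWeight (q D d : ℕ) : ℝ :=
  ∑ l ∈ sieveSupport q D, if d ∣ l then (moebius (l / d) : ℝ) * diagWeight q D l else 0

lemma mem_sieveSupport {q D l : ℕ} :
    l ∈ sieveSupport q D ↔ (1 ≤ l ∧ l ≤ D) ∧ Squarefree l ∧ Nat.Coprime l q := by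
  simp [sieveSupport]

lemma sieveSupport_of_dvd {q D l d : ℕ} (hl : l ∈ sieveSupport q D) (hd : d ∣ l) :
    d ∈ sieveSupport q D := by
  rw [mem_sieveSupport] at hl ⊢
  obtain ⟨⟨h1, h2⟩, h3, h4⟩ := hl
  exact ⟨⟨Nat.pos_of_dvd_of_pos hd h1, (Nat.le_of_dvd h1 hd).trans h2⟩,
    h3.squarefree_of_dvd hd, h4.coprime_dvd_left hd⟩

lemma one_le_sieveMass (q : ℕ) {D : ℕ} (hD : 1 ≤ D) : 1 ≤ sieveMass q D := by
  have h1 : 1 ∈ sieveSupport q D := by simp [mem_sieveSupport, hD]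
  have := single_le_sum (f := fun l => 1 / (Nat.totient l : ℝ)) (fun i _ => by positivity) h1
  simpa [sieveMass] using this

lemma totient_pos_of_mem {q D l : ℕ} (hl : l ∈ sieveSupport q D) : (0 : ℝ) < Nat.totient l := by
  rw [mem_sieveSupport] at hl
  exact_mod_cast Nat.totient_pos.2 hl.1.1

lemma moebius_sq_of_mem {q D l : ℕ} (hl : l ∈ sieveSupport q D) : (moebius l : ℝ) ^ 2 = 1 := by
  rw [mem_sieveSupport] at hl
  have := moebius_sq_eq_one_of_squarefree hl.2.1
  exact_mod_cast this

lemma sieveWeight_one {q D : ℕ} (hD : 1 ≤ D) : sieveWeight q D 1 = 1 := by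
  have hG := one_le_sieveMass q hD
  have : sieveWeight q D 1 = ∑ l ∈ sieveSupport q D, 1 / (Nat.totient l : ℝ) / sieveMass q D := by
    refine sum_congr rfl fun l hl => ?_
    have h1 := totient_pos_of_mem hl
    have h2 := moebius_sq_of_mem hl
    simp only [one_dvd, if_true, Nat.div_one, diagWeight]
    rw [mul_div_assoc', ← sq, h2]
    field_simp
  rw [this, ← sum_div]
  exact div_self (by unfold sieveMass at hG; positivity)

lemma abs_sieveWeight_le_one {q D : ℕ} (hD : 1 ≤ D) (d : ℕ) : |sieveWeight q D d| ≤ 1 := by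
  have hG := one_le_sieveMass q hD
  have hG0 : 0 < sieveMass q D := by linarith
  calc |sieveWeight q D d|
      ≤ ∑ l ∈ sieveSupport q D, 1 / (Nat.totient l : ℝ) / sieveMass q D := by
        refine (abs_sum_le_sum_abs _ _).trans (sum_le_sum fun l hl => ?_)
        have h1 := totient_pos_of_mem hl
        have hm : ∀ n : ℕ, |(moebius n : ℝ)| ≤ 1 := fun n => by
          exact_mod_cast abs_moebius_le_one (n := n)
        split_ifs with h
        · rw [diagWeight, abs_mul, abs_div, abs_of_pos (mul_pos h1 hG0), div_div]
          calc _ ≤ 1 * (1 / (Nat.totient l * sieveMass q D)) := by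
                gcongr
                · exact hm _
                · exact hm _
            _ = _ := one_mul _
        · rw [abs_zero]; positivity
    _ = 1 := by rw [← sum_div]; exact div_self hG0.ne'

lemma sum_sieveWeight_multiples {q D m : ℕ} (hm : m ∈ sieveSupport q D) :
    ∑ d ∈ sieveSupport q D, (if m ∣ d then sieveWeight q D d else 0) = diagWeight q D m := by
  have hm0 : 0 < m := (mem_sieveSupport.1 hm).1.1
  calc ∑ d ∈ sieveSupport q D, (if m ∣ d then sieveWeight q D d else 0)
      = ∑ l ∈ sieveSupport q D, ∑ d ∈ sieveSupport q D,
          (if m ∣ d ∧ d ∣ l then (moebius (l / d) : ℝ) * diagWeight q D l else 0) := by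
        rw [sum_comm]
        refine sum_congr rfl fun d _ => ?_
        by_cases h : m ∣ d <;> simp [h, sieveWeight]
    _ = ∑ l ∈ sieveSupport q D, (if l = m then diagWeight q D l else 0) := by
        refine sum_congr rfl fun l hl => ?_
        have hl0 : 0 < l := (mem_sieveSupport.1 hl).1.1
        rw [← sum_filter, ← sum_mul]
        by_cases hml : m ∣ l
        · obtain ⟨k, rfl⟩ := hml
          have hk : 0 < k := Nat.pos_of_mul_pos_left hl0
          have : ∑ d ∈ (sieveSupport q D).filter (fun d => m ∣ d ∧ d ∣ m * k),
              (moebius (m * k / d) : ℝ) = ∑ e ∈ k.divisors, (moebius e : ℝ) := by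
            symm
            refine sum_bij' (fun e _ => m * (k / e)) (fun d _ => m * k / d) ?_ ?_ ?_ ?_ ?_
            · intro e he
              have he' := Nat.dvd_of_mem_divisors he
              have hd : m * (k / e) ∣ m * k := Nat.mul_dvd_mul_left _ (Nat.div_dvd_of_dvd he')
              exact mem_filter.2 ⟨sieveSupport_of_dvd hl hd, Dvd.intro _ rfl, hd⟩
            · intro d hd
              obtain ⟨-, ⟨j, rfl⟩, h2⟩ := mem_filter.1 hd
              have hj : j ∣ k := Nat.dvd_of_mul_dvd_mul_left hm0 h2
              rw [Nat.mul_div_mul_left _ _ hm0]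
              exact Nat.mem_divisors.2 ⟨Nat.div_dvd_of_dvd hj, hk.ne'⟩
            · intro e he
              have he' := Nat.dvd_of_mem_divisors he
              rw [Nat.mul_div_mul_left _ _ hm0, Nat.div_div_self he' hk.ne']
            · intro d hd
              obtain ⟨-, ⟨j, rfl⟩, h2⟩ := mem_filter.1 hd
              have hj : j ∣ k := Nat.dvd_of_mul_dvd_mul_left hm0 h2
              rw [Nat.mul_div_mul_left _ _ hm0, Nat.div_div_self hj hk.ne']
            · intro e he
              have he' := Nat.dvd_of_mem_divisors he
              rw [Nat.mul_div_mul_left _ _ hm0, Nat.div_div_self he' hk.ne']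
          rw [this]
          have h2 : ∑ e ∈ k.divisors, (moebius e : ℝ) = if k = 1 then 1 else 0 := by
            rw [← one_apply, ← coe_moebius_mul_coe_zeta, coe_mul_zeta_apply]
            simp
          rw [h2]
          by_cases hk1 : k = 1
          · simp [hk1]
          · have : m * k ≠ m := by
              intro h
              exact hk1 (Nat.eq_of_mul_eq_mul_left hm0 (by simpa using h))
            simp [hk1, this]
        · have hne : l ≠ m := by rintro rfl; exact hml dvd_rfl
          rw [if_neg hne, filter_eq_empty_iff.2 ?_]
          · simp
          · intro d _ h; exact hml (h.1.trans h.2)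
    _ = diagWeight q D m := by rw [sum_ite_eq' _ _ _, if_pos hm]

lemma sieve_quadratic_form {q D : ℕ} (hD : 1 ≤ D) :
    ∑ d ∈ sieveSupport q D, ∑ d' ∈ sieveSupport q D,
      sieveWeight q D d * sieveWeight q D d' * (Nat.gcd d d' : ℝ) = 1 / sieveMass q D := by
  have hG := one_le_sieveMass q hD
  have hG0 : 0 < sieveMass q D := by linarith
  have hgcd : ∀ d ∈ sieveSupport q D, ∀ d' ∈ sieveSupport q D, (Nat.gcd d d' : ℝ) =
      ∑ m ∈ sieveSupport q D, if m ∣ d ∧ m ∣ d' then (Nat.totient m : ℝ) else 0 := by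
    intro d hd d' hd'
    have hd0 : 0 < d := (mem_sieveSupport.1 hd).1.1
    rw [← sum_filter]
    have h1 : ((∑ m ∈ (Nat.gcd d d').divisors, Nat.totient m : ℕ) : ℝ) = (Nat.gcd d d' : ℝ) := by
      rw [Nat.sum_totient]
    rw [← h1, Nat.cast_sum]
    refine sum_congr ?_ fun _ _ => rfl
    ext m
    simp only [Nat.mem_divisors, Nat.dvd_gcd_iff, mem_filter]
    constructor
    · rintro ⟨h, -⟩
      exact ⟨sieveSupport_of_dvd hd h.1, h⟩
    · rintro ⟨-, h⟩
      exact ⟨h, (Nat.gcd_pos_of_pos_left _ hd0).ne'⟩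
  calc _ = ∑ d ∈ sieveSupport q D, ∑ d' ∈ sieveSupport q D, ∑ m ∈ sieveSupport q D,
        (Nat.totient m : ℝ) * ((if m ∣ d then sieveWeight q D d else 0) *
          (if m ∣ d' then sieveWeight q D d' else 0)) := by
        refine sum_congr rfl fun d hd => sum_congr rfl fun d' hd' => ?_
        rw [hgcd d hd d' hd', mul_sum]
        refine sum_congr rfl fun m _ => ?_
        by_cases h1 : m ∣ d <;> by_cases h2 : m ∣ d' <;> simp [h1, h2]
        ring
    _ = ∑ m ∈ sieveSupport q D, (Nat.totient m : ℝ) *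
          (∑ d ∈ sieveSupport q D, if m ∣ d then sieveWeight q D d else 0) ^ 2 := by
        simp_rw [sq, sum_mul_sum, mul_sum]
        rw [sum_congr rfl fun d _ => sum_comm, sum_comm]
    _ = ∑ m ∈ sieveSupport q D, 1 / (Nat.totient m : ℝ) / sieveMass q D ^ 2 := by
        refine sum_congr rfl fun m hm => ?_
        have h1 := totient_pos_of_mem hm
        rw [sum_sieveWeight_multiples hm, diagWeight, div_pow, moebius_sq_of_mem hm]
        field_simp
    _ = 1 / sieveMass q D := by
        rw [← sum_div]
        change sieveMass q D / sieveMass q D ^ 2 = _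
        field_simp

/-- The number of multiples of `d` in an arithmetic progression with modulus coprime to `d`. -/
lemma abs_card_dvd_progression_sub_le {d q : ℕ} (hd : 0 < d) (h : Nat.Coprime d q) (c T : ℕ) :
    |(#{t ∈ range T | d ∣ c + q * t} : ℝ) - T / d| ≤ 1 := by
  obtain ⟨v, hv⟩ : ∃ v : ℕ, ∀ t : ℕ, d ∣ c + q * t ↔ t ≡ v [MOD d] := by
    have : NeZero d := ⟨hd.ne'⟩
    let u := ZMod.unitOfCoprime q h.symm
    refine ⟨(-(u⁻¹ : (ZMod d)ˣ) * (c : ZMod d) : ZMod d).val, fun t => ?_⟩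
    rw [← ZMod.natCast_eq_natCast_iff, ZMod.natCast_zmod_val, ← ZMod.natCast_eq_zero_iff]
    push_cast
    have hu : (q : ZMod d) = (u : ZMod d) := (ZMod.coe_unitOfCoprime q h.symm).symm
    rw [hu]
    constructor
    · intro h0
      have : (t : ZMod d) = (u⁻¹ : (ZMod d)ˣ) * ((u : ZMod d) * t) := by
        rw [← mul_assoc, Units.inv_mul, one_mul]
      rw [this, eq_neg_of_add_eq_zero_right h0]; ring
    · intro h0
      rw [h0, neg_mul, mul_neg, ← mul_assoc, Units.mul_inv, one_mul, add_neg_cancel]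
  have hset : #{t ∈ range T | d ∣ c + q * t} = T.count (· ≡ v [MOD d]) := by
    rw [Nat.count_eq_card_filter_range]
    congr 1
    ext t
    simp [hv]
  rw [hset, Nat.count_modEq_card _ hd]
  have hdiv : (T : ℝ) / d = (T / d : ℕ) + ((T % d : ℕ) : ℝ) / d := by
    have := Nat.div_add_mod T d
    have h2 : (T : ℝ) = d * (T / d : ℕ) + (T % d : ℕ) := by exact_mod_cast this.symm
    field_simp
    linarith
  have hlt : ((T % d : ℕ) : ℝ) / d ≤ 1 := by
    rw [div_le_one (by positivity)]
    exact_mod_cast (Nat.mod_lt _ hd).le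
  have hnn : 0 ≤ ((T % d : ℕ) : ℝ) / d := by positivity
  rw [hdiv, abs_le]
  split_ifs <;> push_cast <;> constructor <;> linarith

/-- Selberg's upper bound for the number of primes in an arithmetic progression. -/
lemma card_primes_progression_le_mass {q D : ℕ} (hD : 1 ≤ D) (c T : ℕ) :
    (#{t ∈ range T | (c + q * t).Prime ∧ D < c + q * t} : ℝ)
      ≤ T / sieveMass q D + D ^ 4 := by
  set A := sieveSupport q D with hA
  set w : ℕ → ℝ := fun d => d * sieveWeight q D d with hw
  have hG0 : 0 < sieveMass q D := by linarith [one_le_sieveMass q hD]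
  have hwle : ∀ d ∈ A, |w d| ≤ D := by
    intro d hd
    have h1 : (d : ℝ) ≤ D := by exact_mod_cast (mem_sieveSupport.1 hd).1.2
    rw [hw, abs_mul, Nat.abs_cast]
    calc (d : ℝ) * |sieveWeight q D d| ≤ D * 1 := by
          gcongr; exact abs_sieveWeight_le_one hD d
      _ = D := mul_one _
  have hsumw : ∑ d ∈ A, |w d| ≤ (D : ℝ) ^ 2 := by
    calc ∑ d ∈ A, |w d| ≤ ∑ d ∈ A, (D : ℝ) := sum_le_sum hwle
      _ = #A * D := by rw [sum_const, nsmul_eq_mul]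
      _ ≤ D * D := by
        gcongr
        calc #A ≤ #(Icc 1 D) := card_filter_le _ _
          _ = D := by simp
      _ = _ := (sq _).symm
  calc (#{t ∈ range T | (c + q * t).Prime ∧ D < c + q * t} : ℝ)
      = ∑ t ∈ range T, if (c + q * t).Prime ∧ D < c + q * t then (1 : ℝ) else 0 := by
        rw [← sum_filter]; simp
    _ ≤ ∑ t ∈ range T, (∑ d ∈ A, if d ∣ c + q * t then w d else 0) ^ 2 := by
        refine sum_le_sum fun t _ => ?_
        split_ifs with h
        · have : ∑ d ∈ A, (if d ∣ c + q * t then w d else 0) = 1 := by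
            rw [sum_eq_single 1]
            · simp [hw, sieveWeight_one hD]
            · intro d hd hd1
              rw [if_neg]
              intro hdvd
              rcases (Nat.dvd_prime h.1).1 hdvd with h3 | h3
              · exact hd1 h3
              · have := (mem_sieveSupport.1 hd).1.2
                omega
            · intro h1
              exact absurd (by simp [hA, mem_sieveSupport, hD]) h1
          rw [this]; norm_num
        · positivity
    _ = ∑ d ∈ A, ∑ d' ∈ A, w d * w d' * (#{t ∈ range T | Nat.lcm d d' ∣ c + q * t} : ℝ) := by
        simp_rw [sq, sum_mul_sum]
        rw [sum_comm]
        refine sum_congr rfl fun d _ => ?_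
        rw [sum_comm]
        refine sum_congr rfl fun d' _ => ?_
        rw [card_filter, Nat.cast_sum, mul_sum]
        refine sum_congr rfl fun t _ => ?_
        by_cases h1 : d ∣ c + q * t <;> by_cases h2 : d' ∣ c + q * t <;>
          simp [h1, h2, Nat.lcm_dvd_iff]
    _ ≤ ∑ d ∈ A, ∑ d' ∈ A, (T * (sieveWeight q D d * sieveWeight q D d' * (Nat.gcd d d' : ℝ))
          + |w d| * |w d'|) := by
        refine sum_le_sum fun d hd => sum_le_sum fun d' hd' => ?_
        have hd1 := mem_sieveSupport.1 hd
        have hd2 := mem_sieveSupport.1 hd'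
        have hl : 0 < Nat.lcm d d' := Nat.lcm_pos hd1.1.1 hd2.1.1
        have hcop : Nat.Coprime (Nat.lcm d d') q :=
          Nat.Coprime.coprime_dvd_left (Nat.lcm_dvd_mul d d') (hd1.2.2.mul_left hd2.2.2)
        have hb := abs_card_dvd_progression_sub_le hl hcop c T
        have hmain : w d * w d' * (T / (Nat.lcm d d' : ℝ)) =
            T * (sieveWeight q D d * sieveWeight q D d' * (Nat.gcd d d' : ℝ)) := by
          have hgl : (Nat.gcd d d' : ℝ) * Nat.lcm d d' = d * d' := by
            exact_mod_cast Nat.gcd_mul_lcm d d'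
          have hl' : (Nat.lcm d d' : ℝ) ≠ 0 := by positivity
          rw [mul_div_assoc', div_eq_iff hl']
          simp only [hw]
          linear_combination (-(T : ℝ) * sieveWeight q D d * sieveWeight q D d') * hgl
        rw [← hmain, ← sub_le_iff_le_add', ← mul_sub, ← abs_mul]
        refine (le_abs_self _).trans ?_
        rw [abs_mul]
        calc _ ≤ |w d * w d'| * 1 := by gcongr
          _ = _ := mul_one _
    _ = T / sieveMass q D + (∑ d ∈ A, |w d|) ^ 2 := by
        simp_rw [sum_add_distrib, ← mul_sum]
        rw [sieve_quadratic_form hD, ← sum_mul, sq]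
        ring
    _ ≤ T / sieveMass q D + D ^ 4 := by
        have : (∑ d ∈ A, |w d|) ^ 2 ≤ ((D : ℝ) ^ 2) ^ 2 := by
          gcongr
        linarith [this, show ((D : ℝ) ^ 2) ^ 2 = D ^ 4 by ring]

lemma totient_eq_mul_prod_real (n : ℕ) :
    (Nat.totient n : ℝ) = n * ∏ p ∈ n.primeFactors, (1 - (p : ℝ)⁻¹) := by
  have h : ((Nat.totient n : ℚ) : ℝ) = ((n * ∏ p ∈ n.primeFactors, (1 - (p : ℚ)⁻¹) : ℚ) : ℝ) := by
    rw [Nat.totient_eq_mul_prod_factors]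
  push_cast at h
  exact h

lemma prod_inv_one_sub_inv_primeFactors {n : ℕ} (hn : 0 < n) :
    ∏ p ∈ n.primeFactors, (1 - (p : ℝ)⁻¹)⁻¹ = n / Nat.totient n := by
  have h := totient_eq_mul_prod_real n
  have hφ : (0 : ℝ) < Nat.totient n := by exact_mod_cast Nat.totient_pos.2 hn
  rw [prod_inv_distrib, eq_div_iff hφ.ne', h]
  have : ∏ p ∈ n.primeFactors, (1 - (p : ℝ)⁻¹) ≠ 0 := by
    intro h0
    rw [h0, mul_zero] at h
    exact hφ.ne' h
  rw [mul_comm (n : ℝ), inv_mul_cancel_left₀ this]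

lemma sum_inv_factoredNumbers_le {n : ℕ} (hn : 0 < n) (S : Finset ℕ)
    (hS : ∀ m ∈ S, m ∈ Nat.factoredNumbers n.primeFactors) :
    ∑ m ∈ S, (m : ℝ)⁻¹ ≤ n / Nat.totient n := by
  let f : ℕ →* ℝ :=
    { toFun := fun m => (m : ℝ)⁻¹
      map_one' := by simp
      map_mul' := fun a b => by push_cast; rw [mul_inv] }
  have h1 := (EulerProduct.summable_and_hasSum_factoredNumbers_prod_filter_prime_geometric
    (f := f) (fun {p} hp => by
      change ‖(p : ℝ)⁻¹‖ < 1
      rw [norm_inv, Real.norm_natCast]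
      exact inv_lt_one_of_one_lt₀ (by exact_mod_cast hp.one_lt)) n.primeFactors).2
  have h2 : ∏ p ∈ n.primeFactors with p.Prime, (1 - f p)⁻¹ = n / Nat.totient n := by
    rw [← prod_inv_one_sub_inv_primeFactors hn, filter_true_of_mem]
    · rfl
    · intro p hp; exact Nat.prime_of_mem_primeFactors hp
  rw [h2] at h1
  have h3 := (hasSum_subtype_iff_indicator (f := fun m : ℕ => (m : ℝ)⁻¹)).1 h1
  have h4 := sum_le_hasSum S (fun m _ => by
    by_cases hm : m ∈ Nat.factoredNumbers n.primeFactors <;> simp [hm]) h3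
  refine le_trans (le_of_eq ?_) h4
  refine sum_congr rfl fun m hm => ?_
  rw [Set.indicator_of_mem (hS m hm)]

/-- Lower bound for the Selberg sum. -/
lemma log_le_mul_sieveMass {q : ℕ} (hq : 0 < q) (D : ℕ) :
    Real.log (D + 1) ≤ q / Nat.totient q * sieveMass q D := by
  set r : ℕ → ℕ := fun n => ∏ p ∈ n.primeFactors with ¬ p ∣ q, p with hr
  have hrdvd : ∀ n, r n ∣ n := fun n =>
    (prod_dvd_prod_of_subset _ _ _ (filter_subset _ _)).trans (Nat.prod_primeFactors_dvd n)
  have hmaps : ∀ n ∈ Icc 1 D, r n ∈ sieveSupport q D := by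
    intro n hn
    rw [mem_Icc] at hn
    have hp : ∀ p ∈ n.primeFactors.filter (fun p => ¬ p ∣ q), p.Prime := fun p hp =>
      Nat.prime_of_mem_primeFactors (mem_filter.1 hp).1
    refine mem_sieveSupport.2 ⟨⟨Nat.pos_of_dvd_of_pos (hrdvd n) hn.1,
      (Nat.le_of_dvd hn.1 (hrdvd n)).trans hn.2⟩, ?_, ?_⟩
    · have hsq : Squarefree (∏ p ∈ n.primeFactors, p) := by
        refine Finset.squarefree_prod_of_pairwise_isCoprime ?_ ?_
        rotate_left
        · intro p hp; exact (Nat.prime_of_mem_primeFactors hp).squarefree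
        · intro a ha b hb hab
          simp only [Function.onFun]
          exact Nat.coprime_iff_isRelPrime.1 ((Nat.coprime_primes (Nat.prime_of_mem_primeFactors ha)
            (Nat.prime_of_mem_primeFactors hb)).2 hab)
      exact hsq.squarefree_of_dvd (prod_dvd_prod_of_subset _ _ _ (filter_subset _ _))
    · refine Nat.Coprime.prod_left fun p hp' => ?_
      exact (Nat.Prime.coprime_iff_not_dvd (hp p hp')).2 (mem_filter.1 hp').2
  have hharm : Real.log (D + 1) ≤ ∑ n ∈ Icc 1 D, (n : ℝ)⁻¹ := by
    have := log_add_one_le_harmonic D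
    rw [harmonic_eq_sum_Icc] at this
    push_cast at this
    exact this
  refine hharm.trans ?_
  rw [← sum_fiberwise_of_maps_to hmaps, sieveMass, mul_sum]
  refine sum_le_sum fun l hl => ?_
  have hl0 : 0 < l := (mem_sieveSupport.1 hl).1.1
  have hcop := (mem_sieveSupport.1 hl).2.2
  have hφl := totient_pos_of_mem hl
  have hφq : (0 : ℝ) < Nat.totient q := by exact_mod_cast Nat.totient_pos.2 hq
  set S := (Icc 1 D).filter fun n => r n = l with hS
  have hinj : Set.InjOn (fun n => n / l) (S : Set ℕ) := by
    intro a ha b hb hab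
    have ha' : l ∣ a := by
      have := hrdvd a; rwa [(mem_filter.1 (mem_coe.1 ha)).2] at this
    have hb' : l ∣ b := by
      have := hrdvd b; rwa [(mem_filter.1 (mem_coe.1 hb)).2] at this
    simp only at hab
    rw [← Nat.div_mul_cancel ha', ← Nat.div_mul_cancel hb', hab]
  calc ∑ n ∈ S, (n : ℝ)⁻¹ = (l : ℝ)⁻¹ * ∑ m ∈ S.image (fun n => n / l), (m : ℝ)⁻¹ := by
        rw [sum_image hinj, mul_sum]
        refine sum_congr rfl fun n hn => ?_
        have hn' : l ∣ n := by
          have := hrdvd n; rwa [(mem_filter.1 hn).2] at this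
        rw [← mul_inv, ← Nat.cast_mul, Nat.mul_div_cancel' hn']
    _ ≤ (l : ℝ)⁻¹ * ((l * q : ℕ) / Nat.totient (l * q)) := by
        gcongr
        refine sum_inv_factoredNumbers_le (Nat.mul_pos hl0 hq) _ fun m hm => ?_
        obtain ⟨n, hn, rfl⟩ := mem_image.1 hm
        obtain ⟨hn1, hn2⟩ := mem_filter.1 hn
        have hn0 : 0 < n := (mem_Icc.1 hn1).1
        have hn' : l ∣ n := by
          have := hrdvd n; rwa [hn2] at this
        refine Nat.mem_factoredNumbers'.2 fun p hp hpd => ?_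
        have hpn : p ∣ n := hpd.trans (Nat.div_dvd_of_dvd hn')
        rw [Nat.mem_primeFactors]
        refine ⟨hp, ?_, (Nat.mul_pos hl0 hq).ne'⟩
        by_cases hpq : p ∣ q
        · exact hpq.mul_left _
        · refine Dvd.dvd.mul_right ?_ _
          rw [← hn2]
          exact dvd_prod_of_mem (fun p => p)
            (mem_filter.2 ⟨Nat.mem_primeFactors.2 ⟨hp, hpn, hn0.ne'⟩, hpq⟩)
    _ = q / Nat.totient q * (1 / Nat.totient l) := by
        rw [Nat.totient_mul hcop]
        push_cast
        have : (l : ℝ) ≠ 0 := by positivity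
        field_simp

/-- A Brun–Titchmarsh type bound. -/
lemma card_primes_progression_le {q : ℕ} (hq : 0 < q) {D : ℕ} (hD : 1 ≤ D) (c T : ℕ) :
    (#{t ∈ range T | (c + q * t).Prime ∧ D < c + q * t} : ℝ)
      ≤ T * (q / Nat.totient q) / Real.log (D + 1) + D ^ 4 := by
  refine (card_primes_progression_le_mass hD c T).trans ?_
  have hG0 : 0 < sieveMass q D := by linarith [one_le_sieveMass q hD]
  have hl : 0 < Real.log (D + 1) := Real.log_pos (by
    have : (1 : ℝ) ≤ D := by exact_mod_cast hD
    linarith)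
  refine add_le_add_left ?_ _
  rw [div_le_div_iff₀ hG0 hl, mul_assoc]
  gcongr
  exact log_le_mul_sieveMass hq D

lemma card_squarefree_divisors_le (q : ℕ) :
    #{d ∈ q.divisors | Squarefree d} ≤ 2 ^ #q.primeFactors := by
  rw [← card_powerset]
  refine card_le_card_of_injOn Nat.primeFactors ?_ ?_
  · intro d hd
    simp only [coe_filter, Nat.mem_divisors, Set.mem_ofPred_eq] at hd
    exact mem_coe.2 (mem_powerset.2 (Nat.primeFactors_mono hd.1.1 hd.1.2))
  · intro a ha b hb hab
    simp only [coe_filter, Nat.mem_divisors, Set.mem_ofPred_eq] at ha hb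
    rw [← Nat.prod_primeFactors_of_squarefree ha.2, ← Nat.prod_primeFactors_of_squarefree hb.2, hab]

lemma sum_abs_moebius_divisors_le (q : ℕ) :
    ∑ d ∈ q.divisors, |(moebius d : ℝ)| ≤ 2 ^ #q.primeFactors := by
  have h : ∀ d ∈ q.divisors, |(moebius d : ℝ)| ≤ if Squarefree d then (1 : ℝ) else 0 := by
    intro d _
    split_ifs with hd
    · exact_mod_cast abs_moebius_le_one (n := d)
    · simp [moebius_eq_zero_of_not_squarefree hd]
  refine (sum_le_sum h).trans ?_
  rw [← sum_filter, sum_const, nsmul_eq_mul, mul_one]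
  exact_mod_cast card_squarefree_divisors_le q

lemma totient_div_self_eq_sum_moebius {q : ℕ} (hq : 0 < q) :
    (Nat.totient q : ℝ) / q = ∑ d ∈ q.divisors, (moebius d : ℝ) / d := by
  have h := (sum_eq_iff_sum_mul_moebius_eq (R := ℝ) (f := fun n => (Nat.totient n : ℝ))
    (g := fun n => (n : ℝ))).1 (fun n _ => by exact_mod_cast Nat.sum_totient n) q hq
  rw [← h, Nat.sum_divisorsAntidiagonal (fun a b => (moebius a : ℝ) * (b : ℝ)), sum_div]
  refine sum_congr rfl fun d hd => ?_
  have hdv := Nat.dvd_of_mem_divisors hd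
  have hd0 : (d : ℝ) ≠ 0 := by exact_mod_cast (Nat.pos_of_mem_divisors hd).ne'
  have hq0 : (q : ℝ) ≠ 0 := by exact_mod_cast hq.ne'
  rw [Nat.cast_div hdv hd0]
  field_simp

lemma two_pow_mul_sqrt_le_totient {q : ℕ} (hq : 0 < q) :
    (2 : ℝ) ^ #q.primeFactors * √q ≤ 4 ^ 6 * Nat.totient q := by
  have hpp : ∀ p ∈ q.primeFactors, 2 ≤ p := fun p hp => (Nat.prime_of_mem_primeFactors hp).two_le
  have hprod0 : ∀ p ∈ q.primeFactors, (0 : ℝ) < 1 - (p : ℝ)⁻¹ := by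
    intro p hp
    have : (2 : ℝ) ≤ p := by exact_mod_cast hpp p hp
    have : (p : ℝ)⁻¹ ≤ 2⁻¹ := by gcongr
    linarith [show (2 : ℝ)⁻¹ = 1 / 2 by norm_num]
  have h1 : (2 : ℝ) ^ #q.primeFactors ≤
      ∏ p ∈ q.primeFactors, ((√p * (if p ≤ 6 then 4 else 1)) * (1 - (p : ℝ)⁻¹)) := by
    rw [← prod_const]
    refine prod_le_prod (fun _ _ => by norm_num) fun p hp => ?_
    have h2 : (2 : ℝ) ≤ p := by exact_mod_cast hpp p hp
    split_ifs with h
    · have hs : (1 : ℝ) ≤ √p := Real.one_le_sqrt.2 (by linarith)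
      have : (p : ℝ)⁻¹ ≤ 2⁻¹ := by gcongr
      nlinarith [hprod0 p hp]
    · have h7 : (7 : ℝ) ≤ p := by exact_mod_cast (by omega : 7 ≤ p)
      have hs : (2.5 : ℝ) ≤ √p := Real.le_sqrt_of_sq_le (by nlinarith)
      have : (p : ℝ)⁻¹ ≤ 7⁻¹ := by gcongr
      nlinarith [hprod0 p hp]
  have h2 : ∏ p ∈ q.primeFactors, √(p : ℝ) ≤ √q := by
    have : ∏ p ∈ q.primeFactors, √(p : ℝ) = √((∏ p ∈ q.primeFactors, p : ℕ) : ℝ) := by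
      push_cast
      rw [Real.sqrt_eq_rpow, ← Real.finsetProd_rpow _ _ (fun i _ => by positivity)]
      refine prod_congr rfl fun p _ => by rw [Real.sqrt_eq_rpow]
    rw [this]
    refine Real.sqrt_le_sqrt ?_
    exact_mod_cast Nat.le_of_dvd hq (Nat.prod_primeFactors_dvd q)
  have h3 : ∏ p ∈ q.primeFactors, (if p ≤ 6 then (4 : ℝ) else 1) ≤ 4 ^ 6 := by
    rw [← prod_filter, prod_const]
    refine pow_le_pow_right₀ (by norm_num) ?_
    calc #{p ∈ q.primeFactors | p ≤ 6} ≤ #(Icc 1 6) := by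
          refine card_le_card fun p hp => ?_
          rw [mem_filter] at hp
          exact mem_Icc.2 ⟨by linarith [hpp p hp.1], hp.2⟩
      _ = 6 := by simp
  have hpos : 0 ≤ ∏ p ∈ q.primeFactors, (1 - (p : ℝ)⁻¹) := prod_nonneg fun p hp => (hprod0 p hp).le
  rw [prod_mul_distrib, prod_mul_distrib] at h1
  calc (2 : ℝ) ^ #q.primeFactors * √q
      ≤ (√q * 4 ^ 6 * ∏ p ∈ q.primeFactors, (1 - (p : ℝ)⁻¹)) * √q := by
        gcongr
        refine h1.trans ?_
        gcongr
    _ = 4 ^ 6 * Nat.totient q := by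
        rw [totient_eq_mul_prod_real]
        have : √(q : ℝ) * √q = q := Real.mul_self_sqrt (by positivity)
        linear_combination (4 ^ 6 * ∏ p ∈ q.primeFactors, (1 - (p : ℝ)⁻¹)) * this

lemma mem_Icc_floor_ceil {x y : ℝ} {r : ℤ} : r ∈ Icc (⌊x⌋ + 1) (⌈y⌉ - 1) ↔ x < r ∧ (r : ℝ) < y := by
  rw [mem_Icc, Int.add_one_le_iff, Int.floor_lt, Int.le_sub_one_iff, Int.lt_ceil]

lemma abs_card_dvd_Ioo_sub_le {d : ℕ} (hd : 0 < d) (x : ℝ) {L : ℝ} (hL : 0 ≤ L) :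
    |(#{r ∈ Icc (⌊x⌋ + 1) (⌈x + L⌉ - 1) | (d : ℤ) ∣ r} : ℝ) - L / d| ≤ 1 := by
  have hd' : (0 : ℝ) < d := by exact_mod_cast hd
  have h1 : #{r ∈ Icc (⌊x⌋ + 1) (⌈x + L⌉ - 1) | (d : ℤ) ∣ r} =
      #(Icc (⌊x / d⌋ + 1) (⌈(x + L) / d⌉ - 1)) := by
    symm
    refine card_bij (fun k _ => d * k) ?_ ?_ ?_
    · intro k hk
      rw [mem_Icc_floor_ceil, div_lt_iff₀ hd', lt_div_iff₀ hd'] at hk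
      rw [mem_filter, mem_Icc_floor_ceil]
      push_cast
      exact ⟨⟨by linarith [hk.1], by linarith [hk.2]⟩, Dvd.intro _ rfl⟩
    · intro a _ b _ h
      have : (d : ℤ) ≠ 0 := by exact_mod_cast hd.ne'
      exact mul_left_cancel₀ this h
    · intro r hr
      obtain ⟨hr1, k, rfl⟩ := mem_filter.1 hr
      rw [mem_Icc_floor_ceil] at hr1
      push_cast at hr1
      refine ⟨k, ?_, rfl⟩
      rw [mem_Icc_floor_ceil, div_lt_iff₀ hd', lt_div_iff₀ hd']
      exact ⟨by linarith [hr1.1], by linarith [hr1.2]⟩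
  rw [h1, Int.card_Icc]
  have e1 := Int.floor_le (x / d)
  have e2 := Int.lt_floor_add_one (x / d)
  have e3 := Int.le_ceil ((x + L) / d)
  have e4 := Int.ceil_lt_add_one ((x + L) / d)
  have e5 : (x + L) / d = x / d + L / d := add_div _ _ _
  have e6 : 0 ≤ L / d := by positivity
  have hcast : (((⌈(x + L) / d⌉ - 1 + 1 - (⌊x / d⌋ + 1)).toNat : ℤ) : ℝ) =
      max ((⌈(x + L) / d⌉ : ℝ) - ⌊x / d⌋ - 1) 0 := by
    rw [Int.toNat_eq_max]
    push_cast
    congr 1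
    ring
  rw [Int.cast_natCast] at hcast
  rw [hcast, abs_le]
  constructor
  · have := le_max_left ((⌈(x + L) / d⌉ : ℝ) - ⌊x / d⌋ - 1) 0
    linarith
  · have : max ((⌈(x + L) / d⌉ : ℝ) - ⌊x / d⌋ - 1) 0 ≤ L / d + 1 := max_le (by linarith) (by linarith)
    linarith

/-- Legendre's bound for the number of integers in an interval that are coprime to `q`. -/
lemma card_coprime_Ioo_le {q : ℕ} (hq : 0 < q) (x : ℝ) {L : ℝ} (hL : 0 ≤ L) :
    (#{r ∈ Icc (⌊x⌋ + 1) (⌈x + L⌉ - 1) | Int.gcd r q = 1} : ℝ) ≤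
      L * (Nat.totient q / q) + 2 ^ #q.primeFactors := by
  set S := Icc (⌊x⌋ + 1) (⌈x + L⌉ - 1)
  have h1 : (#{r ∈ S | Int.gcd r q = 1} : ℝ) =
      ∑ d ∈ q.divisors, (moebius d : ℝ) * #{r ∈ S | (d : ℤ) ∣ r} := by
    calc (#{r ∈ S | Int.gcd r q = 1} : ℝ)
        = ∑ r ∈ S, ∑ d ∈ q.divisors, if (d : ℤ) ∣ r then (moebius d : ℝ) else 0 := by
          rw [card_filter, Nat.cast_sum]
          refine sum_congr rfl fun r _ => ?_
          have hg : 0 < Int.gcd r q := Int.gcd_pos_of_ne_zero_right _ (by exact_mod_cast hq.ne')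
          have h2 : ∑ e ∈ (Int.gcd r q).divisors, (moebius e : ℝ) =
              if Int.gcd r q = 1 then 1 else 0 := by
            rw [← one_apply, ← coe_moebius_mul_coe_zeta, coe_mul_zeta_apply]
            simp
          rw [← sum_filter]
          have h3 : q.divisors.filter (fun d : ℕ => (d : ℤ) ∣ r) = (Int.gcd r q).divisors := by
            ext d
            simp only [mem_filter, Nat.mem_divisors]
            constructor
            · rintro ⟨⟨h, -⟩, h'⟩
              exact ⟨Int.dvd_gcd h' (by exact_mod_cast h), hg.ne'⟩
            · rintro ⟨h, -⟩
              have h4 : (d : ℤ) ∣ (Int.gcd r q : ℤ) := by exact_mod_cast h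
              exact ⟨⟨by exact_mod_cast h4.trans (Int.gcd_dvd_right _ _), hq.ne'⟩,
                h4.trans (Int.gcd_dvd_left _ _)⟩
          rw [h3, h2]
          push_cast
          rfl
      _ = _ := by
          rw [sum_comm]
          refine sum_congr rfl fun d _ => ?_
          rw [← sum_filter, sum_const, nsmul_eq_mul, mul_comm]
  calc (#{r ∈ S | Int.gcd r q = 1} : ℝ)
      ≤ ∑ d ∈ q.divisors, (L * ((moebius d : ℝ) / d) + |(moebius d : ℝ)|) := by
        rw [h1]
        refine sum_le_sum fun d hd => ?_
        have hb := abs_card_dvd_Ioo_sub_le (Nat.pos_of_mem_divisors hd) x hL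
        have h5 : (moebius d : ℝ) * ((#{r ∈ S | (d : ℤ) ∣ r} : ℝ) - L / d) ≤ |(moebius d : ℝ)| := by
          refine (le_abs_self _).trans ?_
          rw [abs_mul]
          exact mul_le_of_le_one_right (abs_nonneg _) hb
        have h6 : L * ((moebius d : ℝ) / d) = (moebius d : ℝ) * (L / d) := by ring
        rw [h6]
        linarith
    _ ≤ _ := by
        rw [sum_add_distrib, ← mul_sum, ← totient_div_self_eq_sum_moebius hq]
        gcongr
        exact sum_abs_moebius_divisors_le q

/-- The distance from a real number to the nearest integer. -/
noncomputable def distInt (x : ℝ) : ℝ := |x - round x|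

lemma distInt_nonneg (x : ℝ) : 0 ≤ distInt x := abs_nonneg _

lemma distInt_le (x : ℝ) (m : ℤ) : distInt x ≤ |x - m| := round_le x m

lemma distInt_add_le (x y : ℝ) (m : ℤ) : distInt (x + y) ≤ distInt x + |y - m| := by
  refine (distInt_le (x + y) (round x + m)).trans ?_
  push_cast
  rw [show x + y - (round x + m) = (x - round x) + (y - m) by ring]
  exact abs_add_le _ _

lemma abs_residue_add_lt {q : ℕ} (hq : 0 < q) {α ε : ℝ} {n : ℕ} (a : ℤ)
    (h : distInt (n * α) < ε) :
    |((n * a - round (n * α) * q : ℤ) : ℝ) + n * (q * α - a)| < q * ε := by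
  have hq' : (0 : ℝ) < q := by exact_mod_cast hq
  have : ((n * a - round (n * α) * q : ℤ) : ℝ) + n * (q * α - a) = q * (n * α - round (n * α)) := by
    push_cast
    ring
  rw [this, abs_mul, abs_of_pos hq']
  exact mul_lt_mul_of_pos_left h hq'

lemma gcd_residue {q n : ℕ} {a : ℤ} (ha : IsCoprime a q) (hn : n.Coprime q) (m : ℤ) :
    Int.gcd (n * a - m * q) q = 1 := by
  rw [← Int.isCoprime_iff_gcd_eq_one]
  have h1 : IsCoprime ((n : ℤ) * a) q := (Nat.isCoprime_iff_coprime.2 hn).mul_left ha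
  have := h1.add_mul_right_left (-m)
  rwa [show (n : ℤ) * a + -m * (q : ℤ) = n * a - m * q by ring] at this

lemma modEq_of_residue_eq {q n n' : ℕ} {a : ℤ} (ha : IsCoprime a q) {m m' : ℤ}
    (h : (n * a - m * q : ℤ) = n' * a - m' * q) : n ≡ n' [MOD q] := by
  rw [← Int.natCast_modEq_iff, Int.modEq_iff_dvd]
  have h1 : (q : ℤ) ∣ ((n' : ℤ) - n) * a := ⟨m' - m, by linear_combination -h⟩
  exact ha.symm.dvd_of_dvd_mul_right h1

lemma card_near_coprime_le {q : ℕ} (hq : 0 < q) {a : ℤ} (ha : IsCoprime a q) {α ε : ℝ}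
    (hη : |q * α - a| ≤ 1 / q) (hε : 1 / (4 * q) ≤ ε) {M : ℕ} {S : Finset ℕ}
    (hM : ∀ n ∈ S, n ≤ M) (hS : ∀ n ∈ S, n.Coprime q) (hd : ∀ n ∈ S, distInt (n * α) < ε) :
    (#S : ℝ) ≤ (M / q + 1) * (10 * ε * Nat.totient q + 2 ^ #q.primeFactors) := by
  have hq' : (0 : ℝ) < q := by exact_mod_cast hq
  have hq1 : (1 : ℝ) ≤ q := by exact_mod_cast hq
  have hε0 : 0 < ε := lt_of_lt_of_le (by positivity) hε
  set η := q * α - a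
  have hfib : ∀ k ∈ range (M / q + 1), (#{n ∈ S | n / q = k} : ℝ) ≤
      10 * ε * Nat.totient q + 2 ^ #q.primeFactors := by
    intro k _
    have hcard : #{n ∈ S | n / q = k} ≤
        #{r ∈ Icc (⌊-(k * q * η) - 5 * q * ε⌋ + 1) (⌈-(k * q * η) - 5 * q * ε + 10 * q * ε⌉ - 1) |
          Int.gcd r q = 1} := by
      refine card_le_card_of_injOn (fun n => (n * a - round (n * α) * q : ℤ)) ?_ ?_
      · intro n hn
        obtain ⟨hnS, hnk⟩ := mem_filter.1 (mem_coe.1 hn)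
        rw [mem_coe, mem_filter, mem_Icc_floor_ceil]
        refine ⟨?_, gcd_residue ha (hS n hnS) _⟩
        have h1 := abs_residue_add_lt hq a (hd n hnS)
        have h2 : (n : ℝ) = k * q + (n % q : ℕ) := by
          rw [← hnk]
          exact_mod_cast (Nat.div_add_mod' n q).symm
        have h3 : |((n % q : ℕ) : ℝ) * η| ≤ 4 * q * ε := by
          rw [abs_mul, Nat.abs_cast]
          have h4 : ((n % q : ℕ) : ℝ) ≤ q := by exact_mod_cast (Nat.mod_lt n hq).le
          calc ((n % q : ℕ) : ℝ) * |η| ≤ q * (1 / q) := by gcongr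
            _ = 4 * q * (1 / (4 * q)) := by field_simp
            _ ≤ 4 * q * ε := by gcongr
        have h5 : (n : ℝ) * η = k * q * η + (n % q : ℕ) * η := by
          rw [← add_mul, ← h2]
        change |_ + (n : ℝ) * η| < _ at h1
        rw [h5] at h1
        obtain ⟨h6, h7⟩ := abs_lt.1 h1
        obtain ⟨h8, h9⟩ := abs_le.1 h3
        exact ⟨by linarith, by linarith⟩
      · intro n hn n' hn' h
        have e1 := (mem_filter.1 (mem_coe.1 hn)).2
        have e2 := (mem_filter.1 (mem_coe.1 hn')).2
        have := modEq_of_residue_eq ha h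
        rw [← Nat.div_add_mod n q, ← Nat.div_add_mod n' q, e1, e2, this]
    have h := card_coprime_Ioo_le hq (-(k * q * η) - 5 * q * ε) (L := 10 * q * ε) (by positivity)
    calc (#{n ∈ S | n / q = k} : ℝ) ≤ _ := by exact_mod_cast hcard
      _ ≤ _ := h
      _ = _ := by field_simp
  have hmap : ∀ n ∈ S, n / q ∈ range (M / q + 1) := fun n hn =>
    mem_range.2 (Nat.lt_succ_of_le (Nat.div_le_div_right (hM n hn)))
  rw [card_eq_sum_card_fiberwise hmap]
  push_cast
  refine (sum_le_sum hfib).trans ?_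
  rw [sum_const, card_range, nsmul_eq_mul]
  push_cast
  gcongr
  exact Nat.cast_div_le

lemma card_near_le {q : ℕ} (hq : 0 < q) {a : ℤ} (ha : IsCoprime a q) {α ε : ℝ}
    (hε₀ : 0 ≤ ε) (hε : ε ≤ 1 / (4 * q)) {M : ℕ} {S : Finset ℕ}
    (hM : ∀ n ∈ S, n ≤ M) (hη : ∀ n ∈ S, 1 / 4 ≤ n * |q * α - a|)
    (hd : ∀ n ∈ S, distInt (n * α) < ε) :
    (#S : ℝ) ≤ 8 * M * ε + 4 * M * |q * α - a| := by
  have hq' : (0 : ℝ) < q := by exact_mod_cast hq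
  rcases S.eq_empty_or_nonempty with rfl | ⟨n₁, hn₁⟩
  · simp only [card_empty, Nat.cast_zero]
    positivity
  have hε0 : 0 < ε := (distInt_nonneg _).trans_lt (hd n₁ hn₁)
  set η := q * α - a
  have hη0 : 0 < |η| := by
    rcases (abs_nonneg η).eq_or_lt with h | h
    · have := hη n₁ hn₁
      rw [← h] at this
      norm_num at this
    · exact h
  have hqε : q * ε ≤ 1 / 4 := by
    calc q * ε ≤ q * (1 / (4 * q)) := by gcongr
      _ = 1 / 4 := by field_simp
  have hmap : ∀ n ∈ S, ⌊4 * |η| * n⌋₊ ∈ Icc 1 ⌊4 * |η| * M⌋₊ := by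
    intro n hn
    rw [mem_Icc]
    constructor
    · rw [Nat.one_le_floor_iff]
      linarith [hη n hn]
    · have : (n : ℝ) ≤ M := by exact_mod_cast hM n hn
      gcongr
  have hfib : ∀ k ∈ Icc 1 ⌊4 * |η| * M⌋₊, (#(S.filter fun n : ℕ => ⌊4 * |η| * n⌋₊ = k) : ℝ) ≤
      2 * ε / |η| + 1 := by
    intro k _
    set F := S.filter fun n : ℕ => ⌊4 * |η| * n⌋₊ = k with hF
    rcases F.eq_empty_or_nonempty with h | hne
    · rw [h]; simp only [card_empty, Nat.cast_zero]; positivity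
    set n₀ := F.min' hne
    have hn₀ : n₀ ∈ F := F.min'_mem hne
    have key : ∀ n ∈ F, ∃ l : ℕ, n = n₀ + q * l ∧ (l : ℝ) < 2 * ε / |η| := by
      intro n hn
      have hle : n₀ ≤ n := F.min'_le n hn
      obtain ⟨hnS, hnk⟩ := mem_filter.1 hn
      obtain ⟨hnS₀, hnk₀⟩ := mem_filter.1 hn₀
      have h1 := abs_residue_add_lt hq a (hd n hnS)
      have h2 := abs_residue_add_lt hq a (hd n₀ hnS₀)
      set r : ℤ := n * a - round (n * α) * q with hr
      set r₀ : ℤ := n₀ * a - round (n₀ * α) * q with hr₀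
      change |_ + (n : ℝ) * η| < _ at h1
      change |_ + (n₀ : ℝ) * η| < _ at h2
      have h3 : 4 * |η| * n - 4 * |η| * n₀ < 1 := by
        have e1 := Nat.lt_floor_add_one (4 * |η| * n)
        have e2 := Nat.floor_le (show 0 ≤ 4 * |η| * n₀ by positivity)
        rw [hnk] at e1
        rw [hnk₀] at e2
        linarith
      have hle' : (n₀ : ℝ) ≤ n := by exact_mod_cast hle
      have h4 : |(n : ℝ) * η - n₀ * η| < 1 / 4 := by
        rw [← sub_mul, abs_mul, abs_of_nonneg (sub_nonneg.2 hle')]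
        linarith
      obtain ⟨a1, a2⟩ := abs_lt.1 h1
      obtain ⟨b1, b2⟩ := abs_lt.1 h2
      obtain ⟨c1, c2⟩ := abs_lt.1 h4
      have h5 : r = r₀ := by
        have d1 : (r : ℝ) - r₀ < 1 := by linarith
        have d2 : (r₀ : ℝ) - r < 1 := by linarith
        have d1' : r - r₀ < 1 := by exact_mod_cast d1
        have d2' : r₀ - r < 1 := by exact_mod_cast d2
        omega
      have h6 : n₀ ≡ n [MOD q] := modEq_of_residue_eq ha h5.symm
      obtain ⟨l, hl⟩ := (Nat.modEq_iff_dvd' hle).1 h6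
      have hnl : n = n₀ + q * l := by omega
      refine ⟨l, hnl, ?_⟩
      have h7 : |(n : ℝ) * η - n₀ * η| < 2 * (q * ε) := by
        rw [h5] at a1 a2
        exact abs_lt.2 ⟨by linarith, by linarith⟩
      have h8 : (n : ℝ) * η - n₀ * η = q * (l * η) := by
        rw [hnl]; push_cast; ring
      rw [h8, abs_mul, abs_mul, Nat.abs_cast, Nat.abs_cast] at h7
      rw [lt_div_iff₀ hη0]
      have : (q : ℝ) * (l * |η|) < q * (2 * ε) := by linarith
      exact lt_of_mul_lt_mul_left this hq'.le
    have hsub : F ⊆ (range (⌊2 * ε / |η|⌋₊ + 1)).image (fun l => n₀ + q * l) := by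
      intro n hn
      obtain ⟨l, hl, hl'⟩ := key n hn
      exact mem_image.2 ⟨l, mem_range.2 (Nat.lt_succ_of_le (Nat.le_floor hl'.le)), hl.symm⟩
    calc (#F : ℝ) ≤ (⌊2 * ε / |η|⌋₊ + 1 : ℕ) := by
          exact_mod_cast (card_le_card hsub).trans (card_image_le.trans (card_range _).le)
      _ ≤ _ := by
          push_cast
          gcongr
          exact Nat.floor_le (by positivity)
  rw [card_eq_sum_card_fiberwise hmap]
  push_cast
  refine (sum_le_sum hfib).trans ?_
  rw [sum_const, Nat.card_Icc, nsmul_eq_mul, Nat.add_sub_cancel]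
  calc (⌊4 * |η| * M⌋₊ : ℝ) * (2 * ε / |η| + 1) ≤ (4 * |η| * M) * (2 * ε / |η| + 1) := by
        gcongr
        exact Nat.floor_le (by positivity)
    _ = _ := by
        field_simp
        ring

/-- Primes are sparse in every progression modulo `q` of length `T`, so a set of primes is much
smaller than the union of the progressions of length `T` that contain its elements. -/
lemma exists_window_cover {q T D : ℕ} (hq : 0 < q) (hT : 0 < T) (hD : 1 ≤ D) {S : Finset ℕ}
    (hS : ∀ p ∈ S, p.Prime ∧ D < p) :
    ∃ I : Finset ℕ, (#S : ℝ) * T ≤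
        #I * (T * (q / Nat.totient q) / Real.log (D + 1) + D ^ 4) ∧
      ∀ n ∈ I, ∃ p ∈ S, ∃ l : ℤ, (n : ℤ) = p + q * l ∧ |l| < T := by
  set key : ℕ → ℕ × ℕ := fun p => (p % q, p / (q * T))
  set K := S.image key
  set w : (ℕ × ℕ) × ℕ → ℕ := fun x => x.1.2 * (q * T) + (x.1.1 + q * x.2)
  have hqT : 0 < q * T := Nat.mul_pos hq hT
  have hlt : ∀ c t, c < q → t < T → c + q * t < q * T := by
    intro c t hc ht
    calc c + q * t < q + q * t := by omega
      _ = q * (t + 1) := by ring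
      _ ≤ q * T := Nat.mul_le_mul_left _ ht
  have hKlt : ∀ x ∈ K, x.1 < q := by
    intro x hx
    obtain ⟨p, _, rfl⟩ := mem_image.1 hx
    exact Nat.mod_lt _ hq
  have hdiv : ∀ c k t, c < q → t < T → (k * (q * T) + (c + q * t)) / (q * T) = k := by
    intro c k t hc ht
    rw [Nat.add_comm, Nat.add_mul_div_right _ _ hqT, Nat.div_eq_of_lt (hlt c t hc ht), zero_add]
  have hmod : ∀ c k t, c < q → (k * (q * T) + (c + q * t)) % q = c := by
    intro c k t hc
    rw [show k * (q * T) + (c + q * t) = c + q * (k * T + t) by ring, Nat.add_mul_mod_self_left,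
      Nat.mod_eq_of_lt hc]
  have hdecomp : ∀ p : ℕ, ∃ t < T, p = p / (q * T) * (q * T) + (p % q + q * t) := by
    intro p
    refine ⟨p % (q * T) / q, ?_, ?_⟩
    · exact Nat.div_lt_of_lt_mul (Nat.mod_lt _ hqT)
    · have h1 := Nat.div_add_mod' p (q * T)
      have h2 := Nat.mod_add_div (p % (q * T)) q
      rw [Nat.mod_mul_right_mod] at h2
      omega
  have hinj : Set.InjOn w ((K ×ˢ range T : Finset _) : Set ((ℕ × ℕ) × ℕ)) := by
    rintro ⟨⟨c, k⟩, t⟩ hx ⟨⟨c', k'⟩, t'⟩ hx' h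
    simp only [coe_product, Set.mem_prod, mem_coe, mem_range] at hx hx'
    have h1 := hdiv c k t (hKlt _ hx.1) hx.2
    have h2 := hdiv c' k' t' (hKlt _ hx'.1) hx'.2
    have h3 := hmod c k t (hKlt _ hx.1)
    have h4 := hmod c' k' t' (hKlt _ hx'.1)
    change k * (q * T) + (c + q * t) = k' * (q * T) + (c' + q * t') at h
    rw [h] at h1 h3
    obtain rfl : k = k' := h1.symm.trans h2
    obtain rfl : c = c' := h3.symm.trans h4
    have h5 : q * t = q * t' := by omega
    rw [Nat.eq_of_mul_eq_mul_left hq h5]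
  refine ⟨(K ×ˢ range T).image w, ?_, ?_⟩
  · rw [card_image_of_injOn hinj, card_product, card_range]
    have hfib : ∀ x ∈ K, (#{p ∈ S | key p = x} : ℝ) ≤
        T * (q / Nat.totient q) / Real.log (D + 1) + D ^ 4 := by
      intro x _
      refine le_trans ?_ (card_primes_progression_le hq hD (x.2 * (q * T) + x.1) T)
      have hsub : S.filter (fun p => key p = x) ⊆ ((range T).filter (fun t =>
          (x.2 * (q * T) + x.1 + q * t).Prime ∧ D < x.2 * (q * T) + x.1 + q * t)).image
          (fun t => x.2 * (q * T) + x.1 + q * t) := by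
        intro p hp
        obtain ⟨hpS, rfl⟩ := mem_filter.1 hp
        obtain ⟨t, ht, h⟩ := hdecomp p
        have h' : (key p).2 * (q * T) + (key p).1 + q * t = p := by
          change p / (q * T) * (q * T) + p % q + q * t = p
          omega
        refine mem_image.2 ⟨t, mem_filter.2 ⟨mem_range.2 ht, ?_⟩, h'⟩
        rw [h']
        exact hS p hpS
      exact_mod_cast (card_le_card hsub).trans card_image_le
    have hc : (#S : ℝ) ≤ #K * (T * (q / Nat.totient q) / Real.log (D + 1) + D ^ 4) := by
      rw [card_eq_sum_card_fiberwise (f := key) (t := K) (fun p hp => mem_image_of_mem _ hp)]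
      push_cast
      refine (sum_le_sum hfib).trans ?_
      rw [sum_const, nsmul_eq_mul]
    calc (#S : ℝ) * T ≤ (#K * (T * (q / Nat.totient q) / Real.log (D + 1) + D ^ 4)) * T := by gcongr
      _ = _ := by push_cast; ring
  · intro n hn
    obtain ⟨⟨x, t⟩, hx, rfl⟩ := mem_image.1 hn
    obtain ⟨hxK, ht⟩ := mem_product.1 hx
    obtain ⟨p, hp, rfl⟩ := mem_image.1 hxK
    obtain ⟨t', ht', h⟩ := hdecomp p
    have ht : t < T := mem_range.1 ht
    refine ⟨p, hp, (t : ℤ) - t', ?_, by rw [abs_lt]; omega⟩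
    change ((p / (q * T) * (q * T) + (p % q + q * t) : ℕ) : ℤ) = _
    have h' : (p : ℤ) = ((p / (q * T) * (q * T) + (p % q + q * t') : ℕ) : ℤ) := by exact_mod_cast h
    rw [h']
    generalize p / (q * T) = u
    push_cast
    ring

lemma quarter_le_mul_abs {q : ℕ} (hq : 0 < q) {a : ℤ} (ha : IsCoprime a q) {α ε : ℝ}
    (hε : ε ≤ 1 / (4 * q)) {n : ℕ} (hn : n.Coprime q) (hα : 1 / 4 ≤ n * distInt α)
    (hd : distInt (n * α) < ε) : 1 / 4 ≤ n * |q * α - a| := by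
  have hq' : (0 : ℝ) < q := by exact_mod_cast hq
  rcases (Nat.succ_le_of_lt hq).eq_or_lt with h | h
  · have h1 : q = 1 := h.symm
    subst h1
    refine hα.trans ?_
    gcongr
    simpa using distInt_le α a
  · have hqε : q * ε ≤ 1 / 4 := by
      calc q * ε ≤ q * (1 / (4 * q)) := by gcongr
        _ = 1 / 4 := by field_simp
    have h1 := abs_residue_add_lt hq a hd
    have h2 := gcd_residue ha hn (round (n * α))
    set r : ℤ := n * a - round (n * α) * q
    have hr : r ≠ 0 := by
      intro h0
      rw [h0, Int.gcd_zero_left, Int.natAbs_natCast] at h2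
      omega
    have h3 : (1 : ℝ) ≤ |(r : ℝ)| := by exact_mod_cast Int.one_le_abs hr
    have h4 := abs_sub_abs_le_abs_sub (r : ℝ) (-(n * (q * α - a)))
    rw [sub_neg_eq_add, abs_neg, abs_mul, Nat.abs_cast] at h4
    linarith

/-- A set of primes `p` from a dyadic interval `(2 ^ i, 2 ^ (i + 1)]` together with a rational
approximation of `α`, where each `p` is bounded below in terms of the distance of `α` to the
integers. -/
structure DyadicSetup (i : ℕ) (α : ℝ) (q : ℕ) (a : ℤ) (S : Finset ℕ) : Prop where
  hi : 32 ≤ i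
  hq : 0 < q
  ha : IsCoprime a q
  hqP : (q : ℝ) ^ 2 ≤ 2 ^ i
  hη : |q * α - a| * √(2 ^ i) ≤ 1
  prime : ∀ p ∈ S, p.Prime
  lower : ∀ p ∈ S, 2 ^ i < p
  upper : ∀ p ∈ S, p ≤ 2 * 2 ^ i
  far : ∀ p ∈ S, 1 / 2 ≤ p * distInt α

namespace DyadicSetup

variable {i : ℕ} {α : ℝ} {q : ℕ} {a : ℤ} {S : Finset ℕ}

lemma two_le_pow (h : DyadicSetup i α q a S) : (2 : ℝ) ≤ 2 ^ (i / 32) := by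
  have : 1 ≤ i / 32 := by have := h.hi; omega
  calc (2 : ℝ) = 2 ^ 1 := by norm_num
    _ ≤ _ := by gcongr; norm_num

lemma pow_le_sqrt (_h : DyadicSetup i α q a S) : ((2 : ℝ) ^ (i / 32)) ^ 16 ≤ √(2 ^ i) := by
  refine Real.le_sqrt_of_sq_le ?_
  rw [← pow_mul, ← pow_mul]
  exact pow_le_pow_right₀ (by norm_num) (by omega)

lemma q_le_sqrt (h : DyadicSetup i α q a S) : (q : ℝ) ≤ √(2 ^ i) := Real.le_sqrt_of_sq_le h.hqP

lemma abs_le_inv (h : DyadicSetup i α q a S) : |q * α - a| ≤ 1 / q := by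
  have hq : (0 : ℝ) < q := by exact_mod_cast h.hq
  rw [le_div_iff₀ hq]
  exact (mul_le_mul_of_nonneg_left h.q_le_sqrt (abs_nonneg _)).trans h.hη

lemma abs_le_pow (h : DyadicSetup i α q a S) : |q * α - a| * ((2 : ℝ) ^ (i / 32)) ^ 16 ≤ 1 :=
  (mul_le_mul_of_nonneg_left h.pow_le_sqrt (abs_nonneg _)).trans h.hη

lemma coprime (h : DyadicSetup i α q a S) {p : ℕ} (hp : p ∈ S) : p.Coprime q := by
  refine ((h.prime p hp).coprime_iff_not_dvd).2 fun hd => ?_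
  have h1 : p ≤ q := Nat.le_of_dvd h.hq hd
  have h2 : q ^ 2 ≤ 2 ^ i := by exact_mod_cast h.hqP
  have h3 := h.lower p hp
  have h4 : q ≤ q ^ 2 := Nat.le_self_pow (by norm_num) q
  omega

lemma q_le (h : DyadicSetup i α q a S) : (q : ℝ) ≤ 2 ^ i := by
  have h4 : q ≤ q ^ 2 := Nat.le_self_pow (by norm_num) q
  have : (q : ℝ) ≤ q ^ 2 := by exact_mod_cast h4
  exact this.trans h.hqP

lemma log_le (h : DyadicSetup i α q a S) :
    Real.log (2 ^ i) ≤ 64 * Real.log (((2 ^ (i / 32) : ℕ) : ℝ) + 1) := by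
  have h2 : Real.log ((2 : ℝ) ^ (i / 32)) ≤ Real.log (((2 ^ (i / 32) : ℕ) : ℝ) + 1) := by
    apply Real.log_le_log (by positivity)
    push_cast
    linarith
  refine le_trans ?_ (mul_le_mul_of_nonneg_left h2 (by norm_num))
  rw [Real.log_pow, Real.log_pow, ← mul_assoc]
  gcongr
  have := h.hi
  exact_mod_cast (by omega : i ≤ 64 * (i / 32))

lemma one_le_log (h : DyadicSetup i α q a S) : 1 ≤ Real.log (2 ^ i) := by
  rw [Real.log_pow]
  have h1 : (32 : ℝ) ≤ i := by exact_mod_cast h.hi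
  have h2 := Real.log_two_gt_d9
  nlinarith

lemma exists_cover (h : DyadicSetup i α q a S) {δ : ℝ} (hδ : 1 ≤ δ * ((2 : ℝ) ^ (i / 32)) ^ 4)
    (hd : ∀ p ∈ S, distInt (p * α) < δ) :
    ∃ I : Finset ℕ, (#S : ℝ) ≤ #I * (128 * (q / Nat.totient q) / Real.log (2 ^ i)) ∧
      (∀ n ∈ I, n ≤ 3 * 2 ^ i) ∧ (∀ n ∈ I, n.Coprime q) ∧
      (∀ n ∈ I, distInt (n * α) < 2 * δ) ∧ ∀ n ∈ I, 1 / 4 ≤ n * distInt α := by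
  set D := 2 ^ (i / 32) with hD
  have hDr : ((D : ℕ) : ℝ) = 2 ^ (i / 32) := by rw [hD]; push_cast; rfl
  have hD2 : (2 : ℝ) ≤ D := by rw [hDr]; exact h.two_le_pow
  have hδD : 1 ≤ δ * (D : ℝ) ^ 4 := by rw [hDr]; exact hδ
  have hδ0 : 0 < δ := by
    by_contra hcon
    have : δ * (D : ℝ) ^ 4 ≤ 0 := mul_nonpos_of_nonpos_of_nonneg (not_lt.1 hcon) (by positivity)
    linarith
  have hlog := h.log_le
  have hlog1 := h.one_le_log
  have hDP : (D : ℝ) ^ 32 ≤ 2 ^ i := by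
    rw [hDr, ← pow_mul]
    exact pow_le_pow_right₀ (by norm_num) (by omega)
  have hηD := h.abs_le_pow
  rw [← hDr] at hηD
  have hDpos : (0 : ℝ) < D := by linarith
  obtain ⟨I, hI, hI'⟩ := exists_window_cover (T := D ^ 5) (D := D) h.hq
    (by positivity) (Nat.one_le_two_pow) (S := S) (fun p hp => ⟨h.prime p hp, by
      have h1 := h.lower p hp
      have h2 : D ≤ 2 ^ i := Nat.pow_le_pow_right (by norm_num) (Nat.div_le_self _ _)
      omega⟩)
  have hqT : (q : ℝ) * D ^ 5 ≤ 2 ^ i / 2 := by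
    have h1 := h.q_le_sqrt
    have h2 : 2 * (D : ℝ) ^ 5 ≤ √(2 ^ i) := by
      refine le_trans ?_ h.pow_le_sqrt
      rw [← hDr]
      calc 2 * (D : ℝ) ^ 5 ≤ D * D ^ 5 := by gcongr
        _ = (D : ℝ) ^ 6 := by ring
        _ ≤ (D : ℝ) ^ 16 := pow_le_pow_right₀ (by linarith) (by norm_num)
    have h3 : √((2 : ℝ) ^ i) * √(2 ^ i) = 2 ^ i := Real.mul_self_sqrt (by positivity)
    have h4 : (q : ℝ) * (2 * D ^ 5) ≤ √(2 ^ i) * √(2 ^ i) := by gcongr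
    linarith
  have hφ : (1 : ℝ) ≤ q / Nat.totient q := by
    have h1 : (0 : ℝ) < Nat.totient q := by exact_mod_cast Nat.totient_pos.2 h.hq
    rw [one_le_div h1]
    exact_mod_cast Nat.totient_le q
  refine ⟨I, ?_, ?_⟩
  · set ℓ := Real.log ((D : ℝ) + 1)
    have hℓ : 0 < ℓ := Real.log_pos (by linarith)
    have hℓD : ℓ ≤ D := by
      have := Real.log_le_sub_one_of_pos (show (0 : ℝ) < D + 1 by linarith)
      linarith
    have hB : (D : ℝ) ^ 5 * (q / Nat.totient q) / ℓ + D ^ 4 ≤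
        D ^ 5 * (128 * (q / Nat.totient q) / Real.log (2 ^ i)) := by
      have e1 : (D : ℝ) ^ 4 ≤ D ^ 5 * (q / Nat.totient q) / ℓ := by
        rw [le_div_iff₀ hℓ]
        calc (D : ℝ) ^ 4 * ℓ ≤ D ^ 4 * D := by gcongr
          _ = (D : ℝ) ^ 5 * 1 := by ring
          _ ≤ _ := by gcongr
      calc (D : ℝ) ^ 5 * (q / Nat.totient q) / ℓ + D ^ 4
          ≤ 2 * (D ^ 5 * (q / Nat.totient q)) * (1 / ℓ) := by
            rw [mul_one_div, mul_div_assoc 2]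
            linarith
        _ ≤ 2 * (D ^ 5 * (q / Nat.totient q)) * (64 / Real.log (2 ^ i)) := by
            refine mul_le_mul_of_nonneg_left ?_ (by positivity)
            rw [div_le_div_iff₀ hℓ (by linarith)]
            linarith
        _ = _ := by ring
    have hI2 : (#S : ℝ) * D ^ 5 ≤ #I * (D ^ 5 * (128 * (q / Nat.totient q) / Real.log (2 ^ i))) := by
      push_cast at hI
      exact hI.trans (by gcongr)
    have hD5 : (0 : ℝ) < D ^ 5 := by positivity
    refine le_of_mul_le_mul_right ?_ hD5
    linarith
  · have key : ∀ n ∈ I, ∃ p ∈ S, n.Coprime q ∧ |(n : ℝ) - p| ≤ 2 ^ i / 2 ∧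
        distInt (n * α) < 2 * δ := by
      intro n hn
      obtain ⟨p, hp, l, hl, hlT⟩ := hI' n hn
      have hlT' : |(l : ℝ)| ≤ D ^ 5 := by exact_mod_cast hlT.le
      have hnp : (n : ℝ) = p + q * l := by exact_mod_cast hl
      refine ⟨p, hp, ?_, ?_, ?_⟩
      · have := h.coprime hp
        rw [← Nat.isCoprime_iff_coprime] at this ⊢
        rw [hl]
        exact this.add_mul_left_left l
      · rw [hnp, add_sub_cancel_left, abs_mul, Nat.abs_cast]
        exact (mul_le_mul_of_nonneg_left hlT' (by positivity)).trans hqT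
      · rw [hnp, add_mul]
        refine (distInt_add_le _ _ (l * a)).trans_lt ?_
        have h1 : |(q : ℝ) * l * α - (l * a : ℤ)| ≤ δ := by
          push_cast
          rw [show (q : ℝ) * l * α - l * a = l * (q * α - a) by ring, abs_mul]
          have h2 : |(l : ℝ)| * |q * α - a| ≤ D ^ 5 * |q * α - a| := by gcongr
          refine h2.trans ?_
          have h3 : (0 : ℝ) < D ^ 4 := by positivity
          refine le_of_mul_le_mul_right (le_trans ?_ hδD) h3
          refine le_trans ?_ hηD
          rw [show (D : ℝ) ^ 5 * |q * α - a| * D ^ 4 = |q * α - a| * D ^ 9 by ring]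
          gcongr
          · linarith
          · norm_num
        linarith [hd p hp]
    refine ⟨fun n hn => ?_, fun n hn => ?_, fun n hn => ?_, fun n hn => ?_⟩ <;>
      obtain ⟨p, hp, h1, h2, h3⟩ := key n hn
    · have h4 : (p : ℝ) ≤ 2 * 2 ^ i := by exact_mod_cast h.upper p hp
      have h5 := (abs_le.1 h2).2
      have : (n : ℝ) ≤ 3 * 2 ^ i := by
        have : (0 : ℝ) < 2 ^ i := by positivity
        linarith
      exact_mod_cast this
    · exact h1
    · exact h3
    · have h4 : (2 : ℝ) ^ i < p := by exact_mod_cast h.lower p hp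
      have h5 := (abs_le.1 h2).1
      have h6 := h.far p hp
      have h7 : (p : ℝ) / 2 ≤ n := by linarith
      have := mul_le_mul_of_nonneg_right h7 (distInt_nonneg α)
      linarith

end DyadicSetup

lemma two_pow_primeFactors_le_sqrt {q : ℕ} (hq : 0 < q) :
    (2 : ℝ) ^ #q.primeFactors ≤ 4 ^ 6 * √q := by
  have hs : 0 < √(q : ℝ) := Real.sqrt_pos.2 (by exact_mod_cast hq)
  refine le_of_mul_le_mul_right ((two_pow_mul_sqrt_le_totient hq).trans ?_) hs
  rw [mul_assoc, Real.mul_self_sqrt (by positivity)]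
  gcongr
  exact Nat.totient_le q

namespace DyadicSetup

variable {i : ℕ} {α : ℝ} {q : ℕ} {a : ℤ} {S : Finset ℕ}

lemma mono (h : DyadicSetup i α q a S) {S' : Finset ℕ} (hS : S' ⊆ S) : DyadicSetup i α q a S' where
  hi := h.hi
  hq := h.hq
  ha := h.ha
  hqP := h.hqP
  hη := h.hη
  prime p hp := h.prime p (hS hp)
  lower p hp := h.lower p (hS hp)
  upper p hp := h.upper p (hS hp)
  far p hp := h.far p (hS hp)

lemma card_le_of_large (h : DyadicSetup i α q a S) {δ : ℝ}
    (hδ : 1 ≤ δ * ((2 : ℝ) ^ (i / 32)) ^ 4) (hqδ : 1 ≤ 8 * q * δ)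
    (hd : ∀ p ∈ S, distInt (p * α) < δ) :
    (#S : ℝ) ≤ 2 ^ i / Real.log (2 ^ i) * (10240 * δ +
      512 * (2 ^ #q.primeFactors / Nat.totient q)) := by
  have hq : (0 : ℝ) < q := by exact_mod_cast h.hq
  have hφ : (0 : ℝ) < Nat.totient q := by exact_mod_cast Nat.totient_pos.2 h.hq
  have hℓ : 0 < Real.log (2 ^ i) := by linarith [h.one_le_log]
  have hδ0 : 0 < δ := pos_of_mul_pos_right (lt_of_lt_of_le one_pos hqδ) (by positivity)
  obtain ⟨I, h1, h2, h3, h4, -⟩ := h.exists_cover hδ hd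
  have h5 := card_near_coprime_le h.hq h.ha (ε := 2 * δ) h.abs_le_inv (by
    rw [div_le_iff₀ (by positivity)]; linarith) h2 h3 h4
  push_cast at h5
  have h6 : 3 * (2 : ℝ) ^ i / q + 1 ≤ 4 * (2 ^ i / q) := by
    have : 1 ≤ (2 : ℝ) ^ i / q := (one_le_div hq).2 h.q_le
    rw [mul_div_assoc]
    linarith
  calc (#S : ℝ) ≤ (4 * (2 ^ i / q) * (10 * (2 * δ) * Nat.totient q + 2 ^ #q.primeFactors)) *
        (128 * (q / Nat.totient q) / Real.log (2 ^ i)) := by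
        refine h1.trans ?_
        gcongr
        refine h5.trans ?_
        gcongr
    _ = _ := by field_simp; ring

lemma card_le_of_medium (h : DyadicSetup i α q a S) {δ : ℝ}
    (hδ : 1 ≤ δ * ((2 : ℝ) ^ (i / 32)) ^ 4) (hqδ : 8 * q * δ < 1)
    (hd : ∀ p ∈ S, distInt (p * α) < δ) :
    (#S : ℝ) ≤ 2 ^ i / Real.log (2 ^ i) * (6144 * (q * δ)) + 192 * (2 ^ i / 2 ^ (i / 32)) := by
  have hq : (0 : ℝ) < q := by exact_mod_cast h.hq
  have hφ : (1 : ℝ) ≤ Nat.totient q := by exact_mod_cast Nat.totient_pos.2 h.hq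
  have hℓ := h.one_le_log
  have hD := h.two_le_pow
  have hη := h.abs_le_pow
  set D : ℝ := 2 ^ (i / 32)
  have hδ0 : 0 < δ := by
    refine pos_of_mul_pos_left (lt_of_lt_of_le one_pos hδ) (by positivity)
  obtain ⟨I, h1, h2, h3, h4, h5⟩ := h.exists_cover hδ hd
  have hε : 2 * δ ≤ 1 / (4 * q) := by
    rw [le_div_iff₀ (by positivity)]; linarith
  have h6 := card_near_le h.hq h.ha (ε := 2 * δ) (by positivity) hε h2
    (fun n hn => quarter_le_mul_abs h.hq h.ha hε (h3 n hn) (h5 n hn) (h4 n hn)) h4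
  push_cast at h6
  set η := |(q : ℝ) * α - a|
  have hη0 : 0 ≤ η := abs_nonneg _
  have h7 : 8 * (q * η) ≤ 1 / D := by
    have e1 : 8 * (q : ℝ) ≤ D ^ 4 := by
      by_contra hcon
      have : D ^ 4 * δ < 8 * q * δ := mul_lt_mul_of_pos_right (not_le.1 hcon) hδ0
      linarith
    rw [le_div_iff₀ (by positivity)]
    calc 8 * (q * η) * D = (8 * q) * (η * D) := by ring
      _ ≤ D ^ 4 * (η * D) := by gcongr
      _ = η * D ^ 5 := by ring
      _ ≤ η * D ^ 16 := by gcongr <;> linarith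
      _ ≤ 1 := hη
  have h8 : (q : ℝ) / Nat.totient q ≤ q := div_le_self hq.le hφ
  calc (#S : ℝ) ≤ (8 * (3 * 2 ^ i) * (2 * δ) + 4 * (3 * 2 ^ i) * η) *
        (128 * q / Real.log (2 ^ i)) := by
        refine h1.trans ?_
        gcongr
    _ = 2 ^ i / Real.log (2 ^ i) * (6144 * (q * δ)) +
        192 * (2 ^ i * (8 * (q * η))) * (1 / Real.log (2 ^ i)) := by ring
    _ ≤ 2 ^ i / Real.log (2 ^ i) * (6144 * (q * δ)) + 192 * (2 ^ i * (1 / D)) * 1 := by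
        gcongr
        rw [div_le_one (by linarith)]
        exact hℓ
    _ = _ := by ring

lemma card_le_of_small (h : DyadicSetup i α q a S) {δ : ℝ}
    (hδ : δ * ((2 : ℝ) ^ (i / 32)) ^ 4 ≤ 1) (hd : ∀ p ∈ S, distInt (p * α) < δ) :
    (#S : ℝ) ≤ 30000 * (2 ^ i / 2 ^ (i / 32)) := by
  have hq : (0 : ℝ) < q := by exact_mod_cast h.hq
  have hD := h.two_le_pow
  have hη := h.abs_le_pow
  set D : ℝ := 2 ^ (i / 32)
  have hD0 : 0 < D := by linarith
  have hD4 : 1 / D ^ 4 ≤ 1 / D := by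
    gcongr
    exact le_self_pow₀ (by linarith) (by norm_num)
  have hd' : ∀ p ∈ S, distInt (p * α) < 1 / D ^ 4 := fun p hp =>
    (hd p hp).trans_le ((le_div_iff₀ (by positivity)).2 hδ)
  have hP : (0 : ℝ) < 2 ^ i := by positivity
  rcases le_total (1 / (4 * (q : ℝ))) (1 / D ^ 4) with hc | hc
  · have h5 := card_near_coprime_le h.hq h.ha h.abs_le_inv hc h.upper (fun p hp => h.coprime hp) hd'
    push_cast at h5
    have h6 : 2 * (2 : ℝ) ^ i / q + 1 ≤ 3 * (2 ^ i / q) := by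
      have : 1 ≤ (2 : ℝ) ^ i / q := (one_le_div hq).2 h.q_le
      rw [mul_div_assoc]
      linarith
    have hs : 0 < √(q : ℝ) := Real.sqrt_pos.2 hq
    have hs2 : D ≤ 2 * √(q : ℝ) := by
      have e1 : D ^ 4 ≤ 4 * q := by
        rw [div_le_div_iff₀ (by positivity) (by positivity)] at hc
        linarith
      have e2 : D ^ 2 ≤ D ^ 4 := pow_le_pow_right₀ (by linarith) (by norm_num)
      have e3 : √(q : ℝ) ^ 2 = q := Real.sq_sqrt hq.le
      refine le_of_sq_le_sq ?_ (by positivity)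
      nlinarith
    calc (#S : ℝ) ≤ 3 * (2 ^ i / q) * (10 * (1 / D) * q + 4 ^ 6 * √q) := by
          refine h5.trans ?_
          gcongr
          · exact Nat.totient_le q
          · exact two_pow_primeFactors_le_sqrt h.hq
      _ = 30 * (2 ^ i / D) + 12288 * (2 ^ i * (√q / q)) := by
          field_simp
          ring
      _ ≤ 30 * (2 ^ i / D) + 12288 * (2 ^ i * (2 / D)) := by
          gcongr 30 * (2 ^ i / D) + 12288 * (2 ^ i * ?_)
          rw [Real.sqrt_div_self, ← one_div, div_le_div_iff₀ hs hD0]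
          linarith
      _ = 24606 * (2 ^ i / D) := by ring
      _ ≤ _ := by gcongr; norm_num
  · have h6 := card_near_le h.hq h.ha (by positivity) hc h.upper
      (fun n hn => quarter_le_mul_abs h.hq h.ha hc (h.coprime hn)
        (by linarith [h.far n hn]) (hd' n hn)) hd'
    push_cast at h6
    have h7 : |(q : ℝ) * α - a| ≤ 1 / D := by
      rw [le_div_iff₀ hD0]
      refine le_trans ?_ hη
      gcongr
      exact le_self_pow₀ (by linarith) (by norm_num)
    calc (#S : ℝ) ≤ 8 * (2 * 2 ^ i) * (1 / D) + 4 * (2 * 2 ^ i) * (1 / D) := by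
          refine h6.trans ?_
          gcongr
      _ = 24 * (2 ^ i / D) := by ring
      _ ≤ _ := by gcongr; norm_num

lemma card_le (h : DyadicSetup i α q a S) {δ : ℝ} (hδ : 0 ≤ δ)
    (hd : ∀ p ∈ S, distInt (p * α) < δ) :
    (#S : ℝ) ≤ 2 ^ i / Real.log (2 ^ i) * (10240 * δ +
      (if 1 ≤ 8 * q * δ then 512 * (2 ^ #q.primeFactors / Nat.totient q : ℝ) else 6144 * (q * δ))) +
      30000 * (2 ^ i / 2 ^ (i / 32)) := by
  have hℓ := h.one_le_log
  have hP : (0 : ℝ) ≤ 2 ^ i / 2 ^ (i / 32) := by positivity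
  have hpos : (0 : ℝ) ≤ 2 ^ i / Real.log (2 ^ i) := by positivity
  rcases le_total 1 (δ * ((2 : ℝ) ^ (i / 32)) ^ 4) with h1 | h1
  · split_ifs with h2
    · linarith [h.card_le_of_large h1 h2 hd]
    · have h3 := h.card_le_of_medium h1 (not_le.1 h2) hd
      have h4 : (0 : ℝ) ≤ 2 ^ i / Real.log (2 ^ i) * (10240 * δ) := by positivity
      rw [mul_add]
      linarith
  · refine (h.card_le_of_small h1 hd).trans (le_add_of_nonneg_left ?_)
    refine mul_nonneg hpos (add_nonneg (by positivity) ?_)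
    split_ifs <;> positivity

end DyadicSetup

lemma exists_coprime_approx (α : ℝ) (i : ℕ) : ∃ (q : ℕ) (a : ℤ), 0 < q ∧ IsCoprime a q ∧
    (q : ℝ) ^ 2 ≤ 2 ^ i ∧ |q * α - a| * √(2 ^ i) ≤ 1 := by
  set R := √((2 : ℝ) ^ i)
  have hR : 1 ≤ R := Real.one_le_sqrt.2 (one_le_pow₀ (by norm_num))
  obtain ⟨r, hr, hr'⟩ := Real.exists_rat_abs_sub_le_and_den_le α (n := ⌊R⌋₊) (Nat.floor_pos.2 hR)
  have hden : (0 : ℝ) < r.den := by exact_mod_cast r.den_pos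
  refine ⟨r.den, r.num, r.den_pos, ?_, ?_, ?_⟩
  · exact Int.isCoprime_iff_gcd_eq_one.2 r.reduced
  · have h1 : (r.den : ℝ) ≤ R := (Nat.cast_le.2 hr').trans (Nat.floor_le (by positivity))
    calc (r.den : ℝ) ^ 2 ≤ R ^ 2 := by gcongr
      _ = 2 ^ i := Real.sq_sqrt (by positivity)
  · have h1 : (r.den : ℝ) * α - r.num = r.den * (α - r) := by
      rw [mul_sub]
      congr 1
      rw [mul_comm]
      exact_mod_cast (Rat.mul_den_eq_num r).symm
    rw [h1, abs_mul, Nat.abs_cast]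
    have h2 := Nat.lt_floor_add_one R
    calc (r.den : ℝ) * |α - r| * R ≤ r.den * (1 / ((⌊R⌋₊ + 1) * r.den)) * (⌊R⌋₊ + 1) := by
          gcongr
      _ = 1 := by field_simp

lemma sum_half_pow_le (s : Finset ℕ) : ∑ j ∈ s, ((1 : ℝ) / 2) ^ j ≤ 2 := by
  have := summable_geometric_two.sum_le_tsum s (fun j _ => by positivity)
  rwa [tsum_geometric_two] at this

lemma succ_le_two_mul_sqrt_two_pow (m : ℕ) : (m : ℝ) + 1 ≤ 2 * √(2 ^ m) := by
  have h : ∀ m : ℕ, (m + 1) ^ 2 ≤ 4 * 2 ^ m := by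
    intro m
    induction m with
    | zero => norm_num
    | succ m ih =>
      rcases m with _ | _ | _ | m
      · norm_num
      · norm_num
      · norm_num
      · have h2 : (m + 1 + 1 + 1 + 1 + 1) ^ 2 ≤ 2 * (m + 1 + 1 + 1 + 1) ^ 2 := by
          clear ih
          nlinarith [Nat.zero_le (m * m), Nat.zero_le m]
        calc _ ≤ 2 * (m + 1 + 1 + 1 + 1) ^ 2 := h2
          _ ≤ 2 * (4 * 2 ^ (m + 1 + 1 + 1)) := by gcongr
          _ = _ := by ring
  have h' : ((m : ℝ) + 1) ^ 2 ≤ 4 * 2 ^ m := by exact_mod_cast h m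
  refine le_of_sq_le_sq ?_ (by positivity)
  rw [mul_pow, Real.sq_sqrt (by positivity)]
  linarith

lemma sum_two_pow_primeFactors_le {q : ℕ} (hq : 0 < q) (J : ℕ) :
    ∑ j ∈ range J, (if 1 ≤ 8 * q * ((1 : ℝ) / 2) ^ j then
      512 * (2 ^ #q.primeFactors / Nat.totient q : ℝ) else 6144 * (q * ((1 : ℝ) / 2) ^ j)) ≤
      13000000 := by
  have hq' : (0 : ℝ) < q := by exact_mod_cast hq
  have hφ : (0 : ℝ) < Nat.totient q := by exact_mod_cast Nat.totient_pos.2 hq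
  set m := Nat.log 2 (8 * q) with hm
  have hm1 : 2 ^ m ≤ 8 * q := Nat.pow_log_le_self 2 (by omega)
  have hm2 : 8 * q < 2 ^ (m + 1) := Nat.lt_pow_succ_log_self (by norm_num) _
  rw [sum_ite]
  have h1 : (#{j ∈ range J | 1 ≤ 8 * q * ((1 : ℝ) / 2) ^ j} : ℝ) ≤ m + 1 := by
    have : (range J).filter (fun j : ℕ => 1 ≤ 8 * q * ((1 : ℝ) / 2) ^ j) ⊆ range (m + 1) := by
      intro j hj
      have hj := (mem_filter.1 hj).2
      rw [div_pow, one_pow, mul_one_div, one_le_div (by positivity)] at hj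
      have hj' : 2 ^ j ≤ 8 * q := by exact_mod_cast hj
      rw [mem_range]
      exact (Nat.pow_lt_pow_iff_right (by norm_num)).1 (hj'.trans_lt hm2)
    exact_mod_cast (card_le_card this).trans (card_range _).le
  have h2 : (m : ℝ) + 1 ≤ 6 * √q := by
    refine (succ_le_two_mul_sqrt_two_pow m).trans ?_
    have e1 : (2 : ℝ) ^ m ≤ 8 * q := by exact_mod_cast hm1
    have e2 : √((2 : ℝ) ^ m) ≤ 3 * √q := by
      rw [Real.sqrt_le_left (by positivity), mul_pow, Real.sq_sqrt (by positivity)]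
      linarith
    linarith
  have h3 : (m + 1 : ℝ) * (2 ^ #q.primeFactors / Nat.totient q) ≤ 24576 := by
    rw [← mul_div_assoc, div_le_iff₀ hφ]
    have := two_pow_mul_sqrt_le_totient hq
    calc (m + 1 : ℝ) * 2 ^ #q.primeFactors ≤ 6 * √q * 2 ^ #q.primeFactors := by gcongr
      _ = 6 * (2 ^ #q.primeFactors * √q) := by ring
      _ ≤ 6 * (4 ^ 6 * Nat.totient q) := by gcongr
      _ = _ := by ring
  have h4 : ∑ j ∈ range J with ¬ 1 ≤ 8 * q * ((1 : ℝ) / 2) ^ j, (q : ℝ) * ((1 : ℝ) / 2) ^ j ≤ 1 := by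
    set F := (range J).filter (fun j : ℕ => ¬ 1 ≤ 8 * q * ((1 : ℝ) / 2) ^ j)
    have hF : ∀ j ∈ F, m ≤ j := by
      intro j hj
      have hj := (mem_filter.1 hj).2
      rw [div_pow, one_pow, mul_one_div, one_le_div (by positivity), not_le] at hj
      have hj' : 8 * q < 2 ^ j := by exact_mod_cast hj
      exact ((Nat.pow_lt_pow_iff_right (by norm_num)).1 (hm1.trans_lt hj')).le
    have e1 : ∀ j ∈ F, (q : ℝ) * ((1 : ℝ) / 2) ^ j ≤ 1 / 4 * (1 / 2) ^ (j - m) := by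
      intro j hj
      have e2 : j = m + (j - m) := by have := hF j hj; omega
      have e3 : 8 * (q : ℝ) < 2 * 2 ^ m := by
        rw [pow_succ] at hm2
        exact_mod_cast (by linarith : 8 * q < 2 * 2 ^ m)
      have e4 : (q : ℝ) * (1 / 2) ^ m ≤ 1 / 4 := by
        rw [div_pow, one_pow, mul_one_div, div_le_iff₀ (by positivity)]
        linarith
      calc (q : ℝ) * ((1 : ℝ) / 2) ^ j = (q * (1 / 2) ^ m) * (1 / 2) ^ (j - m) := by
            conv_lhs => rw [e2]
            rw [pow_add]; ring
        _ ≤ _ := by gcongr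
    refine (sum_le_sum e1).trans ?_
    rw [← mul_sum]
    have e5 : ∑ j ∈ F, ((1 : ℝ) / 2) ^ (j - m) = ∑ k ∈ F.image (· - m), ((1 : ℝ) / 2) ^ k := by
      rw [sum_image]
      intro x hx y hy hxy
      have := hF x hx
      have := hF y hy
      simp only at hxy
      omega
    rw [e5]
    linarith [sum_half_pow_le (F.image (· - m))]
  rw [sum_const, nsmul_eq_mul, ← mul_sum]
  have h5 : (#{j ∈ range J | 1 ≤ 8 * q * ((1 : ℝ) / 2) ^ j} : ℝ) *
      (2 ^ #q.primeFactors / Nat.totient q) ≤ 24576 :=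
    le_trans (by gcongr) h3
  linarith

/-- The total number of coincidences `‖p α‖ < 2 ^ (-j)` over the primes of a dyadic interval. -/
lemma sum_card_dyadic_le (i J : ℕ) (α : ℝ) (S : Finset ℕ) (hp : ∀ p ∈ S, p.Prime)
    (hlow : ∀ p ∈ S, 2 ^ i < p) (hup : ∀ p ∈ S, p ≤ 2 * 2 ^ i)
    (hfar : ∀ p ∈ S, 1 / 2 ≤ p * distInt α) :
    ∑ j ∈ range J, (#(S.filter fun p : ℕ => distInt (p * α) < (1 / 2) ^ j) : ℝ) ≤
      30000000 * (2 ^ i / (i + 1)) + 30000 * (J * (2 ^ i / 2 ^ (i / 32))) := by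
  have hi0 : (0 : ℝ) < i + 1 := by positivity
  rcases lt_or_ge i 32 with hi | hi
  · have h0 : i / 32 = 0 := by omega
    have hS : (#S : ℝ) ≤ 2 ^ i := by
      have : S ⊆ Ioc (2 ^ i) (2 * 2 ^ i) := fun p hp => mem_Ioc.2 ⟨hlow p hp, hup p hp⟩
      have h1 := card_le_card this
      rw [Nat.card_Ioc] at h1
      exact_mod_cast (by omega : #S ≤ 2 ^ i)
    calc ∑ j ∈ range J, (#(S.filter fun p : ℕ => distInt (p * α) < (1 / 2) ^ j) : ℝ)
        ≤ ∑ j ∈ range J, (2 : ℝ) ^ i :=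
          sum_le_sum fun j _ => le_trans (by exact_mod_cast card_filter_le _ _) hS
      _ = J * (2 ^ i / 2 ^ (i / 32)) := by rw [h0]; simp
      _ ≤ 30000 * (J * (2 ^ i / 2 ^ (i / 32))) := le_mul_of_one_le_left (by positivity) (by norm_num)
      _ ≤ _ := le_add_of_nonneg_left (by positivity)
  · obtain ⟨q, a, hq, ha, hqP, hη⟩ := exists_coprime_approx α i
    have h : DyadicSetup i α q a S := ⟨hi, hq, ha, hqP, hη, hp, hlow, hup, hfar⟩
    have h1 : ∀ j ∈ range J, _ := fun j _ =>
      (h.mono (filter_subset (fun p : ℕ => distInt (p * α) < (1 / 2) ^ j) S)).card_le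
        (δ := (1 / 2) ^ j) (by positivity) (fun p hp => (mem_filter.1 hp).2)
    refine (sum_le_sum h1).trans ?_
    rw [sum_add_distrib, ← mul_sum, sum_add_distrib, ← mul_sum, sum_const, card_range, nsmul_eq_mul]
    have h2 := sum_two_pow_primeFactors_le hq J
    have h3 := sum_half_pow_le (range J)
    have hℓ : 1 / Real.log (2 ^ i) ≤ 2 * (1 / (i + 1)) := by
      rw [mul_one_div, div_le_div_iff₀ (by linarith [h.one_le_log]) hi0, Real.log_pow]
      have e1 : (32 : ℝ) ≤ i := by exact_mod_cast hi
      have e2 := Real.log_two_gt_d9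
      nlinarith
    have hℓ0 := h.one_le_log
    calc _ ≤ (2 : ℝ) ^ i * (2 * (1 / (i + 1))) * (10240 * 2 + 13000000) +
          J * (30000 * (2 ^ i / 2 ^ (i / 32))) := by
          gcongr ?_ + _
          rw [div_eq_mul_one_div]
          gcongr
      _ = 26040960 * ((2 : ℝ) ^ i / (i + 1)) + 30000 * (J * (2 ^ i / 2 ^ (i / 32))) := by ring
      _ ≤ _ := by gcongr; norm_num

lemma exists_sum_succ_div_le : ∃ K : ℝ, 0 < K ∧ ∀ n : ℕ,
    ∑ i ∈ range n, ((i : ℝ) + 1) / 2 ^ (i / 32) ≤ K := by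
  set r : ℝ := (1 / 2) ^ ((1 : ℝ) / 32) with hr
  have hr0 : 0 < r := by positivity
  have hr1 : r < 1 := Real.rpow_lt_one (by norm_num) (by norm_num) (by norm_num)
  have hr32 : r ^ 32 = 1 / 2 := by
    rw [hr, ← Real.rpow_natCast, ← Real.rpow_mul (by norm_num)]
    norm_num
  have hs : Summable fun i : ℕ => ((i : ℝ) + 1) * (2 * r ^ i) := by
    have h1 := summable_pow_mul_geometric_of_norm_lt_one 1 (r := r)
      (by rwa [Real.norm_of_nonneg hr0.le])
    have h2 := summable_geometric_of_lt_one hr0.le hr1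
    refine ((h1.add h2).mul_left 2).congr fun i => ?_
    rw [pow_one]
    ring
  have hle : ∀ i : ℕ, ((i : ℝ) + 1) / 2 ^ (i / 32) ≤ (i + 1) * (2 * r ^ i) := by
    intro i
    rw [div_eq_mul_inv]
    gcongr
    have h1 : r ^ (32 * (i / 32 + 1)) ≤ r ^ i :=
      pow_le_pow_of_le_one hr0.le hr1.le (by omega)
    rw [pow_mul, hr32, pow_succ, div_pow, one_pow] at h1
    rw [← one_div]
    linarith
  refine ⟨∑' i : ℕ, ((i : ℝ) + 1) * (2 * r ^ i) + 1, ?_, fun n => ?_⟩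
  · have : 0 ≤ ∑' i : ℕ, ((i : ℝ) + 1) * (2 * r ^ i) := tsum_nonneg fun i => by positivity
    linarith
  · have := hs.sum_le_tsum (range n) (fun i _ => by positivity)
    linarith [sum_le_sum fun i (_ : i ∈ range n) => hle i]

/-- The quantity `log (min (1 / ‖β‖) Y)`. -/
noncomputable def logCap (Y β : ℝ) : ℝ := -Real.log (max (distInt β) (1 / Y))

lemma distInt_le_one (x : ℝ) : distInt x ≤ 1 := (abs_sub_round x).trans (by norm_num)

lemma logCap_nonneg {Y : ℝ} (hY : 1 ≤ Y) (β : ℝ) : 0 ≤ logCap Y β := by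
  have h : 0 < max (distInt β) (1 / Y) := lt_max_of_lt_right (by positivity)
  have := Real.log_nonpos h.le (max_le (distInt_le_one β) ((div_le_one (by linarith)).2 hY))
  unfold logCap
  linarith

lemma logCap_le_card {Y : ℝ} (hY : 1 ≤ Y) (β : ℝ) :
    logCap Y β ≤ Real.log 2 * #((range ⌈Real.logb 2 Y⌉₊).filter
      fun j : ℕ => distInt β < (1 / 2) ^ j) := by
  set x := max (distInt β) (1 / Y) with hx
  have hx0 : 0 < x := lt_max_of_lt_right (by positivity)
  have hl2 : 0 < Real.log 2 := Real.log_pos (by norm_num)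
  set t := -Real.log x / Real.log 2 with ht
  have htY : t ≤ Real.logb 2 Y := by
    rw [ht, Real.logb]
    gcongr
    rw [← Real.log_inv]
    refine Real.log_le_log (by positivity) ?_
    rw [inv_le_comm₀ hx0 (by linarith), ← one_div]
    exact le_max_right _ _
  have hsub : range ⌈t⌉₊ ⊆ (range ⌈Real.logb 2 Y⌉₊).filter
      fun j : ℕ => distInt β < (1 / 2) ^ j := by
    intro j hj
    rw [mem_range] at hj
    refine mem_filter.2 ⟨mem_range.2 (hj.trans_le (Nat.ceil_le_ceil htY)), ?_⟩
    rw [Nat.lt_ceil, ht, lt_div_iff₀ hl2] at hj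
    refine (le_max_left _ _).trans_lt (b := x) ?_
    rw [← Real.log_lt_log_iff hx0 (by positivity), Real.log_pow, one_div, Real.log_inv]
    linarith
  have h1 : (⌈t⌉₊ : ℝ) ≤ #((range ⌈Real.logb 2 Y⌉₊).filter
      fun j : ℕ => distInt β < (1 / 2) ^ j) := by
    exact_mod_cast (card_range _).symm.le.trans (card_le_card hsub)
  calc logCap Y β = Real.log 2 * t := by rw [ht]; unfold logCap; field_simp; rfl
    _ ≤ _ := by
        gcongr
        exact (Nat.le_ceil t).trans h1

/-- On average over primes, `p α` is not too close to the integers. -/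
lemma exists_sum_primes_logCap_le : ∃ C : ℝ, 0 < C ∧ ∀ (Y α : ℝ) (S : Finset ℕ), 2 ≤ Y →
    (∀ p ∈ S, p.Prime ∧ (p : ℝ) ≤ Y ∧ 1 / 2 ≤ p * distInt α) →
    ∑ p ∈ S, Real.log p / p * logCap Y (p * α) ≤ C * Real.log Y := by
  obtain ⟨K, hK, hsum⟩ := exists_sum_succ_div_le
  refine ⟨(30000000 + 30000 * K) * 4, by positivity, fun Y α S hY hS => ?_⟩
  have hl2 : 0 < Real.log 2 := Real.log_pos (by norm_num)
  have hl2' : Real.log 2 ≤ 1 := by linarith [Real.log_two_lt_d9]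
  have hl2'' : 1 / 2 ≤ Real.log 2 := by linarith [Real.log_two_gt_d9]
  set J := ⌈Real.logb 2 Y⌉₊ with hJ
  have hlY : Real.log 2 ≤ Real.log Y := Real.log_le_log (by norm_num) hY
  have hJY : (J : ℝ) ≤ 4 * Real.log Y := by
    have h1 : (J : ℝ) < Real.logb 2 Y + 1 :=
      Nat.ceil_lt_add_one (Real.logb_nonneg (by norm_num) (by linarith))
    have h2 : Real.logb 2 Y ≤ 2 * Real.log Y := by
      rw [Real.logb, div_le_iff₀ hl2]
      nlinarith
    linarith
  have hmap : ∀ p ∈ S, Nat.log 2 (p - 1) ∈ range J := by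
    intro p hp
    obtain ⟨hpp, hpY, -⟩ := hS p hp
    have h2 := hpp.two_le
    have h3 : 2 ^ Nat.log 2 (p - 1) ≤ p - 1 := Nat.pow_log_le_self 2 (by omega)
    rw [mem_range, hJ, Nat.lt_ceil, Real.lt_logb_iff_rpow_lt (by norm_num) (by linarith),
      Real.rpow_natCast]
    have h4 : (2 : ℝ) ^ Nat.log 2 (p - 1) < p := by exact_mod_cast (by omega)
    linarith
  rw [← sum_fiberwise_of_maps_to hmap]
  have hfib : ∀ i ∈ range J, ∑ p ∈ S with Nat.log 2 (p - 1) = i,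
      Real.log p / p * logCap Y (p * α) ≤
      30000000 + 30000 * J * (((i : ℝ) + 1) / 2 ^ (i / 32)) := by
    intro i _
    set F := S.filter fun p => Nat.log 2 (p - 1) = i
    have hF : ∀ p ∈ F, p.Prime ∧ 2 ^ i < p ∧ p ≤ 2 * 2 ^ i ∧ 1 / 2 ≤ p * distInt α := by
      intro p hp
      obtain ⟨hpS, hpi⟩ := mem_filter.1 hp
      obtain ⟨hpp, hpY, hfar⟩ := hS p hpS
      have h2 := hpp.two_le
      have h3 : 2 ^ Nat.log 2 (p - 1) ≤ p - 1 := Nat.pow_log_le_self 2 (by omega)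
      have h4 : p - 1 < 2 ^ (Nat.log 2 (p - 1) + 1) := Nat.lt_pow_succ_log_self (by norm_num) _
      rw [hpi] at h3 h4
      rw [pow_succ] at h4
      exact ⟨hpp, by omega, by omega, hfar⟩
    have hterm : ∀ p ∈ F, Real.log p / p * logCap Y (p * α) ≤
        ((i : ℝ) + 1) / 2 ^ i * #((range J).filter fun j : ℕ => distInt (p * α) < (1 / 2) ^ j) := by
      intro p hp
      obtain ⟨hpp, h1, h2, -⟩ := hF p hp
      have h1' : (2 : ℝ) ^ i < p := by exact_mod_cast h1
      have h2' : (p : ℝ) ≤ 2 ^ (i + 1) := by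
        rw [pow_succ, mul_comm]; exact_mod_cast h2
      have hp1 : (1 : ℝ) ≤ p := by exact_mod_cast hpp.one_le
      have h3 : Real.log p ≤ (i + 1) := by
        calc Real.log p ≤ Real.log (2 ^ (i + 1)) := Real.log_le_log (by linarith) h2'
          _ = (i + 1) * Real.log 2 := by rw [Real.log_pow]; push_cast; ring
          _ ≤ (i + 1) * 1 := by gcongr
          _ = _ := mul_one _
      have h4 := logCap_le_card (show 1 ≤ Y by linarith) (p * α)
      have h5 : logCap Y (p * α) ≤
          #((range J).filter fun j : ℕ => distInt (p * α) < (1 / 2) ^ j) :=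
        h4.trans (mul_le_of_le_one_left (by positivity) hl2')
      have h6 := logCap_nonneg (show 1 ≤ Y by linarith) (p * α)
      gcongr
    refine (sum_le_sum hterm).trans ?_
    rw [← mul_sum]
    have hswap : ∑ p ∈ F, (#((range J).filter fun j : ℕ => distInt (p * α) < (1 / 2) ^ j) : ℝ) =
        ∑ j ∈ range J, (#(F.filter fun p : ℕ => distInt (p * α) < (1 / 2) ^ j) : ℝ) := by
      simp only [card_filter, Nat.cast_sum]
      exact sum_comm
    rw [hswap]
    have h7 := sum_card_dyadic_le i J α F (fun p hp => (hF p hp).1) (fun p hp => (hF p hp).2.1)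
      (fun p hp => (hF p hp).2.2.1) (fun p hp => (hF p hp).2.2.2)
    refine (mul_le_mul_of_nonneg_left h7 (by positivity)).trans (le_of_eq ?_)
    field_simp
  refine (sum_le_sum hfib).trans ?_
  rw [sum_add_distrib, sum_const, card_range, nsmul_eq_mul, ← mul_sum]
  calc (J : ℝ) * 30000000 + 30000 * J * ∑ i ∈ range J, ((i : ℝ) + 1) / 2 ^ (i / 32)
      ≤ J * 30000000 + 30000 * J * K := by gcongr; exact hsum J
    _ = (30000000 + 30000 * K) * J := by ring
    _ ≤ (30000000 + 30000 * K) * (4 * Real.log Y) := by gcongr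
    _ = _ := by ring

lemma e2pi_add (x y : ℝ) : e2pi (x + y) = e2pi x * e2pi y := by
  simp only [e2pi, ← Complex.exp_add]
  congr 1
  push_cast
  ring

lemma norm_e2pi (x : ℝ) : ‖e2pi x‖ = 1 := by
  rw [e2pi, show (2 * Real.pi * Complex.I * x : ℂ) = ((2 * Real.pi * x : ℝ) : ℂ) * Complex.I by
    push_cast; ring]
  exact Complex.norm_exp_ofReal_mul_I _

lemma e2pi_intCast (m : ℤ) : e2pi m = 1 := by
  rw [e2pi, Complex.exp_eq_one_iff]
  exact ⟨m, by push_cast; ring⟩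

lemma norm_e2pi_sub_one (x : ℝ) : ‖e2pi x - 1‖ = 2 * |Real.sin (Real.pi * x)| := by
  have := Complex.norm_exp_I_mul_ofReal_sub_one (2 * Real.pi * x)
  rw [e2pi, show (2 * Real.pi * Complex.I * x : ℂ) = Complex.I * ((2 * Real.pi * x : ℝ) : ℂ) by
    push_cast; ring, this, Real.norm_eq_abs, abs_mul, abs_two]
  congr 3
  ring

lemma norm_e2pi_sub_one_le (x : ℝ) : ‖e2pi x - 1‖ ≤ 2 * Real.pi * |x| := by
  rw [norm_e2pi_sub_one]
  have h : |Real.sin (Real.pi * x)| ≤ |Real.pi * x| := Real.abs_sin_le_abs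
  rw [abs_mul, abs_of_pos Real.pi_pos] at h
  linarith

lemma four_mul_distInt_le (x : ℝ) : 4 * distInt x ≤ ‖e2pi x - 1‖ := by
  have h1 : e2pi x = e2pi (x - round x) := by
    have := e2pi_add (x - round x) (round x)
    rw [sub_add_cancel, e2pi_intCast, mul_one] at this
    exact this
  rw [h1, norm_e2pi_sub_one]
  have h2 := abs_sub_round x
  have h3 : |Real.pi * (x - round x)| ≤ Real.pi / 2 := by
    rw [abs_mul, abs_of_pos Real.pi_pos]
    have := Real.pi_pos
    nlinarith
  have h4 := Real.mul_abs_le_abs_sin h3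
  rw [abs_mul, abs_of_pos Real.pi_pos, ← mul_assoc, div_mul_cancel₀ _ Real.pi_ne_zero] at h4
  unfold distInt
  linarith

lemma sum_Ioc_e2pi_mul (A k : ℕ) (hAk : A ≤ k) (β : ℝ) :
    (∑ n ∈ Ioc A k, e2pi (n * β)) * (e2pi β - 1) =
      e2pi (((k + 1 : ℕ) : ℝ) * β) - e2pi (((A + 1 : ℕ) : ℝ) * β) := by
  induction k, hAk using Nat.le_induction with
  | base => simp
  | succ k hk ih =>
    rw [sum_Ioc_succ_top hk, add_mul, ih]
    have h : e2pi (((k + 1 + 1 : ℕ) : ℝ) * β) = e2pi (((k + 1 : ℕ) : ℝ) * β) * e2pi β := by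
      rw [← e2pi_add]
      congr 1
      push_cast
      ring
    rw [h]
    ring

lemma norm_sum_Ioc_e2pi_le (A k : ℕ) {β : ℝ} (hβ : 0 < distInt β) :
    ‖∑ n ∈ Ioc A k, e2pi (n * β)‖ ≤ 1 / (2 * distInt β) := by
  rcases le_total A k with h | h
  · have h1 := congrArg norm (sum_Ioc_e2pi_mul A k h β)
    rw [norm_mul] at h1
    have h2 : ‖e2pi (((k + 1 : ℕ) : ℝ) * β) - e2pi (((A + 1 : ℕ) : ℝ) * β)‖ ≤ 2 := by
      refine (norm_sub_le _ _).trans ?_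
      rw [norm_e2pi, norm_e2pi]
      norm_num
    have h3 := four_mul_distInt_le β
    rw [le_div_iff₀ (by positivity)]
    have h4 : ‖∑ n ∈ Ioc A k, e2pi (n * β)‖ * (4 * distInt β) ≤ 2 := by
      refine le_trans ?_ (h1.le.trans h2)
      gcongr
    linarith
  · rw [Ioc_eq_empty_of_le h]
    simp only [sum_empty, norm_zero]
    positivity

/-- Partial summation against a decreasing weight. -/
lemma norm_sum_Ioc_mul_le {A B : ℕ} {w : ℕ → ℝ} {c : ℕ → ℂ} {M : ℝ}
    (hw : ∀ n, A < n → w (n + 1) ≤ w n) (hw0 : ∀ n, A < n → 0 ≤ w n)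
    (hc : ∀ k, ‖∑ n ∈ Ioc A k, c n‖ ≤ M) :
    ‖∑ n ∈ Ioc A B, (w n : ℂ) * c n‖ ≤ w (A + 1) * M := by
  have hM : 0 ≤ M := (norm_nonneg _).trans (hc 0)
  rcases le_or_gt B A with hBA | hAB
  · rw [Ioc_eq_empty_of_le hBA, sum_empty, norm_zero]
    exact mul_nonneg (hw0 _ (Nat.lt_succ_self _)) hM
  have key : ∀ k, A + 1 ≤ k → ∃ r : ℂ, ∑ n ∈ Ioc A k, (w n : ℂ) * c n =
      w k * ∑ n ∈ Ioc A k, c n + r ∧ ‖r‖ ≤ (w (A + 1) - w k) * M := by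
    intro k hk
    induction k, hk using Nat.le_induction with
    | base => exact ⟨0, by simp, by simp⟩
    | succ k hk ih =>
      obtain ⟨r, hr, hr'⟩ := ih
      refine ⟨r + ((w k - w (k + 1) : ℝ) : ℂ) * ∑ n ∈ Ioc A k, c n, ?_, ?_⟩
      · rw [sum_Ioc_succ_top (by omega : A ≤ k), sum_Ioc_succ_top (by omega : A ≤ k), hr]
        push_cast
        ring
      · have h1 := hw k (by omega)
        refine (norm_add_le _ _).trans ?_
        rw [norm_mul, Complex.norm_real, Real.norm_of_nonneg (by linarith)]
        have h2 : (w k - w (k + 1)) * ‖∑ n ∈ Ioc A k, c n‖ ≤ (w k - w (k + 1)) * M :=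
          mul_le_mul_of_nonneg_left (hc k) (by linarith)
        linarith
  obtain ⟨r, hr, hr'⟩ := key B hAB
  rw [hr]
  refine (norm_add_le _ _).trans ?_
  rw [norm_mul, Complex.norm_real, Real.norm_of_nonneg (hw0 B hAB)]
  have := mul_le_mul_of_nonneg_left (hc B) (hw0 B hAB)
  linarith

lemma norm_sum_e2pi_div_le {A B : ℕ} {β : ℝ} (h : 1 ≤ (A + 1) * distInt β) :
    ‖∑ n ∈ Ioc A B, e2pi (n * β) / n‖ ≤ 1 := by
  have hβ : 0 < distInt β := pos_of_mul_pos_right (lt_of_lt_of_le one_pos h) (by positivity)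
  have h1 := norm_sum_Ioc_mul_le (A := A) (B := B) (w := fun n => 1 / (n : ℝ))
    (c := fun n => e2pi (n * β)) (M := 1 / (2 * distInt β)) (fun n hn => by
      have : (0 : ℝ) < n := by exact_mod_cast (by omega : 0 < n)
      gcongr
      linarith) (fun n _ => by positivity) (fun k => norm_sum_Ioc_e2pi_le A k hβ)
  have h2 : ∑ n ∈ Ioc A B, e2pi (n * β) / n =
      ∑ n ∈ Ioc A B, ((1 / (n : ℝ) : ℝ) : ℂ) * e2pi (n * β) := by
    refine sum_congr rfl fun n _ => ?_
    push_cast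
    ring
  rw [h2]
  refine h1.trans ?_
  rw [div_mul_div_comm, div_le_one (by positivity)]
  push_cast
  linarith

lemma sum_Ioc_one_div_le (A B : ℕ) :
    ∑ n ∈ Ioc A B, (1 : ℝ) / n ≤ 1 + Real.log B := by
  have h := harmonic_le_one_add_log B
  rw [harmonic_eq_sum_Icc] at h
  push_cast at h
  refine le_trans ?_ h
  have hsub : Ioc A B ⊆ Icc 1 B := fun n hn => by
    rw [mem_Ioc] at hn
    exact mem_Icc.2 ⟨by omega, hn.2⟩
  refine (sum_le_sum_of_subset_of_nonneg hsub fun n _ _ => by positivity).trans (le_of_eq ?_)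
  exact sum_congr rfl fun n _ => one_div _

lemma sum_Ioc_split {R : Type*} [AddCommMonoid R] (F : ℕ → R) {A A' : ℕ} (hA : A ≤ A') (B : ℕ) :
    ∑ n ∈ Ioc A B, F n = ∑ n ∈ Ioc A (min B A'), F n + ∑ n ∈ Ioc A' B, F n := by
  rcases le_total B A' with h | h
  · rw [min_eq_left h, Ioc_eq_empty_of_le h, sum_empty, add_zero]
  · rw [min_eq_right h, sum_Ioc_consecutive _ hA h]

lemma norm_sum_e2pi_div_le_logCap {A B : ℕ} {Y β : ℝ} (hY : 1 ≤ Y) (hB : (B : ℝ) ≤ Y) :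
    ‖∑ n ∈ Ioc A B, e2pi (n * β) / n‖ ≤ 2 + logCap Y β := by
  have hL := logCap_nonneg hY β
  set x := max (distInt β) (1 / Y) with hx
  have hx0 : 0 < x := lt_max_of_lt_right (by positivity)
  have htriv : ∀ B' : ℕ, (B' : ℝ) ≤ 1 / x → ‖∑ n ∈ Ioc A B', e2pi (n * β) / n‖ ≤ 1 + logCap Y β := by
    intro B' hB'
    rcases Nat.eq_zero_or_pos B' with rfl | h0
    · simp only [zero_le, Ioc_eq_empty_of_le, sum_empty, norm_zero]
      linarith
    · refine (norm_sum_le _ _).trans ?_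
      have e1 : ∑ n ∈ Ioc A B', ‖e2pi (n * β) / n‖ = ∑ n ∈ Ioc A B', (1 : ℝ) / n :=
        sum_congr rfl fun n _ => by rw [norm_div, norm_e2pi, Complex.norm_natCast]
      rw [e1]
      refine (sum_Ioc_one_div_le A B').trans ?_
      gcongr
      unfold logCap
      rw [← Real.log_inv, ← one_div]
      exact Real.log_le_log (by exact_mod_cast h0) hB'
  rcases le_total (distInt β) (1 / Y) with h | h
  · have : x = 1 / Y := max_eq_right h
    have := htriv B (by rw [this, one_div_one_div]; exact hB)
    linarith
  · have hxd : x = distInt β := max_eq_left h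
    have hd0 : 0 < distInt β := hxd ▸ hx0
    rw [sum_Ioc_split _ (le_max_left A ⌊1 / x⌋₊) B]
    have h1 : ‖∑ n ∈ Ioc (max A ⌊1 / x⌋₊) B, e2pi (n * β) / n‖ ≤ 1 := by
      refine norm_sum_e2pi_div_le ?_
      have e1 : 1 / x < ⌊1 / x⌋₊ + 1 := Nat.lt_floor_add_one _
      rw [div_lt_iff₀ hx0, hxd] at e1
      push_cast
      have e2 : (⌊1 / distInt β⌋₊ : ℝ) ≤ max (A : ℝ) ⌊1 / x⌋₊ := by
        rw [hxd]; exact le_max_right _ _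
      nlinarith
    have h2 : ‖∑ n ∈ Ioc A (min B (max A ⌊1 / x⌋₊)), e2pi (n * β) / n‖ ≤ 1 + logCap Y β := by
      rcases le_total A ⌊1 / x⌋₊ with hA | hA
      · refine htriv _ ?_
        rw [max_eq_right hA]
        exact le_trans (by exact_mod_cast min_le_right _ _) (Nat.floor_le (by positivity))
      · rw [max_eq_left hA, Ioc_eq_empty_of_le (min_le_right _ _), sum_empty, norm_zero]
        linarith
    refine (norm_add_le _ _).trans ?_
    linarith

lemma sum_Ioc_sum_divisors {R : Type*} [AddCommMonoid R] (F : ℕ → ℕ → R) (A B : ℕ) :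
    ∑ n ∈ Ioc A B, ∑ d ∈ n.divisors, F d (n / d) =
      ∑ d ∈ Icc 1 B, ∑ m ∈ Ioc (A / d) (B / d), F d m := by
  rw [sum_sigma', sum_sigma']
  refine sum_bij' (fun x _ => ⟨x.2, x.1 / x.2⟩) (fun x _ => ⟨x.1 * x.2, x.1⟩) ?_ ?_ ?_ ?_ ?_
  · rintro ⟨n, d⟩ h
    simp only [mem_sigma, mem_Ioc, Nat.mem_divisors, mem_Icc] at h ⊢
    obtain ⟨⟨hA, hB⟩, ⟨m, rfl⟩, h0⟩ := h
    have hd : 0 < d := Nat.pos_of_mul_pos_right (Nat.pos_of_ne_zero h0)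
    rw [Nat.mul_div_cancel_left _ hd]
    refine ⟨⟨hd, ?_⟩, (Nat.div_lt_iff_lt_mul hd).2 (by rwa [mul_comm]),
      (Nat.le_div_iff_mul_le hd).2 (by rwa [mul_comm])⟩
    exact (Nat.le_mul_of_pos_right d (Nat.pos_of_ne_zero (by rintro rfl; simp at h0))).trans hB
  · rintro ⟨d, m⟩ h
    simp only [mem_sigma, mem_Ioc, Nat.mem_divisors, mem_Icc] at h ⊢
    obtain ⟨⟨hd, -⟩, hA, hB⟩ := h
    rw [Nat.div_lt_iff_lt_mul hd, mul_comm] at hA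
    rw [Nat.le_div_iff_mul_le hd, mul_comm] at hB
    exact ⟨⟨hA, hB⟩, Dvd.intro _ rfl, by omega⟩
  · rintro ⟨n, d⟩ h
    simp only [mem_sigma, Nat.mem_divisors] at h
    simp only [Nat.mul_div_cancel' h.2.1]
  · rintro ⟨d, m⟩ h
    simp only [mem_sigma, mem_Icc] at h
    simp only [Nat.mul_div_cancel_left _ h.1.1]
  · rintro ⟨n, d⟩ _
    rfl

/-- Mertens' upper bound. -/
lemma exists_sum_vonMangoldt_div_le : ∃ c : ℝ, 0 < c ∧ ∀ n : ℕ, 1 ≤ n →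
    ∑ d ∈ Icc 1 n, Λ d / d ≤ Real.log n + c := by
  refine ⟨Real.log 4 + 4, by positivity, fun n hn => ?_⟩
  have hn0 : (0 : ℝ) < n := by exact_mod_cast hn
  have h1 : ∑ d ∈ Icc 1 n, Λ d * ((n / d : ℕ) : ℝ) ≤ n * Real.log n := by
    have h := sum_Ioc_sum_divisors (fun d _ => Λ d) 0 n
    have e : ∑ d ∈ Icc 1 n, Λ d * ((n / d : ℕ) : ℝ) = ∑ m ∈ Ioc 0 n, Real.log m := by
      simp only [vonMangoldt_sum] at h
      rw [h]
      refine sum_congr rfl fun d _ => ?_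
      simp [mul_comm]
    rw [e]
    refine (sum_le_card_nsmul _ _ (Real.log n) fun m hm => ?_).trans (le_of_eq (by simp))
    rw [mem_Ioc] at hm
    exact Real.log_le_log (by exact_mod_cast hm.1) (by exact_mod_cast hm.2)
  have h2 : ∑ d ∈ Icc 1 n, Λ d ≤ (Real.log 4 + 4) * n := by
    have := Chebyshev.psi_le_const_mul_self hn0.le
    rw [Chebyshev.psi, Nat.floor_natCast] at this
    exact this
  have h3 : n * ∑ d ∈ Icc 1 n, Λ d / d ≤
      ∑ d ∈ Icc 1 n, Λ d * ((n / d : ℕ) : ℝ) + ∑ d ∈ Icc 1 n, Λ d := by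
    rw [mul_sum, ← sum_add_distrib]
    refine sum_le_sum fun d hd => ?_
    have hd0 : (0 : ℝ) < d := by exact_mod_cast (mem_Icc.1 hd).1
    have e : (n : ℝ) / d ≤ ((n / d : ℕ) : ℝ) + 1 := by
      rw [← Nat.floor_div_eq_div (K := ℝ)]
      exact (Nat.lt_floor_add_one _).le
    calc n * (Λ d / d) = Λ d * (n / d) := by ring
      _ ≤ Λ d * (((n / d : ℕ) : ℝ) + 1) := mul_le_mul_of_nonneg_left e vonMangoldt_nonneg
      _ = _ := by ring
  refine le_of_mul_le_mul_left ?_ hn0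
  linarith

lemma exists_sum_vonMangoldt_nonprime_le : ∃ c : ℝ, 0 < c ∧ ∀ S : Finset ℕ,
    (∀ d ∈ S, ¬ d.Prime) → ∑ d ∈ S, Λ d / d ≤ c := by
  have hs := vonMangoldt.summable_residueClass_non_primes_div (q := 1) 0
  refine ⟨∑' n : ℕ, (if n.Prime then 0 else vonMangoldt.residueClass (q := 1) 0 n) / n + 1, ?_, ?_⟩
  · have : 0 ≤ ∑' n : ℕ, (if n.Prime then 0 else vonMangoldt.residueClass (q := 1) 0 n) / n := by
      refine tsum_nonneg fun n => div_nonneg ?_ (Nat.cast_nonneg _)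
      split_ifs
      exacts [le_rfl, vonMangoldt.residueClass_nonneg _ _]
    linarith
  · intro S hS
    have h := hs.sum_le_tsum S fun n _ => div_nonneg (by
      split_ifs
      exacts [le_rfl, vonMangoldt.residueClass_nonneg _ _]) (Nat.cast_nonneg _)
    have e : ∑ d ∈ S, Λ d / d =
        ∑ d ∈ S, (if d.Prime then 0 else vonMangoldt.residueClass (q := 1) 0 d) / (d : ℝ) := by
      refine sum_congr rfl fun d hd => ?_
      rw [if_neg (hS d hd), vonMangoldt.residueClass, Set.indicator_of_mem]
      exact Subsingleton.elim _ _
    linarith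

lemma exists_sum_prime_log_div_le : ∃ c : ℝ, 0 < c ∧ ∀ (Y : ℝ) (S : Finset ℕ), 1 ≤ Y →
    (∀ p ∈ S, p.Prime ∧ (p : ℝ) ≤ Y) → ∑ p ∈ S, Real.log p / p ≤ Real.log Y + c := by
  obtain ⟨c, hc, h⟩ := exists_sum_vonMangoldt_div_le
  refine ⟨c, hc, fun Y S hY hS => ?_⟩
  have h1 := h ⌊Y⌋₊ (Nat.le_floor (by exact_mod_cast hY))
  have h2 : Real.log ⌊Y⌋₊ ≤ Real.log Y :=
    Real.log_le_log (by exact_mod_cast Nat.floor_pos.2 hY) (Nat.floor_le (by linarith))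
  have h3 : ∑ p ∈ S, Real.log p / p ≤ ∑ d ∈ Icc 1 ⌊Y⌋₊, Λ d / d := by
    have e : ∑ p ∈ S, Real.log p / p = ∑ p ∈ S, Λ p / p :=
      sum_congr rfl fun p hp => by rw [vonMangoldt_apply_prime (hS p hp).1]
    rw [e]
    refine sum_le_sum_of_subset_of_nonneg (fun p hp => mem_Icc.2 ⟨(hS p hp).1.one_le,
      Nat.le_floor (hS p hp).2⟩) fun d _ _ => div_nonneg vonMangoldt_nonneg (Nat.cast_nonneg _)
  linarith

/-- Indicator of the integers all of whose prime factors are at most `y`. -/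
noncomputable def sm (y : ℝ) (n : ℕ) : ℝ :=
  if ∀ p : ℕ, p.Prime → p ∣ n → (p : ℝ) ≤ y then 1 else 0

lemma sm_nonneg (y : ℝ) (n : ℕ) : 0 ≤ sm y n := by
  unfold sm; split_ifs <;> norm_num

lemma sm_le_one (y : ℝ) (n : ℕ) : sm y n ≤ 1 := by
  unfold sm; split_ifs <;> norm_num

lemma sm_mono {y y' : ℝ} (h : y ≤ y') (n : ℕ) : sm y n ≤ sm y' n := by
  unfold sm
  split_ifs with h1 h2
  · exact le_rfl
  · exact absurd (fun p hp hpn => (h1 p hp hpn).trans h) h2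
  · exact zero_le_one
  · exact le_rfl

lemma sm_mul (y : ℝ) (d m : ℕ) : sm y (d * m) = sm y d * sm y m := by
  have h : (∀ p : ℕ, p.Prime → p ∣ d * m → (p : ℝ) ≤ y) ↔
      (∀ p : ℕ, p.Prime → p ∣ d → (p : ℝ) ≤ y) ∧ (∀ p : ℕ, p.Prime → p ∣ m → (p : ℝ) ≤ y) := by
    refine ⟨fun h => ⟨fun p hp hd => h p hp (hd.mul_right m), fun p hp hd => h p hp (hd.mul_left d)⟩,
      fun h p hp hd => ?_⟩
    rcases hp.dvd_mul.1 hd with hd | hd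
    exacts [h.1 p hp hd, h.2 p hp hd]
  unfold sm
  rw [if_congr h rfl rfl]
  split_ifs <;> simp_all

lemma sm_prime {y : ℝ} {p : ℕ} (hp : p.Prime) : sm y p = if (p : ℝ) ≤ y then 1 else 0 := by
  unfold sm
  refine if_congr ⟨fun h => h p hp dvd_rfl, fun h q hq hqp => ?_⟩ rfl rfl
  rwa [(Nat.prime_dvd_prime_iff_eq hq hp).1 hqp]

lemma sum_log_smul {R : Type*} [AddCommGroup R] [Module ℝ R] (f : ℕ → R) (A B : ℕ) :
    ∑ n ∈ Ioc A B, Real.log n • f n =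
      ∑ d ∈ Icc 1 B, Λ d • ∑ m ∈ Ioc (A / d) (B / d), f (d * m) := by
  have h := sum_Ioc_sum_divisors (fun d m => Λ d • f (d * m)) A B
  simp only [← smul_sum] at h
  rw [← h]
  refine sum_congr rfl fun n _ => ?_
  rw [← vonMangoldt_sum, sum_smul]
  refine sum_congr rfl fun d hd => ?_
  rw [Nat.mul_div_cancel' (Nat.dvd_of_mem_divisors hd)]

/-- Sum of the reciprocals of smooth numbers. -/
noncomputable def smSum (y : ℝ) (B : ℕ) : ℝ := ∑ n ∈ Ioc 0 B, sm y n / n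

lemma smSum_nonneg (y : ℝ) (B : ℕ) : 0 ≤ smSum y B :=
  sum_nonneg fun n _ => div_nonneg (sm_nonneg y n) (Nat.cast_nonneg _)

lemma smSum_mono_left {y y' : ℝ} (h : y ≤ y') (B : ℕ) : smSum y B ≤ smSum y' B :=
  sum_le_sum fun n _ => div_le_div_of_nonneg_right (sm_mono h n) (Nat.cast_nonneg _)

lemma sum_Ioc_sm_le_smSum (y : ℝ) (A : ℕ) {B B' : ℕ} (h : B ≤ B') :
    ∑ n ∈ Ioc A B, sm y n / n ≤ smSum y B' :=
  sum_le_sum_of_subset_of_nonneg (Ioc_subset_Ioc (Nat.zero_le _) h)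
    fun n _ _ => div_nonneg (sm_nonneg y n) (Nat.cast_nonneg _)

lemma exists_sum_vonMangoldt_sm_le : ∃ c : ℝ, 0 < c ∧ ∀ (y : ℝ) (B : ℕ), 1 ≤ y →
    ∑ d ∈ Icc 1 B, Λ d * sm y d / d ≤ Real.log y + c := by
  obtain ⟨c₁, h₁, hp⟩ := exists_sum_prime_log_div_le
  obtain ⟨c₂, h₂, hn⟩ := exists_sum_vonMangoldt_nonprime_le
  refine ⟨c₁ + c₂, by positivity, fun y B hy => ?_⟩
  rw [← sum_filter_add_sum_filter_not _ Nat.Prime]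
  have e1 : ∑ d ∈ Icc 1 B with d.Prime, Λ d * sm y d / d =
      ∑ d ∈ (Icc 1 B).filter (fun d : ℕ => d.Prime ∧ (d : ℝ) ≤ y), Real.log d / d := by
    rw [← filter_filter, sum_filter (fun d : ℕ => (d : ℝ) ≤ y)]
    refine sum_congr rfl fun p hp => ?_
    rw [mem_filter] at hp
    rw [sm_prime hp.2, vonMangoldt_apply_prime hp.2]
    split_ifs <;> simp
  have e2 : ∑ d ∈ Icc 1 B with ¬ d.Prime, Λ d * sm y d / d ≤
      ∑ d ∈ Icc 1 B with ¬ d.Prime, Λ d / d := by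
    refine sum_le_sum fun d _ => div_le_div_of_nonneg_right ?_ (Nat.cast_nonneg _)
    exact mul_le_of_le_one_right vonMangoldt_nonneg (sm_le_one y d)
  have h3 := hp y {d ∈ Icc 1 B | d.Prime ∧ (d : ℝ) ≤ y} hy fun p hp => (mem_filter.1 hp).2
  have h4 := hn {d ∈ Icc 1 B | ¬ d.Prime} fun p hp => (mem_filter.1 hp).2
  linarith

lemma one_le_log {y : ℝ} (hy : 10 ≤ y) : 1 ≤ Real.log y := by
  rw [Real.le_log_iff_exp_le (by linarith)]
  linarith [Real.exp_one_lt_d9]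

lemma two_mul_log_le {y : ℝ} (hy : 0 < y) {n : ℕ} (h : y ^ 2 ≤ n) :
    2 * Real.log y ≤ Real.log n := by
  have := Real.log_le_log (by positivity) h
  rwa [Real.log_pow, Nat.cast_ofNat] at this

lemma sum_one_div_le_of_sq {y : ℝ} (hy : 1 ≤ y) (A : ℕ) {B : ℕ} (h : (B : ℝ) ≤ y ^ 2) :
    ∑ n ∈ Ioc A B, (1 : ℝ) / n ≤ 1 + 2 * Real.log y := by
  refine (sum_Ioc_one_div_le A B).trans ?_
  rcases Nat.eq_zero_or_pos B with rfl | h0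
  · have := Real.log_nonneg hy
    simp only [CharP.cast_eq_zero, Real.log_zero]
    linarith
  · have := Real.log_le_log (by exact_mod_cast h0) h
    rw [Real.log_pow, Nat.cast_ofNat] at this
    linarith

lemma exists_smSum_le : ∃ C : ℝ, 0 < C ∧ ∀ (y : ℝ) (B : ℕ), 10 ≤ y →
    smSum y B ≤ C * Real.log y := by
  obtain ⟨c, hc, hΛ⟩ := exists_sum_vonMangoldt_sm_le
  have main : ∀ (y : ℝ) (B : ℕ), 10 ≤ y → 2 * c ≤ Real.log y →
      smSum y B ≤ 4 * (1 + 2 * Real.log y) := by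
    intro y B hy hcy
    have hl := one_le_log hy
    set K := ⌊y ^ 2⌋₊ with hK
    have h1 : ∑ n ∈ Ioc 0 (min B K), sm y n / n ≤ 1 + 2 * Real.log y := by
      refine le_trans (sum_le_sum fun n _ => ?_) (sum_one_div_le_of_sq (by linarith) 0
        (B := min B K) ?_)
      · exact div_le_div_of_nonneg_right (sm_le_one y n) (Nat.cast_nonneg _)
      · exact le_trans (by exact_mod_cast min_le_right _ _) (Nat.floor_le (by positivity))
    have h2 : 2 * Real.log y * ∑ n ∈ Ioc K B, sm y n / n ≤ (Real.log y + c) * smSum y B := by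
      calc 2 * Real.log y * ∑ n ∈ Ioc K B, sm y n / n
          ≤ ∑ n ∈ Ioc K B, Real.log n • (sm y n / n) := by
            rw [mul_sum]
            refine sum_le_sum fun n hn => mul_le_mul_of_nonneg_right ?_
              (div_nonneg (sm_nonneg y n) (Nat.cast_nonneg _))
            exact two_mul_log_le (by linarith) (Nat.lt_of_floor_lt (mem_Ioc.1 hn).1).le
        _ = ∑ d ∈ Icc 1 B, Λ d • ∑ m ∈ Ioc (K / d) (B / d), sm y (d * m) / ((d * m : ℕ) : ℝ) :=
            sum_log_smul (fun n => sm y n / n) K B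
        _ ≤ ∑ d ∈ Icc 1 B, Λ d * sm y d / d * smSum y B := by
            refine sum_le_sum fun d _ => ?_
            have e : ∑ m ∈ Ioc (K / d) (B / d), sm y (d * m) / ((d * m : ℕ) : ℝ) =
                sm y d / d * ∑ m ∈ Ioc (K / d) (B / d), sm y m / m := by
              rw [mul_sum]
              refine sum_congr rfl fun m _ => ?_
              rw [sm_mul]
              push_cast
              rw [mul_div_mul_comm]
            rw [e, smul_eq_mul, ← mul_assoc, ← mul_div_assoc]
            exact mul_le_mul_of_nonneg_left (sum_Ioc_sm_le_smSum y _ (Nat.div_le_self _ _))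
              (div_nonneg (mul_nonneg vonMangoldt_nonneg (sm_nonneg y d)) (Nat.cast_nonneg _))
        _ ≤ _ := by
            rw [← sum_mul]
            exact mul_le_mul_of_nonneg_right (hΛ y B (by linarith)) (smSum_nonneg y B)
    have h3 : smSum y B = _ := sum_Ioc_split (fun n => sm y n / (n : ℝ)) (Nat.zero_le K) B
    have h4 := smSum_nonneg y B
    have h5 : ∑ n ∈ Ioc K B, sm y n / n ≤ 3 / 4 * smSum y B := by
      refine le_of_mul_le_mul_left (h2.trans ?_) (by linarith : 0 < 2 * Real.log y)
      nlinarith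
    linarith
  refine ⟨12 + 16 * c, by positivity, fun y B hy => ?_⟩
  have hl := one_le_log hy
  have h0 := main (max y (Real.exp (2 * c))) B (hy.trans (le_max_left _ _)) (by
    rw [Real.le_log_iff_exp_le (by positivity)]
    exact le_max_right _ _)
  have h1 := smSum_mono_left (le_max_left y (Real.exp (2 * c))) B
  have h2 : Real.log (max y (Real.exp (2 * c))) ≤ Real.log y + 2 * c := by
    rcases max_cases y (Real.exp (2 * c)) with ⟨h, -⟩ | ⟨h, -⟩ <;> rw [h]
    · linarith
    · rw [Real.log_exp]; linarith
  nlinarith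

/-- The exponential sum over the smooth numbers in `(A, B]`. -/
noncomputable def smExp (y α : ℝ) (A B : ℕ) : ℂ :=
  ∑ n ∈ Ioc A B, (sm y n : ℂ) * (e2pi (n * α) / n)

lemma e2pi_dilate (d m : ℕ) (α : ℝ) :
    e2pi ((d * m : ℕ) * α) / ((d * m : ℕ) : ℂ) = (1 / d : ℂ) * (e2pi (m * (d * α)) / m) := by
  rw [show ((d * m : ℕ) : ℝ) * α = m * (d * α) by push_cast; ring, Nat.cast_mul,
    div_mul_div_comm, one_mul]

lemma mul_distInt_le {p : ℕ} {α : ℝ} (h : p * distInt α < 1 / 2) :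
    p * distInt α ≤ distInt (p * α) := by
  set r := round (p * α) with hr
  have h1 : |p * α - (p * round α : ℤ)| = p * distInt α := by
    rw [distInt, ← Nat.abs_cast (R := ℝ) p, ← abs_mul, Nat.abs_cast]
    congr 1
    push_cast
    ring
  have h2 : distInt (p * α) = |p * α - r| := rfl
  by_cases hrp : r = p * round α
  · rw [h2, hrp, h1]
  · have h3 : (1 : ℝ) ≤ |((p * round α - r : ℤ) : ℝ)| := by
      exact_mod_cast Int.one_le_abs (sub_ne_zero.2 (Ne.symm hrp))
    have h4 : |((p * round α - r : ℤ) : ℝ)| ≤ |p * α - r| + |p * α - (p * round α : ℤ)| := by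
      rw [show ((p * round α - r : ℤ) : ℝ) = (p * α - r) - (p * α - (p * round α : ℤ)) by
        push_cast; ring]
      exact abs_sub _ _
    rw [h2]
    linarith

lemma succ_le_div_succ_mul (A : ℕ) {p : ℕ} (hp : 0 < p) :
    (A + 1 : ℝ) ≤ ((A / p : ℕ) + 1) * p := by
  have := Nat.lt_mul_div_succ A hp
  have h : A + 1 ≤ (A / p + 1) * p := by rw [mul_comm]; exact this
  exact_mod_cast h

lemma one_le_div_succ_mul_distInt {A p : ℕ} {α : ℝ} (hp : 0 < p) (h : p * distInt α < 1 / 2)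
    (hA : 1 ≤ (A + 1) * distInt α) : 1 ≤ ((A / p : ℕ) + 1) * distInt (p * α) :=
  calc (1 : ℝ) ≤ (A + 1) * distInt α := hA
    _ ≤ (((A / p : ℕ) + 1) * p) * distInt α :=
      mul_le_mul_of_nonneg_right (succ_le_div_succ_mul A hp) (distInt_nonneg α)
    _ = ((A / p : ℕ) + 1) * (p * distInt α) := by ring
    _ ≤ _ := mul_le_mul_of_nonneg_left (mul_distInt_le h) (by positivity)

lemma sm_eq_one_sub {y : ℝ} (hy : 0 ≤ y) {n : ℕ} (hn : 0 < n) (h : (n : ℝ) ≤ y ^ 2) :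
    sm y n = 1 - ∑ d ∈ n.divisors, if d.Prime ∧ y < d then 1 else 0 := by
  unfold sm
  split_ifs with hs
  · rw [sum_eq_zero, sub_zero]
    intro d hd
    rw [if_neg]
    rintro ⟨hp, hyd⟩
    exact absurd (hs d hp (Nat.dvd_of_mem_divisors hd)) (not_le.2 hyd)
  · push Not at hs
    obtain ⟨p, hp, hpn, hyp⟩ := hs
    rw [sum_eq_single_of_mem p (Nat.mem_divisors.2 ⟨hpn, hn.ne'⟩), if_pos ⟨hp, hyp⟩, sub_self]
    intro q hq hqp
    rw [if_neg]
    rintro ⟨hq', hyq⟩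
    have hdvd : p * q ∣ n := ((Nat.coprime_primes hp hq').2 (Ne.symm hqp)).mul_dvd_of_dvd_of_dvd hpn
      (Nat.dvd_of_mem_divisors hq)
    have h1 : ((p * q : ℕ) : ℝ) ≤ n := by exact_mod_cast Nat.le_of_dvd hn hdvd
    push_cast at h1
    nlinarith

lemma smExp_eq_sub {y α : ℝ} (hy : 0 ≤ y) (A : ℕ) {B : ℕ} (hB : (B : ℝ) ≤ y ^ 2) :
    smExp y α A B = ∑ n ∈ Ioc A B, e2pi (n * α) / n -
      ∑ p ∈ (Icc 1 B).filter (fun p : ℕ => p.Prime ∧ y < p),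
        (1 / p : ℂ) * ∑ m ∈ Ioc (A / p) (B / p), e2pi (m * (p * α)) / m := by
  have h := sum_Ioc_sum_divisors
    (fun d m => if d.Prime ∧ y < d then e2pi ((d * m : ℕ) * α) / ((d * m : ℕ) : ℂ) else 0) A B
  have h1 : ∑ p ∈ (Icc 1 B).filter (fun p : ℕ => p.Prime ∧ y < p),
        (1 / p : ℂ) * ∑ m ∈ Ioc (A / p) (B / p), e2pi (m * (p * α)) / m =
      ∑ d ∈ Icc 1 B, ∑ m ∈ Ioc (A / d) (B / d),
        if d.Prime ∧ y < d then e2pi ((d * m : ℕ) * α) / ((d * m : ℕ) : ℂ) else 0 := by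
    rw [sum_filter]
    refine sum_congr rfl fun d _ => ?_
    split_ifs
    · rw [mul_sum]
      exact sum_congr rfl fun m _ => (e2pi_dilate d m α).symm
    · simp
  rw [h1, ← h, smExp, ← sum_sub_distrib]
  refine sum_congr rfl fun n hn => ?_
  rw [mem_Ioc] at hn
  rw [sm_eq_one_sub hy (by omega) (le_trans (by exact_mod_cast hn.2) hB)]
  push_cast
  rw [sub_mul, one_mul, sum_mul]
  congr 1
  refine sum_congr rfl fun d hd => ?_
  rw [← Nat.cast_mul, ← Nat.cast_mul, Nat.mul_div_cancel' (Nat.dvd_of_mem_divisors hd)]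
  split_ifs <;> simp

/-- The range `n ≤ y ^ 2`. -/
lemma exists_norm_smExp_le_of_le_sq : ∃ C : ℝ, 0 < C ∧ ∀ (y α : ℝ) (A B : ℕ), 10 ≤ y →
    1 ≤ (A + 1) * distInt α → (B : ℝ) ≤ y ^ 2 → ‖smExp y α A B‖ ≤ C := by
  obtain ⟨c, hc, hM⟩ := exists_sum_prime_log_div_le
  obtain ⟨C, hC, hP⟩ := exists_sum_primes_logCap_le
  refine ⟨1 + (2 * (2 + c) + 2 * C), by positivity, fun y α A B hy hA hB => ?_⟩
  have hl := one_le_log hy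
  have hl2 : Real.log (y ^ 2) = 2 * Real.log y := by rw [Real.log_pow, Nat.cast_ofNat]
  have hY : 1 ≤ y ^ 2 := by nlinarith
  rw [smExp_eq_sub (by linarith) A hB]
  refine (norm_sub_le _ _).trans (add_le_add (norm_sum_e2pi_div_le hA) ?_)
  set S := (Icc 1 B).filter (fun p : ℕ => p.Prime ∧ y < p) with hS
  have hSp : ∀ p ∈ S, p.Prime ∧ y < p ∧ (p : ℝ) ≤ y ^ 2 := by
    intro p hp
    rw [hS, mem_filter, mem_Icc] at hp
    exact ⟨hp.2.1, hp.2.2, le_trans (by exact_mod_cast hp.1.2) hB⟩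
  have hterm : ∀ p ∈ S, Real.log y *
      ‖(1 / p : ℂ) * ∑ m ∈ Ioc (A / p) (B / p), e2pi (m * (p * α)) / m‖ ≤
      2 * (Real.log p / p) +
        if 1 / 2 ≤ p * distInt α then Real.log p / p * logCap (y ^ 2) (p * α) else 0 := by
    intro p hp
    obtain ⟨hpp, hyp, hpy⟩ := hSp p hp
    have hp0 : (0 : ℝ) < p := by exact_mod_cast hpp.pos
    have hlp : Real.log y ≤ Real.log p := Real.log_le_log (by linarith) hyp.le
    have hinner : ‖∑ m ∈ Ioc (A / p) (B / p), e2pi (m * (p * α)) / m‖ ≤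
        2 + if 1 / 2 ≤ p * distInt α then logCap (y ^ 2) (p * α) else 0 := by
      split_ifs with hfar
      · refine norm_sum_e2pi_div_le_logCap hY (le_trans ?_ hB)
        exact_mod_cast Nat.div_le_self _ _
      · refine (norm_sum_e2pi_div_le ?_).trans (by norm_num)
        exact one_le_div_succ_mul_distInt hpp.pos (not_le.1 hfar) hA
    rw [norm_mul, norm_div, norm_one, Complex.norm_natCast]
    calc Real.log y * (1 / p * ‖∑ m ∈ Ioc (A / p) (B / p), e2pi (m * (p * α)) / m‖)
        ≤ Real.log p * (1 / p * (2 + if 1 / 2 ≤ p * distInt α then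
            logCap (y ^ 2) (p * α) else 0)) := by
          refine mul_le_mul hlp (mul_le_mul_of_nonneg_left hinner (by positivity)) (by positivity)
            (by linarith)
      _ = _ := by split_ifs <;> ring
  refine le_of_mul_le_mul_left ?_ (by linarith : 0 < Real.log y)
  calc Real.log y * ‖∑ p ∈ S, (1 / p : ℂ) * ∑ m ∈ Ioc (A / p) (B / p), e2pi (m * (p * α)) / m‖
      ≤ ∑ p ∈ S, Real.log y *
          ‖(1 / p : ℂ) * ∑ m ∈ Ioc (A / p) (B / p), e2pi (m * (p * α)) / m‖ := by
        rw [← mul_sum]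
        exact mul_le_mul_of_nonneg_left (norm_sum_le _ _) (by linarith)
    _ ≤ _ := sum_le_sum hterm
    _ = 2 * ∑ p ∈ S, Real.log p / p + ∑ p ∈ S.filter (fun p : ℕ => 1 / 2 ≤ p * distInt α),
          Real.log p / p * logCap (y ^ 2) (p * α) := by
        rw [sum_add_distrib, mul_sum, sum_filter (fun p : ℕ => 1 / 2 ≤ p * distInt α)]
    _ ≤ 2 * (Real.log (y ^ 2) + c) + C * Real.log (y ^ 2) := by
        refine add_le_add (mul_le_mul_of_nonneg_left (hM _ _ hY fun p hp => ?_) zero_le_two)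
          (hP _ _ _ (by nlinarith) fun p hp => ?_)
        · exact ⟨(hSp p hp).1, (hSp p hp).2.2⟩
        · rw [mem_filter] at hp
          exact ⟨(hSp p hp.1).1, (hSp p hp.1).2.2, hp.2⟩
    _ ≤ _ := by
        rw [hl2]
        nlinarith

lemma smExp_split (y α : ℝ) {A A' : ℕ} (hA : A ≤ A') (B : ℕ) :
    smExp y α A B = smExp y α A (min B A') + smExp y α A' B :=
  sum_Ioc_split _ hA B

lemma smExp_of_le (y α : ℝ) {A B : ℕ} (h : B ≤ A) : smExp y α A B = 0 := by
  rw [smExp, Ioc_eq_empty_of_le h, sum_empty]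

lemma norm_smExp_le_smSum (y α : ℝ) (A B : ℕ) : ‖smExp y α A B‖ ≤ smSum y B := by
  refine (norm_sum_le _ _).trans (le_trans (le_of_eq ?_) (sum_Ioc_sm_le_smSum y A le_rfl))
  refine sum_congr rfl fun n _ => ?_
  rw [norm_mul, norm_div, norm_e2pi, Complex.norm_natCast, Complex.norm_real,
    Real.norm_of_nonneg (sm_nonneg y n), mul_one_div]

/-- `M` bounds every smooth exponential sum starting past `y` and past the reciprocal of the
distance from the frequency to the nearest integer. -/
def IsTailBound (y M : ℝ) : Prop :=
  ∀ (α : ℝ) (A B : ℕ), y ≤ A + 1 → 1 ≤ (A + 1) * distInt α → ‖smExp y α A B‖ ≤ M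

lemma norm_smExp_le_add {y M K : ℝ} (hM0 : 0 ≤ M) (hM : IsTailBound y M)
    (hK : ∀ B, smSum y B ≤ K) {β : ℝ} {A : ℕ} (hyA : y ≤ A + 1) (B : ℕ) :
    ‖smExp y β A B‖ ≤ M + K := by
  rcases (distInt_nonneg β).eq_or_lt with h0 | h0
  · linarith [norm_smExp_le_smSum y β A B, hK B]
  rw [smExp_split y β (le_max_left A ⌊1 / distInt β⌋₊) B, add_comm M]
  refine (norm_add_le _ _).trans (add_le_add ((norm_smExp_le_smSum _ _ _ _).trans (hK _)) ?_)
  have h1 : (A : ℝ) ≤ (max A ⌊1 / distInt β⌋₊ : ℕ) := by exact_mod_cast le_max_left _ _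
  have h2 : (⌊1 / distInt β⌋₊ : ℝ) ≤ (max A ⌊1 / distInt β⌋₊ : ℕ) := by
    exact_mod_cast le_max_right _ _
  have h3 := Nat.lt_floor_add_one (1 / distInt β)
  rw [div_lt_iff₀ h0] at h3
  exact hM β _ B (by linarith) (by nlinarith)

lemma norm_smExp_dilate_le {y M C : ℝ} (hy : 10 ≤ y) (hM0 : 0 ≤ M) (hM : IsTailBound y M)
    (hC : ∀ B, smSum y B ≤ C * Real.log y) (hC0 : 0 ≤ C) {α : ℝ} {A p : ℕ} (hp : 0 < p)
    (hpy : (p : ℝ) ≤ y) (hyA : y ^ 2 ≤ A + 1) (hA : 1 ≤ (A + 1) * distInt α) (B : ℕ) :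
    ‖smExp y (p * α) (A / p) B‖ ≤
      M + if 1 / 2 ≤ p * distInt α then C * logCap y (p * α) else 0 := by
  have hp0 : (0 : ℝ) < p := by exact_mod_cast hp
  have hy' : y ≤ ((A / p : ℕ) : ℝ) + 1 := by
    have := succ_le_div_succ_mul A hp
    refine le_of_mul_le_mul_right ?_ hp0
    nlinarith
  by_cases hfirst : 1 ≤ ((A / p : ℕ) + 1) * distInt (p * α)
  · refine (hM _ _ B hy' hfirst).trans (le_add_of_nonneg_right ?_)
    split_ifs
    · exact mul_nonneg hC0 (logCap_nonneg (by linarith) _)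
    · exact le_rfl
  · have hfar : 1 / 2 ≤ p * distInt α := by
      by_contra h
      exact hfirst (one_le_div_succ_mul_distInt hp (not_le.1 h) hA)
    have hcap : logCap y (p * α) = Real.log y := by
      unfold logCap
      rw [max_eq_right, one_div, Real.log_inv, neg_neg]
      rw [le_div_iff₀ (by linarith)]
      have := distInt_nonneg (p * α)
      nlinarith
    rw [if_pos hfar, hcap]
    exact norm_smExp_le_add hM0 hM hC hy' B

lemma sum_log_mul_smExp (y α : ℝ) (A B : ℕ) :
    ∑ n ∈ Ioc A B, Real.log n • ((sm y n : ℂ) * (e2pi (n * α) / n)) =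
      ∑ d ∈ Icc 1 B, ((Λ d * sm y d / d : ℝ) : ℂ) * smExp y (d * α) (A / d) (B / d) := by
  rw [sum_log_smul (fun n => (sm y n : ℂ) * (e2pi (n * α) / n))]
  refine sum_congr rfl fun d _ => ?_
  rw [smExp, mul_sum, smul_sum]
  refine sum_congr rfl fun m _ => ?_
  rw [e2pi_dilate, sm_mul, Complex.real_smul]
  push_cast
  ring

lemma exists_norm_sum_log_le : ∃ c K : ℝ, 0 < c ∧ 0 < K ∧ ∀ y M : ℝ, 10 ≤ y → 0 ≤ M →
    IsTailBound y M → ∀ (α : ℝ) (A B : ℕ), y ^ 2 ≤ A + 1 → 1 ≤ (A + 1) * distInt α →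
    ‖∑ n ∈ Ioc A B, Real.log n • ((sm y n : ℂ) * (e2pi (n * α) / n))‖ ≤
      (Real.log y + c) * M + K * Real.log y := by
  obtain ⟨c, hc, hΛ⟩ := exists_sum_prime_log_div_le
  obtain ⟨c', hc', hΛ'⟩ := exists_sum_vonMangoldt_nonprime_le
  obtain ⟨C, hC, hP⟩ := exists_sum_primes_logCap_le
  obtain ⟨D, hD, hT⟩ := exists_smSum_le
  refine ⟨c, D * C + D * c', hc, by positivity, fun y M hy hM0 hM α A B hyA hA => ?_⟩
  have hl := one_le_log hy
  rw [sum_log_mul_smExp]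
  refine (norm_sum_le _ _).trans ?_
  have hnorm : ∀ d : ℕ, ‖((Λ d * sm y d / d : ℝ) : ℂ) * smExp y (d * α) (A / d) (B / d)‖ =
      Λ d * sm y d / d * ‖smExp y (d * α) (A / d) (B / d)‖ := fun d => by
    rw [norm_mul, Complex.norm_real, Real.norm_of_nonneg]
    exact div_nonneg (mul_nonneg vonMangoldt_nonneg (sm_nonneg y d)) (Nat.cast_nonneg _)
  simp only [hnorm]
  rw [← sum_filter_add_sum_filter_not _ Nat.Prime]
  set S := (Icc 1 B).filter (fun p : ℕ => p.Prime ∧ (p : ℝ) ≤ y) with hS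
  have hSp : ∀ p ∈ S, p.Prime ∧ (p : ℝ) ≤ y := fun p hp => (mem_filter.1 hp).2
  have hprime : ∑ d ∈ Icc 1 B with d.Prime,
      Λ d * sm y d / d * ‖smExp y (d * α) (A / d) (B / d)‖ ≤
      (Real.log y + c) * M + D * C * Real.log y := by
    calc ∑ d ∈ Icc 1 B with d.Prime, Λ d * sm y d / d * ‖smExp y (d * α) (A / d) (B / d)‖
        = ∑ p ∈ S, Real.log p / p * ‖smExp y (p * α) (A / p) (B / p)‖ := by
          rw [hS, ← filter_filter, sum_filter (fun d : ℕ => (d : ℝ) ≤ y)]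
          refine sum_congr rfl fun p hp => ?_
          rw [mem_filter] at hp
          rw [sm_prime hp.2, vonMangoldt_apply_prime hp.2]
          split_ifs <;> simp
      _ ≤ ∑ p ∈ S, (Real.log p / p * M +
            D * if 1 / 2 ≤ p * distInt α then Real.log p / p * logCap y (p * α) else 0) := by
          refine sum_le_sum fun p hp => ?_
          have h1 := norm_smExp_dilate_le hy hM0 hM (fun B => hT y B hy) hD.le (hSp p hp).1.pos
            (hSp p hp).2 hyA hA (B / p)
          refine (mul_le_mul_of_nonneg_left h1 (by positivity)).trans (le_of_eq ?_)
          split_ifs <;> ring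
      _ = (∑ p ∈ S, Real.log p / p) * M +
            D * ∑ p ∈ S.filter (fun p : ℕ => 1 / 2 ≤ p * distInt α),
              Real.log p / p * logCap y (p * α) := by
          rw [sum_add_distrib, sum_mul, mul_sum (S.filter _), ← mul_sum, mul_sum,
            sum_filter (fun p : ℕ => 1 / 2 ≤ p * distInt α)]
          congr 1
          refine sum_congr rfl fun p _ => ?_
          split_ifs <;> simp
      _ ≤ (Real.log y + c) * M + D * (C * Real.log y) := by
          refine add_le_add (mul_le_mul_of_nonneg_right (hΛ y S (by linarith) hSp) hM0)
            (mul_le_mul_of_nonneg_left (hP y α _ (by linarith) fun p hp => ?_) hD.le)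
          rw [mem_filter] at hp
          exact ⟨(hSp p hp.1).1, (hSp p hp.1).2, hp.2⟩
      _ = _ := by ring
  have hnon : ∑ d ∈ Icc 1 B with ¬ d.Prime,
      Λ d * sm y d / d * ‖smExp y (d * α) (A / d) (B / d)‖ ≤ D * c' * Real.log y := by
    calc ∑ d ∈ Icc 1 B with ¬ d.Prime, Λ d * sm y d / d * ‖smExp y (d * α) (A / d) (B / d)‖
        ≤ ∑ d ∈ Icc 1 B with ¬ d.Prime, Λ d / d * (D * Real.log y) := by
          refine sum_le_sum fun d _ => mul_le_mul ?_
            ((norm_smExp_le_smSum _ _ _ _).trans (hT y _ hy)) (norm_nonneg _)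
            (div_nonneg vonMangoldt_nonneg (Nat.cast_nonneg _))
          exact div_le_div_of_nonneg_right
            (mul_le_of_le_one_right vonMangoldt_nonneg (sm_le_one y d)) (Nat.cast_nonneg _)
      _ ≤ c' * (D * Real.log y) := by
          rw [← sum_mul]
          exact mul_le_mul_of_nonneg_right (hΛ' _ fun d hd => (mem_filter.1 hd).2) (by positivity)
      _ = _ := by ring
  linarith

/-- The range `n ≥ y ^ 2`. -/
lemma exists_two_mul_log_mul_norm_smExp_le : ∃ c K : ℝ, 0 < c ∧ 0 < K ∧ ∀ y M : ℝ, 10 ≤ y →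
    0 ≤ M → IsTailBound y M → ∀ (α : ℝ) (A B : ℕ), y ^ 2 ≤ A + 1 → 1 ≤ (A + 1) * distInt α →
    2 * Real.log y * ‖smExp y α A B‖ ≤ (Real.log y + c) * M + K * Real.log y := by
  obtain ⟨c, K, hc, hK, h⟩ := exists_norm_sum_log_le
  refine ⟨c, K, hc, hK, fun y M hy hM0 hM α A B hyA hA => ?_⟩
  have hl := one_le_log hy
  have hlog : ∀ n, A < n → 0 < Real.log n := fun n hn => by
    have h1 : ((A + 1 : ℕ) : ℝ) ≤ n := by exact_mod_cast hn
    push_cast at h1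
    exact lt_of_lt_of_le (by linarith) (two_mul_log_le (by linarith) (hyA.trans h1))
  have habel := norm_sum_Ioc_mul_le (A := A) (B := B) (w := fun n => 1 / Real.log n)
    (c := fun n => Real.log n • ((sm y n : ℂ) * (e2pi (n * α) / n)))
    (M := (Real.log y + c) * M + K * Real.log y) (fun n hn => by
      refine one_div_le_one_div_of_le (hlog n hn) (Real.log_le_log ?_ (by simp))
      exact_mod_cast (by omega : 0 < n)) (fun n hn => (one_div_pos.2 (hlog n hn)).le)
    (fun k => h y M hy hM0 hM α A k hyA hA)
  have e : ∑ n ∈ Ioc A B, ((1 / Real.log n : ℝ) : ℂ) *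
      Real.log n • ((sm y n : ℂ) * (e2pi (n * α) / n)) = smExp y α A B := by
    refine sum_congr rfl fun n hn => ?_
    have := (hlog n (mem_Ioc.1 hn).1).ne'
    rw [Complex.real_smul, ← mul_assoc, ← Complex.ofReal_mul, one_div_mul_cancel this,
      Complex.ofReal_one, one_mul]
  rw [e] at habel
  have h1 := two_mul_log_le (by linarith : 0 < y) (n := A + 1) (by push_cast; exact hyA)
  have h2 := hlog (A + 1) (Nat.lt_succ_self A)
  rw [one_div_mul_eq_div, le_div_iff₀ h2, mul_comm] at habel
  exact (mul_le_mul_of_nonneg_right h1 (norm_nonneg _)).trans habel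

lemma exists_isTailBound : ∃ C : ℝ, 0 < C ∧ ∀ y : ℝ, 10 ≤ y → IsTailBound y C := by
  obtain ⟨c, K, hc, hK, hlarge⟩ := exists_two_mul_log_mul_norm_smExp_le
  obtain ⟨C, hC, hsmall⟩ := exists_norm_smExp_le_of_le_sq
  obtain ⟨D, hD, hT⟩ := exists_smSum_le
  refine ⟨4 * (C + K / 2) + D * (2 * c), by positivity, fun y hy => ?_⟩
  have hl := one_le_log hy
  have htriv : IsTailBound y (D * Real.log y) := fun α A B _ _ =>
    (norm_smExp_le_smSum _ _ _ _).trans (hT y B hy)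
  rcases le_total (Real.log y) (2 * c) with hsm | hbig
  · intro α A B hyA hA
    refine (htriv α A B hyA hA).trans ?_
    nlinarith
  set V : Set ℝ := {x | ∃ (α : ℝ) (A B : ℕ), y ≤ A + 1 ∧ 1 ≤ (A + 1) * distInt α ∧
    x = ‖smExp y α A B‖} with hV
  have hbdd : BddAbove V := ⟨D * Real.log y, by
    rintro x ⟨α, A, B, h1, h2, rfl⟩
    exact htriv α A B h1 h2⟩
  have hM : IsTailBound y (sSup V) := fun α A B h1 h2 => le_csSup hbdd ⟨α, A, B, h1, h2, rfl⟩
  have hM0 : 0 ≤ sSup V := Real.sSup_nonneg (by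
    rintro x ⟨α, A, B, -, -, rfl⟩
    exact norm_nonneg _)
  have hstep : ∀ x ∈ V, x ≤ 3 / 4 * sSup V + (C + K / 2) := by
    rintro x ⟨α, A, B, h1, h2, rfl⟩
    set A' := max A ⌊y ^ 2⌋₊ with hA'
    have hAA' : (A : ℝ) ≤ A' := by exact_mod_cast le_max_left A _
    have hyA' : y ^ 2 ≤ A' + 1 := by
      have e1 := Nat.lt_floor_add_one (y ^ 2)
      have e2 : (⌊y ^ 2⌋₊ : ℝ) ≤ A' := by exact_mod_cast le_max_right A _
      linarith
    have hdA' : 1 ≤ (A' + 1) * distInt α := by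
      have := distInt_nonneg α
      nlinarith
    rw [smExp_split y α (le_max_left A ⌊y ^ 2⌋₊) B]
    refine (norm_add_le _ _).trans ?_
    have g1 : ‖smExp y α A (min B A')‖ ≤ C := by
      rcases le_total ⌊y ^ 2⌋₊ A with h | h
      · rw [hA', max_eq_left h, smExp_of_le _ _ (min_le_right _ _), norm_zero]
        exact hC.le
      · refine hsmall y α A _ hy h2 ?_
        rw [hA', max_eq_right h]
        exact le_trans (by exact_mod_cast min_le_right _ _) (Nat.floor_le (by positivity))
    have g2 := hlarge y (sSup V) hy hM0 hM α A' B hyA' hdA'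
    have g3 : ‖smExp y α A' B‖ ≤ 3 / 4 * sSup V + K / 2 := by
      refine le_of_mul_le_mul_left (g2.trans ?_) (by linarith : 0 < 2 * Real.log y)
      nlinarith
    linarith
  have hfin : sSup V ≤ 4 * (C + K / 2) := by
    have := Real.sSup_le hstep (by positivity)
    linarith
  intro α A B h1 h2
  have := hM α A B h1 h2
  have : 0 ≤ D * (2 * c) := by positivity
  linarith

lemma distInt_eq_abs {α : ℝ} (h : α ∈ Set.Ico (-(1 : ℝ) / 2) (1 / 2)) : distInt α = |α| := by
  have h0 : round α = 0 := by
    rw [round_eq, Int.floor_eq_zero_iff]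
    exact ⟨by linarith [h.1], by linarith [h.2]⟩
  rw [distInt, h0, Int.cast_zero, sub_zero]

lemma sum_filter_smooth {R : Type*} [Semiring R] [Module ℝ R] (y : ℝ) (B : ℕ) (f : ℕ → R) :
    ∑ n ∈ (Icc 1 B).filter (fun n : ℕ => ∀ p : ℕ, p.Prime → p ∣ n → (p : ℝ) ≤ y), f n =
      ∑ n ∈ Ioc 0 B, sm y n • f n := by
  rw [sum_filter]
  refine sum_congr rfl fun n _ => ?_
  unfold sm
  split_ifs <;> simp

lemma norm_smExp_sub_smSum_le (y α : ℝ) (B : ℕ) :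
    ‖smExp y α 0 B - (smSum y B : ℂ)‖ ≤ 2 * Real.pi * (B * |α|) := by
  have h : smExp y α 0 B - (smSum y B : ℂ) =
      ∑ n ∈ Ioc 0 B, (sm y n : ℂ) * ((e2pi (n * α) - 1) / n) := by
    rw [smExp, smSum]
    push_cast
    rw [← sum_sub_distrib]
    exact sum_congr rfl fun n _ => by ring
  rw [h]
  refine (norm_sum_le _ _).trans ((sum_le_card_nsmul _ _ (2 * Real.pi * |α|) fun n hn => ?_).trans
    (le_of_eq ?_))
  · have hn0 : (0 : ℝ) < n := by exact_mod_cast (mem_Ioc.1 hn).1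
    rw [norm_mul, norm_div, Complex.norm_natCast, Complex.norm_real,
      Real.norm_of_nonneg (sm_nonneg y n)]
    refine (mul_le_of_le_one_left (by positivity) (sm_le_one y n)).trans ?_
    rw [div_le_iff₀ hn0]
    refine (norm_e2pi_sub_one_le _).trans (le_of_eq ?_)
    rw [abs_mul, Nat.abs_cast]
    ring
  · rw [Nat.card_Ioc, nsmul_eq_mul, Nat.sub_zero]
    ring

lemma exists_norm_smExp_tail_le : ∃ C : ℝ, 0 < C ∧ ∀ (y α : ℝ) (A B : ℕ), 10 ≤ y →
    1 ≤ (A + 1) * distInt α → ‖smExp y α A B‖ ≤ C := by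
  obtain ⟨C, hC, hsmall⟩ := exists_norm_smExp_le_of_le_sq
  obtain ⟨D, hD, htail⟩ := exists_isTailBound
  refine ⟨C + D, by positivity, fun y α A B hy hA => ?_⟩
  rw [smExp_split y α (le_max_left A ⌊y⌋₊) B]
  refine (norm_add_le _ _).trans (add_le_add ?_ ?_)
  · rcases le_total ⌊y⌋₊ A with h | h
    · rw [max_eq_left h, smExp_of_le _ _ (min_le_right _ _), norm_zero]
      exact hC.le
    · refine hsmall y α A _ hy hA ?_
      rw [max_eq_right h]
      refine le_trans (by exact_mod_cast min_le_right _ _)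
        ((Nat.floor_le (by linarith)).trans (by nlinarith : y ≤ y ^ 2))
  · have h1 : (A : ℝ) ≤ (max A ⌊y⌋₊ : ℕ) := by exact_mod_cast le_max_left _ _
    have h2 : (⌊y⌋₊ : ℝ) ≤ (max A ⌊y⌋₊ : ℕ) := by exact_mod_cast le_max_right _ _
    have h3 := Nat.lt_floor_add_one y
    have h4 := distInt_nonneg α
    exact htail y hy α _ B (by linarith) (by nlinarith)

end SmoothExpSum

/-- Lemma 4(a): smooth exponential sums. -/
theorem smooth_exponential_sum :
    ∃ C : ℝ, 0 < C ∧
      ∀ y α z : ℝ, 10 ≤ y → α ∈ Set.Ico (-(1 : ℝ) / 2) (1 / 2) → α ≠ 0 → 1 / |α| ≤ z →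
        ‖(∑ n ∈ (Finset.Icc 1 ⌊z⌋₊).filter
              (fun n => ∀ p : ℕ, p.Prime → p ∣ n → (p : ℝ) ≤ y),
            e2pi (n * α) / n) -
          ((∑ n ∈ (Finset.Icc 1 ⌊1 / |α|⌋₊).filter
              (fun n => ∀ p : ℕ, p.Prime → p ∣ n → (p : ℝ) ≤ y),
            (1 : ℝ) / n : ℝ) : ℂ)‖ ≤ C := by
  obtain ⟨C, hC, h⟩ := SmoothExpSum.exists_norm_smExp_tail_le
  refine ⟨2 * Real.pi + C, by positivity, fun y α z hy hα hα0 hz => ?_⟩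
  have hα' : 0 < |α| := abs_pos.2 hα0
  have hNZ : ⌊1 / |α|⌋₊ ≤ ⌊z⌋₊ := Nat.floor_le_floor hz
  have e1 : ∑ n ∈ (Finset.Icc 1 ⌊z⌋₊).filter
      (fun n : ℕ => ∀ p : ℕ, p.Prime → p ∣ n → (p : ℝ) ≤ y), e2pi (n * α) / n =
      SmoothExpSum.smExp y α 0 ⌊z⌋₊ := by
    rw [SmoothExpSum.sum_filter_smooth, SmoothExpSum.smExp]
    exact Finset.sum_congr rfl fun n _ => Complex.real_smul
  have e2 : ∑ n ∈ (Finset.Icc 1 ⌊1 / |α|⌋₊).filter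
      (fun n : ℕ => ∀ p : ℕ, p.Prime → p ∣ n → (p : ℝ) ≤ y), (1 : ℝ) / n =
      SmoothExpSum.smSum y ⌊1 / |α|⌋₊ := by
    rw [SmoothExpSum.sum_filter_smooth, SmoothExpSum.smSum]
    exact Finset.sum_congr rfl fun n _ => by rw [smul_eq_mul, mul_one_div]
  rw [e1, e2, SmoothExpSum.smExp_split y α (Nat.zero_le ⌊1 / |α|⌋₊), min_eq_right hNZ,
    add_sub_right_comm]
  refine (norm_add_le _ _).trans (add_le_add ?_ (h y α _ _ hy ?_))
  · refine (SmoothExpSum.norm_smExp_sub_smSum_le _ _ _).trans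
      (mul_le_of_le_one_right (by positivity) ?_)
    rw [← le_div_iff₀ hα']
    exact Nat.floor_le (by positivity)
  · rw [SmoothExpSum.distInt_eq_abs hα, ← div_le_iff₀ hα']
    exact (Nat.lt_floor_add_one _).le
end

section
/- There is an absolute constant C > 0 such that for every real ε ∈ (0, 1], every integer k ≥ 2, every real σ ≥ (2+ε)/(2+2ε), and every real y ≥ k^{1+ε}, one has ∑_{n ≥ 1, P⁻(n) > y} d_k(n)²/n^{2σ} ≤ exp(C·k/log k). -/
open Real Complex MeasureTheory
open scoped BigOperators

attribute [local instance] Classical.propDecidable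

/-- `d_k(n)` : the number of ordered `k`-tuples of positive integers with product `n`. -/
noncomputable def dk (k n : ℕ) : ℕ :=
  Nat.card {t : Fin k → ℕ // (∀ i, 0 < t i) ∧ ∏ i, t i = n}

lemma zeta_pow_succ_apply (k n : ℕ) :
    (ArithmeticFunction.zeta ^ (k + 1)) n =
      ∑ x ∈ n.divisorsAntidiagonal, (ArithmeticFunction.zeta ^ k) x.2 := by
  rw [pow_succ', ArithmeticFunction.mul_apply]
  refine Finset.sum_congr rfl fun x hx => ?_
  rw [ArithmeticFunction.zeta_apply_ne (Nat.left_ne_zero_of_mem_divisorsAntidiagonal hx), one_mul]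

lemma card_finMulAntidiag_succ (k n : ℕ) :
    (Nat.finMulAntidiag (k + 1) n).card =
      ∑ x ∈ n.divisorsAntidiagonal, (Nat.finMulAntidiag k x.2).card := by
  rw [← Finset.card_sigma]
  refine Finset.card_nbij' (fun t => ⟨(t 0, ∏ i : Fin k, t i.succ), fun i => t i.succ⟩)
    (fun u => Fin.cons u.1.1 u.2) ?_ ?_ ?_ ?_
  · intro t ht
    have ht' := Nat.mem_finMulAntidiag.mp (Finset.mem_coe.mp ht)
    rw [Fin.prod_univ_succ] at ht'
    have hne : ∏ i : Fin k, t i.succ ≠ 0 := fun h => ht'.2 (by rw [← ht'.1, h, mul_zero])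
    simp only [Finset.coe_sigma, Set.mem_sigma_iff, Finset.mem_coe,
      Nat.mem_divisorsAntidiagonal, Nat.mem_finMulAntidiag]
    exact ⟨ht', trivial, hne⟩
  · rintro ⟨x, u⟩ h
    simp only [Finset.coe_sigma, Set.mem_sigma_iff, Finset.mem_coe,
      Nat.mem_divisorsAntidiagonal, Nat.mem_finMulAntidiag] at h
    simp only [Finset.mem_coe, Nat.mem_finMulAntidiag, Fin.prod_univ_succ, Fin.cons_zero,
      Fin.cons_succ]
    rw [h.2.1]
    exact h.1
  · intro t _
    exact Fin.cons_self_tail t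
  · rintro ⟨⟨a, b⟩, u⟩ h
    simp only [Finset.coe_sigma, Set.mem_sigma_iff, Finset.mem_coe,
      Nat.mem_divisorsAntidiagonal, Nat.mem_finMulAntidiag] at h
    simp [h.2.1]

lemma card_finMulAntidiag_eq_zeta_pow (k n : ℕ) :
    (Nat.finMulAntidiag k n).card =
      (ArithmeticFunction.zeta ^ k) n := by
  induction k generalizing n with
  | zero =>
    rw [pow_zero, ArithmeticFunction.one_apply]
    split_ifs with h
    · subst h; simp [Nat.finMulAntidiag_one]
    · simp [Nat.finMulAntidiag_zero_left h]
  | succ k ih =>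
    rw [card_finMulAntidiag_succ, zeta_pow_succ_apply]
    exact Finset.sum_congr rfl fun x _ => ih x.2

lemma dk_eq_zeta_pow (k n : ℕ) : dk k n = (ArithmeticFunction.zeta ^ k) n := by
  rw [← card_finMulAntidiag_eq_zeta_pow, dk, ← Nat.card_eq_finsetCard]
  refine Nat.card_congr (Equiv.subtypeEquivRight fun t => ?_)
  rw [Nat.mem_finMulAntidiag]
  constructor
  · rintro ⟨hpos, rfl⟩
    exact ⟨rfl, (Finset.prod_pos fun i _ => hpos i).ne'⟩
  · rintro ⟨rfl, hne⟩
    exact ⟨fun i => Nat.pos_of_ne_zero (Finset.prod_ne_zero_iff.mp hne i (Finset.mem_univ i)), rfl⟩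

/-- `d_k(p^a)` is the number of multisets of size `a` on `k` letters. -/
lemma dk_prime_pow {p : ℕ} (hp : p.Prime) (k a : ℕ) : dk k (p ^ a) = k.multichoose a := by
  rw [dk_eq_zeta_pow]
  have hsucc (k a : ℕ) : (ArithmeticFunction.zeta ^ (k + 1)) (p ^ a) =
      ∑ b ∈ Finset.range (a + 1), (ArithmeticFunction.zeta ^ k) (p ^ b) := by
    rw [zeta_pow_succ_apply,
      Nat.sum_divisorsAntidiagonal' (fun _ d => (ArithmeticFunction.zeta ^ k) d),
      Nat.sum_divisors_prime_pow hp]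
  induction k generalizing a with
  | zero =>
    cases a with
    | zero => simp
    | succ a =>
      rw [pow_zero, ArithmeticFunction.one_apply_ne (Nat.one_lt_pow a.succ_ne_zero hp.one_lt).ne',
        Nat.multichoose_zero_succ]
  | succ k ih =>
    induction a with
    | zero => rw [hsucc, zero_add, Finset.sum_range_one, ih, Nat.multichoose_zero_right,
        Nat.multichoose_zero_right]
    | succ a iha =>
      rw [hsucc, Finset.sum_range_succ, ← hsucc, iha, ih, Nat.multichoose_succ_succ, add_comm]

lemma dk_mul_of_coprime (k : ℕ) {m n : ℕ} (h : m.Coprime n) :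
    dk k (m * n) = dk k m * dk k n := by
  simp only [dk_eq_zeta_pow]
  exact ArithmeticFunction.isMultiplicative_zeta.pow.map_mul_of_coprime h

lemma multichoose_succ_mul (k a : ℕ) :
    (a + 1) * k.multichoose (a + 1) = (k + a) * k.multichoose a := by
  cases k with
  | zero => cases a <;> simp
  | succ k =>
    have h := Nat.add_one_mul_choose_eq (k + a) a
    simp only [Nat.multichoose_eq, show k + 1 + (a + 1) - 1 = k + a + 1 by omega,
      show k + 1 + a - 1 = k + a by omega]
    linarith

/-- For `k ≥ 2`, the multiset coefficient is smaller than `k ^ a` by a geometric factor. -/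
lemma multichoose_succ_le {k : ℕ} (hk : 2 ≤ k) (a : ℕ) :
    (k.multichoose (a + 1) : ℝ) ≤ (k : ℝ) ^ (a + 1) * (3 / 4) ^ a := by
  have hk' : (2 : ℝ) ≤ k := by exact_mod_cast hk
  induction a with
  | zero => simp
  | succ a ih =>
    have h : ((a : ℝ) + 1 + 1) * k.multichoose (a + 1 + 1) =
        (k + (a + 1)) * k.multichoose (a + 1) := by
      exact_mod_cast multichoose_succ_mul k (a + 1)
    have ha : (0 : ℝ) ≤ a := a.cast_nonneg
    have hstep : (k : ℝ) + (a + 1) ≤ (a + 1 + 1) * (k * (3 / 4)) := by nlinarith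
    refine le_of_mul_le_mul_left ?_ (by positivity : (0 : ℝ) < a + 1 + 1)
    calc ((a : ℝ) + 1 + 1) * k.multichoose (a + 1 + 1)
        = (k + (a + 1)) * k.multichoose (a + 1) := h
      _ ≤ ((a + 1 + 1) * (k * (3 / 4))) * (k ^ (a + 1) * (3 / 4) ^ a) := by gcongr
      _ = (a + 1 + 1) * ((k : ℝ) ^ (a + 1 + 1) * (3 / 4) ^ (a + 1)) := by ring

/-- Dyadic form of the Chebyshev bound for `∑ log p / p ^ (3/2)` over primes `p > y`. -/
lemma sum_log_mul_rpow_le_of_le_two_pow_mul (J : ℕ) {y : ℝ} (hy : 0 < y) (S : Finset ℕ)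
    (hS : ∀ p ∈ S, p.Prime ∧ y < p ∧ (p : ℝ) ≤ 2 ^ J * y) :
    ∑ p ∈ S, Real.log p * (p : ℝ) ^ (-(3 / 2) : ℝ) ≤ 10 * y ^ (-(1 / 2) : ℝ) := by
  induction J generalizing y S with
  | zero =>
    have : S = ∅ := Finset.eq_empty_of_forall_notMem fun p hp => by
      have := hS p hp
      simp only [pow_zero, one_mul] at this
      linarith [this.2.1, this.2.2]
    subst this
    simp only [Finset.sum_empty]
    positivity
  | succ J ih =>
    rw [← Finset.sum_filter_add_sum_filter_not S (fun p : ℕ => (p : ℝ) ≤ 2 * y)]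
    have hfar := ih (y := 2 * y) (by positivity) (S.filter fun p : ℕ => ¬ (p : ℝ) ≤ 2 * y) (by
      intro p hp
      obtain ⟨hpS, hp2⟩ := Finset.mem_filter.mp hp
      obtain ⟨h1, _, h3⟩ := hS p hpS
      exact ⟨h1, not_le.mp hp2, h3.trans_eq (by ring)⟩)
    have hnear : ∑ p ∈ S with ((p : ℕ) : ℝ) ≤ 2 * y, Real.log p * (p : ℝ) ^ (-(3 / 2) : ℝ) ≤
        (Real.log 4 * (2 * y)) * y ^ (-(3 / 2) : ℝ) := by
      calc ∑ p ∈ S with ((p : ℕ) : ℝ) ≤ 2 * y, Real.log p * (p : ℝ) ^ (-(3 / 2) : ℝ)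
          ≤ ∑ p ∈ S with ((p : ℕ) : ℝ) ≤ 2 * y, Real.log p * y ^ (-(3 / 2) : ℝ) := by
            refine Finset.sum_le_sum fun p hp => ?_
            obtain ⟨_, h2, _⟩ := hS p (Finset.mem_filter.mp hp).1
            exact mul_le_mul_of_nonneg_left
              (Real.rpow_le_rpow_of_nonpos hy h2.le (by norm_num)) (Real.log_natCast_nonneg p)
        _ = (∑ p ∈ S with ((p : ℕ) : ℝ) ≤ 2 * y, Real.log p) * y ^ (-(3 / 2) : ℝ) := by
            rw [Finset.sum_mul]
        _ ≤ Chebyshev.theta (2 * y) * y ^ (-(3 / 2) : ℝ) := by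
            refine mul_le_mul_of_nonneg_right ?_ (by positivity)
            refine Finset.sum_le_sum_of_subset_of_nonneg (fun p hp => ?_)
              fun p _ _ => Real.log_natCast_nonneg p
            obtain ⟨hpS, hp2⟩ := Finset.mem_filter.mp hp
            have hpp := (hS p hpS).1
            simp only [Finset.mem_filter, Finset.mem_Ioc]
            exact ⟨⟨hpp.pos, Nat.le_floor hp2⟩, hpp⟩
        _ ≤ _ := by
            gcongr
            exact Chebyshev.theta_le_log4_mul_x (by positivity)
    have hpow : y * y ^ (-(3 / 2) : ℝ) = y ^ (-(1 / 2) : ℝ) := by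
      rw [← Real.rpow_one_add' hy.le (by norm_num)]
      norm_num
    have hlog : Real.log 4 ≤ 1.39 := by
      rw [show (4 : ℝ) = 2 ^ 2 by norm_num, Real.log_pow]
      have := Real.log_two_lt_d9
      push_cast
      linarith
    have htwo : (2 : ℝ) ^ (-(1 / 2) : ℝ) ≤ 0.71 := by
      rw [Real.rpow_neg (by norm_num), ← Real.sqrt_eq_rpow]
      refine inv_le_of_inv_le₀ (by norm_num) (Real.le_sqrt_of_sq_le (by norm_num))
    rw [Real.mul_rpow (by norm_num) hy.le] at hfar
    have hy0 : 0 < y ^ (-(1 / 2) : ℝ) := by positivity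
    have hnear' : (Real.log 4 * (2 * y)) * y ^ (-(3 / 2) : ℝ) =
        2 * Real.log 4 * y ^ (-(1 / 2) : ℝ) := by rw [← hpow]; ring
    rw [hnear'] at hnear
    nlinarith [mul_le_mul_of_nonneg_right hlog hy0.le, mul_le_mul_of_nonneg_right htwo hy0.le]

/-- Chebyshev's bound for the tail `∑ p ^ (-3/2)` over primes `p > y`. -/
lemma sum_prime_rpow_le {y : ℝ} (hy : 1 < y) (S : Finset ℕ)
    (hS : ∀ p ∈ S, p.Prime ∧ y < p) :
    ∑ p ∈ S, (p : ℝ) ^ (-(3 / 2) : ℝ) ≤ 10 * y ^ (-(1 / 2) : ℝ) / Real.log y := by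
  have hy0 : 0 < y := by linarith
  obtain ⟨J, hJ⟩ := pow_unbounded_of_one_lt ((S.sup id : ℕ) : ℝ) (one_lt_two (α := ℝ))
  rw [le_div_iff₀ (Real.log_pos hy), Finset.sum_mul]
  refine le_trans (Finset.sum_le_sum fun p hp => ?_)
    (sum_log_mul_rpow_le_of_le_two_pow_mul J hy0 S fun p hp => ⟨(hS p hp).1, (hS p hp).2, ?_⟩)
  · rw [mul_comm]
    exact mul_le_mul_of_nonneg_right (Real.log_le_log hy0 (hS p hp).2.le) (by positivity)
  · have h1 : (p : ℝ) ≤ ((S.sup id : ℕ) : ℝ) := by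
      exact_mod_cast Finset.le_sup (f := id) hp
    nlinarith [pow_pos (two_pos (α := ℝ)) J]

/-- The local Euler factor of `∑ d_k(n)² n^(-2σ)` at a prime `p` with `k² ≤ p^(2σ)`. -/
lemma euler_factor_le {k : ℕ} (hk : 2 ≤ k) {p : ℕ} (hp : p.Prime) {σ : ℝ}
    (hx : (k : ℝ) ^ 2 / (p : ℝ) ^ (2 * σ) ≤ 1) :
    Summable (fun a : ℕ => (dk k (p ^ a) : ℝ) ^ 2 / ((p ^ a : ℕ) : ℝ) ^ (2 * σ)) ∧
    ∑' a : ℕ, (dk k (p ^ a) : ℝ) ^ 2 / ((p ^ a : ℕ) : ℝ) ^ (2 * σ) ≤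
      Real.exp (3 * ((k : ℝ) ^ 2 / (p : ℝ) ^ (2 * σ))) := by
  set x := (k : ℝ) ^ 2 / (p : ℝ) ^ (2 * σ) with hxdef
  have hx0 : 0 ≤ x := by positivity
  have hterm (a : ℕ) : (dk k (p ^ (a + 1)) : ℝ) ^ 2 / ((p ^ (a + 1) : ℕ) : ℝ) ^ (2 * σ) ≤
      x * (9 / 16) ^ a := by
    have hpw : ((p ^ (a + 1) : ℕ) : ℝ) ^ (2 * σ) = ((p : ℝ) ^ (2 * σ)) ^ (a + 1) := by
      rw [Nat.cast_pow, ← Real.rpow_natCast, ← Real.rpow_natCast, ← Real.rpow_mul (by positivity),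
        ← Real.rpow_mul (by positivity), mul_comm]
    rw [dk_prime_pow hp, hpw]
    calc (k.multichoose (a + 1) : ℝ) ^ 2 / ((p : ℝ) ^ (2 * σ)) ^ (a + 1)
        ≤ ((k : ℝ) ^ (a + 1) * (3 / 4) ^ a) ^ 2 / ((p : ℝ) ^ (2 * σ)) ^ (a + 1) := by
          gcongr
          exact multichoose_succ_le hk a
      _ = x ^ (a + 1) * ((3 / 4) ^ 2) ^ a := by
          rw [hxdef, div_pow ((k : ℝ) ^ 2), mul_pow, pow_right_comm (k : ℝ), pow_right_comm (3 / 4 : ℝ)]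
          ring
      _ = x ^ a * (x * (9 / 16) ^ a) := by norm_num; ring
      _ ≤ 1 * (x * (9 / 16) ^ a) := by
          gcongr
          exact pow_le_one₀ hx0 hx
      _ = x * (9 / 16) ^ a := one_mul _
  have hgeo : HasSum (fun a : ℕ => x * (9 / 16 : ℝ) ^ a) (x * (1 - 9 / 16)⁻¹) :=
    (hasSum_geometric_of_lt_one (by norm_num) (by norm_num)).mul_left x
  have hs1 : Summable (fun a : ℕ =>
      (dk k (p ^ (a + 1)) : ℝ) ^ 2 / ((p ^ (a + 1) : ℕ) : ℝ) ^ (2 * σ)) :=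
    hgeo.summable.of_nonneg_of_le (fun a => by positivity) hterm
  have hs : Summable (fun a : ℕ => (dk k (p ^ a) : ℝ) ^ 2 / ((p ^ a : ℕ) : ℝ) ^ (2 * σ)) :=
    (summable_nat_add_iff 1).mp hs1
  refine ⟨hs, ?_⟩
  rw [hs.tsum_eq_zero_add, dk_prime_pow hp]
  have htail := (hs1.tsum_le_tsum hterm hgeo.summable).trans_eq hgeo.tsum_eq
  have hexp := Real.add_one_le_exp (3 * x)
  norm_num at htail ⊢
  linarith

/-- A finite partial sum of `d_k(n)² n^(-2σ)` over `y`-rough numbers is bounded by a finite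
product over primes exceeding `y`. -/
lemma sum_rough_le_exp {k : ℕ} (hk : 2 ≤ k) {σ y : ℝ}
    (hx : ∀ p : ℕ, p.Prime → y < p → (k : ℝ) ^ 2 / (p : ℝ) ^ (2 * σ) ≤ 1) (T : Finset ℕ)
    (hT : ∀ n ∈ T, 1 ≤ n ∧ ∀ p : ℕ, p.Prime → p ∣ n → y < (p : ℝ)) :
    ∃ S : Finset ℕ, (∀ p ∈ S, p.Prime ∧ y < p) ∧
      ∑ n ∈ T, (dk k n : ℝ) ^ 2 / (n : ℝ) ^ (2 * σ) ≤
        Real.exp (3 * ∑ p ∈ S, (k : ℝ) ^ 2 / (p : ℝ) ^ (2 * σ)) := by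
  let rough : ℕ → Prop := fun n => ∀ p : ℕ, p.Prime → p ∣ n → y < (p : ℝ)
  let f : ℕ → ℝ := fun n => if rough n then (dk k n : ℝ) ^ 2 / (n : ℝ) ^ (2 * σ) else 0
  have hf0 (n : ℕ) : 0 ≤ f n := by
    simp only [f]; split_ifs <;> positivity
  have hrough1 : rough 1 := fun p hp h => absurd (Nat.dvd_one.mp h) hp.one_lt.ne'
  have hf1 : f 1 = 1 := by
    have : dk k 1 = 1 := by simpa using dk_prime_pow Nat.prime_two k 0
    simp [f, hrough1, this]
  have hmul {m n : ℕ} (h : m.Coprime n) : f (m * n) = f m * f n := by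
    have hiff : rough (m * n) ↔ rough m ∧ rough n :=
      ⟨fun H => ⟨fun p hp hd => H p hp (hd.mul_right n), fun p hp hd => H p hp (hd.mul_left m)⟩,
        fun H p hp hd => (hp.dvd_mul.mp hd).elim (H.1 p hp) (H.2 p hp)⟩
    by_cases hm : rough m <;> by_cases hn : rough n <;> simp only [f, hiff, hm, hn] <;> simp
    rw [dk_mul_of_coprime k h, Real.mul_rpow (by positivity) (by positivity)]
    push_cast
    ring
  have hfp {p : ℕ} (hp : p.Prime) (hyp : y < p) (a : ℕ) :
      f (p ^ a) = (dk k (p ^ a) : ℝ) ^ 2 / ((p ^ a : ℕ) : ℝ) ^ (2 * σ) := by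
    refine if_pos fun q hq hd => ?_
    rwa [(Nat.prime_dvd_prime_iff_eq hq hp).mp (hq.dvd_of_dvd_pow hd)]
  have hsum {p : ℕ} (hp : p.Prime) : Summable (fun a : ℕ => ‖f (p ^ a)‖) := by
    simp only [Real.norm_of_nonneg (hf0 _)]
    by_cases hyp : y < p
    · simpa only [hfp hp hyp] using (euler_factor_le hk hp (hx p hp hyp)).1
    · refine summable_of_ne_finset_zero (s := {0}) fun a ha => if_neg fun H => hyp ?_
      exact H p hp (dvd_pow_self p (by simpa using ha))
  let S : Finset ℕ := (T.biUnion Nat.primeFactors).filter fun p => y < (p : ℝ)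
  have hS : ∀ p ∈ S, p.Prime ∧ y < p := fun p hp => by
    obtain ⟨h1, h2⟩ := Finset.mem_filter.mp hp
    obtain ⟨n, _, hn⟩ := Finset.mem_biUnion.mp h1
    exact ⟨Nat.prime_of_mem_primeFactors hn, h2⟩
  refine ⟨S, hS, ?_⟩
  obtain ⟨_, hE⟩ :=
    EulerProduct.summable_and_hasSum_factoredNumbers_prod_filter_prime_tsum hf1 hmul hsum S
  have hTS : ∀ n ∈ T, n ∈ Nat.factoredNumbers S := fun n hn => by
    refine Nat.mem_factoredNumbers_of_primeFactors_subset
      (Nat.one_le_iff_ne_zero.mp (hT n hn).1) fun p hp => ?_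
    exact Finset.mem_filter.mpr ⟨Finset.mem_biUnion.mpr ⟨n, hn, hp⟩,
      (hT n hn).2 p (Nat.prime_of_mem_primeFactors hp) (Nat.dvd_of_mem_primeFactors hp)⟩
  calc ∑ n ∈ T, (dk k n : ℝ) ^ 2 / (n : ℝ) ^ (2 * σ)
      = ∑ n ∈ T, f n := Finset.sum_congr rfl fun n hn => (if_pos (hT n hn).2).symm
    _ = ∑ n ∈ T.subtype (· ∈ Nat.factoredNumbers S), f n := by
        rw [Finset.sum_subtype_of_mem f hTS]
    _ ≤ ∏ p ∈ S with p.Prime, ∑' a : ℕ, f (p ^ a) :=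
        sum_le_hasSum _ (fun n _ => hf0 n) hE
    _ = ∏ p ∈ S, ∑' a : ℕ, f (p ^ a) := by
        rw [Finset.filter_true_of_mem fun p hp => (hS p hp).1]
    _ ≤ ∏ p ∈ S, Real.exp (3 * ((k : ℝ) ^ 2 / (p : ℝ) ^ (2 * σ))) := by
        refine Finset.prod_le_prod (fun p _ => tsum_nonneg fun a => hf0 _) fun p hp => ?_
        obtain ⟨hpp, hyp⟩ := hS p hp
        simpa only [hfp hpp hyp] using (euler_factor_le hk hpp (hx p hpp hyp)).2
    _ = _ := by rw [← Real.exp_sum, Finset.mul_sum]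

/-- Lemma 6: moments of `d_k` on rough numbers. -/
theorem dk_squared_rough_bound :
    ∃ C : ℝ, 0 < C ∧
      ∀ ε : ℝ, 0 < ε → ε ≤ 1 → ∀ k : ℕ, 2 ≤ k → ∀ σ y : ℝ,
        (2 + ε) / (2 + 2 * ε) ≤ σ → (k : ℝ) ^ ((1 : ℝ) + ε) ≤ y →
        (∑' n : {n : ℕ // 1 ≤ n ∧ ∀ p : ℕ, p.Prime → p ∣ (n : ℕ) → y < (p : ℝ)},
            (dk k n : ℝ) ^ 2 / ((n : ℕ) : ℝ) ^ (2 * σ)) ≤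
          Real.exp (C * k / Real.log k) := by
  refine ⟨30, by norm_num, fun ε hε hε1 k hk σ y hσ hy => ?_⟩
  have hk2 : (2 : ℝ) ≤ k := by exact_mod_cast hk
  have hk0 : (0 : ℝ) < k := by linarith
  have hk1 : (1 : ℝ) ≤ k := by linarith
  have hky : (k : ℝ) ≤ y :=
    (Real.self_le_rpow_of_one_le hk1 (by linarith)).trans hy
  have hy0 : 0 < y := by linarith
  have hlogk : 0 < Real.log k := Real.log_pos (by linarith)
  have hσ' : 1 + 1 / (1 + ε) ≤ 2 * σ := by
    refine le_trans (le_of_eq ?_) (mul_le_mul_of_nonneg_left hσ two_pos.le)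
    field_simp
    ring
  have hδ : 1 / 2 ≤ 1 / (1 + ε) := one_div_le_one_div_of_le (by linarith) (by linarith)
  have hδy : (k : ℝ) ≤ y ^ (1 / (1 + ε)) := by
    calc (k : ℝ) = ((k : ℝ) ^ (1 + ε)) ^ (1 / (1 + ε)) := by
          rw [← Real.rpow_mul hk0.le, mul_one_div_cancel (by linarith), Real.rpow_one]
      _ ≤ y ^ (1 / (1 + ε)) := by gcongr
  have hterm (p : ℕ) (hyp : y < p) : (k : ℝ) ^ 2 / (p : ℝ) ^ (2 * σ) ≤
      k * y ^ (1 / 2 : ℝ) * (p : ℝ) ^ (-(3 / 2) : ℝ) := by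
    have hp0 : (0 : ℝ) < p := by linarith
    have hpow : y ^ (1 / (1 + ε) - 1 / 2) ≤ (p : ℝ) ^ (2 * σ - 3 / 2) :=
      calc y ^ (1 / (1 + ε) - 1 / 2) ≤ (p : ℝ) ^ (1 / (1 + ε) - 1 / 2) :=
            Real.rpow_le_rpow hy0.le hyp.le (by linarith)
        _ ≤ (p : ℝ) ^ (2 * σ - 3 / 2) :=
            Real.rpow_le_rpow_of_exponent_le (by linarith) (by linarith)
    rw [div_le_iff₀ (by positivity)]
    calc (k : ℝ) ^ 2 ≤ k * y ^ (1 / (1 + ε)) := by rw [sq]; gcongr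
      _ = k * (y ^ (1 / 2 : ℝ) * y ^ (1 / (1 + ε) - 1 / 2)) := by
          rw [← Real.rpow_add hy0]; ring_nf
      _ ≤ k * (y ^ (1 / 2 : ℝ) * (p : ℝ) ^ (2 * σ - 3 / 2)) := by gcongr
      _ = k * (y ^ (1 / 2 : ℝ) * ((p : ℝ) ^ (-(3 / 2) : ℝ) * (p : ℝ) ^ (2 * σ))) := by
          rw [← Real.rpow_add hp0]; ring_nf
      _ = _ := by ring
  have hx (p : ℕ) (_ : p.Prime) (hyp : y < p) : (k : ℝ) ^ 2 / (p : ℝ) ^ (2 * σ) ≤ 1 := by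
    have hp0 : (0 : ℝ) < p := by linarith
    refine (hterm p hyp).trans ?_
    calc k * y ^ (1 / 2 : ℝ) * (p : ℝ) ^ (-(3 / 2) : ℝ)
        ≤ p * (p : ℝ) ^ (1 / 2 : ℝ) * (p : ℝ) ^ (-(3 / 2) : ℝ) := by
          gcongr
          exact_mod_cast hky.trans hyp.le
      _ = 1 := by
          nth_rewrite 1 [← Real.rpow_one (p : ℝ)]
          rw [← Real.rpow_add hp0, ← Real.rpow_add hp0]
          norm_num
  refine Real.tsum_le_of_sum_le (fun n => by positivity) fun T => ?_
  obtain ⟨S, hS, hle⟩ := sum_rough_le_exp hk hx (T.map (Function.Embedding.subtype _))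
    (fun n hn => by
      obtain ⟨m, _, rfl⟩ := Finset.mem_map.mp hn
      exact m.2)
  rw [Finset.sum_map] at hle
  refine hle.trans (Real.exp_le_exp.mpr ?_)
  have hsum : ∑ p ∈ S, (k : ℝ) ^ 2 / (p : ℝ) ^ (2 * σ) ≤ 10 * k / Real.log k :=
    calc ∑ p ∈ S, (k : ℝ) ^ 2 / (p : ℝ) ^ (2 * σ)
        ≤ ∑ p ∈ S, k * y ^ (1 / 2 : ℝ) * (p : ℝ) ^ (-(3 / 2) : ℝ) :=
          Finset.sum_le_sum fun p hp => hterm p (hS p hp).2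
      _ = k * y ^ (1 / 2 : ℝ) * ∑ p ∈ S, (p : ℝ) ^ (-(3 / 2) : ℝ) := by rw [Finset.mul_sum]
      _ ≤ k * y ^ (1 / 2 : ℝ) * (10 * y ^ (-(1 / 2) : ℝ) / Real.log y) := by
          gcongr
          exact sum_prime_rpow_le (by linarith) S hS
      _ = 10 * k / Real.log y := by
          rw [Real.rpow_neg hy0.le]
          field_simp
      _ ≤ 10 * k / Real.log k := by gcongr
  calc 3 * ∑ p ∈ S, (k : ℝ) ^ 2 / (p : ℝ) ^ (2 * σ) ≤ 3 * (10 * k / Real.log k) := by gcongr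
    _ = 30 * k / Real.log k := by ring
end
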